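/- For every K > 0 and for λ²-almost every (ξ, x) ∈ [0,1)², liminf_{N→∞} [log λ({y ∈ [0,1) : |H(ξ_{-N}, y) − H(ξ_{-N}, x_{-N})| ≤ K·2^{-N/2}}) / log 2^{-N}] ≥ 1, where (ξ_{-N}, x_{-N}) = B^{-N}(ξ, x) and λ is Lebesgue measure on [0,1). -/

import Mathlib

open Real MeasureTheory Set Filter

noncomputable section

/-- The Euclidean plane. -/
abbrev E2 : Type := EuclideanSpace ℝ (Fin 2)

/-- The unit vector `(cos t, sin t)` in the Euclidean plane. -/
def cs (t : ℝ) : E2 := (WithLp.equiv 2 (Fin 2 → ℝ)).symm ![Real.cos t, Real.sin t]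

/-- The vector `(-sin t, cos t)` in the Euclidean plane. -/
def cs' (t : ℝ) : E2 := (WithLp.equiv 2 (Fin 2 → ℝ)).symm ![-Real.sin t, Real.cos t]

/-- The two-dimensional Weierstrass function
`W(x) = ∑_{n≥0} 2^{-n/2} (cos (2π 2^n x), sin (2π 2^n x))`. -/
def Wfn (x : ℝ) : E2 := ∑' n : ℕ, (2 : ℝ) ^ (-(n : ℝ) / 2) • cs (2 * π * 2 ^ n * x)

/-- `dig j ξ` is the `j`-th binary digit of `ξ`: `⌊2^j ξ⌋ mod 2` (as a real number). -/
def dig (j : ℕ) (ξ : ℝ) : ℝ := ((⌊(2 : ℝ) ^ j * ξ⌋ % 2 : ℤ) : ℝ)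

/-- `rho n ξ = ∑_{i=1}^n d_{n+1-i}(ξ) 2^{-i}`. -/
def rho (n : ℕ) (ξ : ℝ) : ℝ := ∑ i ∈ Finset.Icc 1 n, dig (n + 1 - i) ξ / 2 ^ i

/-- `x` is a dyadic rational. -/
def dyadic (x : ℝ) : Prop := ∃ (k : ℕ) (m : ℤ), x = (m : ℝ) / 2 ^ k

/-- The stable-direction function
`S(ξ,x) = -2π ∑_{n≥1} 2^{-n/2} (-sin (2π(ρ_n(ξ)+x/2^n)), cos (2π(ρ_n(ξ)+x/2^n)))`. -/
def Sfn (ξ x : ℝ) : E2 :=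
  (-(2 * π)) • ∑' n : ℕ,
    (2 : ℝ) ^ (-((n : ℝ) + 1) / 2) • cs' (2 * π * (rho (n + 1) ξ + x / 2 ^ (n + 1)))

/-- The function `H` given by the doubly infinite series
`H(ξ,x) = ∑_{n≥0} 2^{-n/2} ((cos,sin)(2π 2^n x) - (1,0))
        + ∑_{k≥1} 2^{k/2} ((cos,sin)(2π(ρ_k(ξ)+x/2^k)) - (cos,sin)(2π ρ_k(ξ)))`. -/
def Hfn (ξ x : ℝ) : E2 :=
  (∑' n : ℕ, (2 : ℝ) ^ (-(n : ℝ) / 2) •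
      (cs (2 * π * 2 ^ n * x) - (WithLp.equiv 2 (Fin 2 → ℝ)).symm ![1, 0]))
  + ∑' k : ℕ, (2 : ℝ) ^ (((k : ℝ) + 1) / 2) •
      (cs (2 * π * (rho (k + 1) ξ + x / 2 ^ (k + 1))) - cs (2 * π * rho (k + 1) ξ))

/-- The baker transformation `B(ξ,x) = (2ξ mod 1, (⌊2ξ⌋ + x)/2)`. -/
def baker (p : ℝ × ℝ) : ℝ × ℝ :=
  (Int.fract (2 * p.1), ((⌊2 * p.1⌋ : ℝ) + p.2) / 2)

/-- The unit square `[0,1)²`. -/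
def usq : Set (ℝ × ℝ) := Ico (0:ℝ) 1 ×ˢ Ico (0:ℝ) 1

/-- The explicit formula for the `N`-th backward iterate of the baker transformation:
`B^{-N}(ξ,x) = (ξ/2^N + ∑_{j=1}^N d_j(x) 2^{-(N+1-j)}, 2^N x mod 1)`. -/
def bakerInvN (N : ℕ) (p : ℝ × ℝ) : ℝ × ℝ :=
  (p.1 / 2 ^ N + ∑ j ∈ Finset.Icc 1 N, dig j p.2 / 2 ^ (N + 1 - j),
    Int.fract ((2 : ℝ) ^ N * p.2))

/-- The additive character `t ↦ exp (2π i t)`. -/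
def ee (t : ℝ) : ℂ := Complex.exp (((2 * π * t : ℝ) : ℂ) * Complex.I)

lemma norm_ee (t : ℝ) : ‖ee t‖ = 1 := Complex.norm_exp_ofReal_mul_I _

lemma ee_add (s t : ℝ) : ee (s + t) = ee s * ee t := by
  unfold ee; rw [← Complex.exp_add]; congr 1; push_cast; ring

lemma ee_int (n : ℤ) : ee n = 1 := by
  unfold ee
  rw [show (((2 * π * (n : ℝ) : ℝ) : ℂ) * Complex.I) = n * (2 * π * Complex.I) by push_cast; ring]
  exact Complex.exp_int_mul_two_pi_mul_I n

lemma ee_zero : ee 0 = 1 := by simpa using ee_int 0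

lemma ee_add_int (t : ℝ) (n : ℤ) : ee (t + n) = ee t := by rw [ee_add, ee_int, mul_one]

lemma norm_ee_sub_le (s t : ℝ) : ‖ee s - ee t‖ ≤ 2 * π * |s - t| := by
  have h : ee s - ee t = ee t * (ee (s - t) - 1) := by
    rw [mul_sub, ← ee_add]; simp
  rw [h, norm_mul, norm_ee, one_mul]
  have := Real.norm_exp_I_mul_ofReal_sub_one_le (x := 2 * π * (s - t))
  rw [mul_comm, Real.norm_eq_abs, abs_mul, abs_of_pos (by positivity : 2 * π > 0)] at this
  exact this

lemma norm_ee_sub_sub_le (s t : ℝ) :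
    ‖ee s - ee t - ((2 * π * (s - t) : ℝ) : ℂ) * Complex.I * ee t‖
      ≤ 3 * (2 * π * (s - t)) ^ 2 := by
  have h : ee s - ee t - ((2 * π * (s - t) : ℝ) : ℂ) * Complex.I * ee t
      = ee t * (Complex.exp (((2 * π * (s - t) : ℝ) : ℂ) * Complex.I) - 1
        - ((2 * π * (s - t) : ℝ) : ℂ) * Complex.I) := by
    have : ee s = ee t * Complex.exp (((2 * π * (s - t) : ℝ) : ℂ) * Complex.I) := by
      change ee s = ee t * ee (s - t)
      rw [← ee_add]; simp
    rw [this]; ring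
  rw [h, norm_mul, norm_ee, one_mul]
  set u : ℝ := 2 * π * (s - t)
  have hn : ‖(u : ℂ) * Complex.I‖ = |u| := by simp
  by_cases hu : |u| ≤ 1
  · refine (Complex.norm_exp_sub_one_sub_id_le (by rw [hn]; exact hu)).trans ?_
    rw [hn, sq_abs]; nlinarith [sq_nonneg u]
  · push Not at hu
    have h1 : ‖Complex.exp ((u : ℂ) * Complex.I) - 1 - (u : ℂ) * Complex.I‖ ≤ 1 + 1 + |u| := by
      refine (norm_sub_le _ _).trans ?_
      rw [hn]
      gcongr
      refine (norm_sub_le _ _).trans ?_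
      rw [Complex.norm_exp_ofReal_mul_I]; simp
    refine h1.trans ?_
    rw [← sq_abs u]; nlinarith

lemma continuous_ee : Continuous ee := by unfold ee; fun_prop

/-- The contraction ratio `2^{-1/2}`. -/
def ww : ℝ := (√2)⁻¹

lemma ww_pos : 0 < ww := by unfold ww; positivity
lemma ww_sq : ww ^ 2 = 1 / 2 := by unfold ww; rw [inv_pow, Real.sq_sqrt (by norm_num)]; norm_num
lemma ww_mul_self : ww * ww = 1 / 2 := by rw [← sq, ww_sq]
lemma ww_lt : ww < 0.7072 := by nlinarith [ww_sq, ww_pos]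
lemma ww_gt : 0.707 < ww := by nlinarith [ww_sq, ww_pos]
lemma ww_lt_one : ww < 1 := ww_lt.trans (by norm_num)
lemma ww_inv : ww⁻¹ = 2 * ww := by
  have := ww_mul_self
  field_simp [ww_pos.ne']; linarith
lemma ww_pow_two_mul (n : ℕ) : ww ^ (2 * n) = (1 / 2) ^ n := by rw [pow_mul, ww_sq]
lemma ww_inv_pow (n : ℕ) : ww⁻¹ ^ n = 2 ^ n * ww ^ n := by rw [ww_inv, mul_pow]

lemma summable_ww : Summable (fun n : ℕ => ww ^ n) :=
  summable_geometric_of_lt_one ww_pos.le ww_lt_one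

/-- The `n`-th term of the forward series. -/
def zf (x : ℝ) (n : ℕ) : ℂ := (ww ^ n : ℝ) * (ee (2 ^ n * x) - 1)

/-- The `k`-th term of the backward series (index shifted by one). -/
def zb (ξ x : ℝ) (k : ℕ) : ℂ :=
  (ww⁻¹ ^ (k + 1) : ℝ) * (ee (rho (k + 1) ξ + x / 2 ^ (k + 1)) - ee (rho (k + 1) ξ))

/-- The complex form of `Hfn`. -/
def Zfn (ξ x : ℝ) : ℂ := (∑' n, zf x n) + ∑' k, zb ξ x k

lemma norm_zf_le (x : ℝ) (n : ℕ) : ‖zf x n‖ ≤ 2 * ww ^ n := by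
  unfold zf
  rw [norm_mul, Complex.norm_real, Real.norm_of_nonneg (pow_nonneg ww_pos.le n), mul_comm]
  gcongr
  · exact pow_nonneg ww_pos.le n
  · refine (norm_sub_le _ _).trans ?_
    rw [norm_ee]; norm_num

lemma summable_zf (x : ℝ) : Summable (zf x) :=
  Summable.of_norm_bounded (summable_ww.mul_left 2) (norm_zf_le x)

lemma norm_zb_le (ξ x : ℝ) (k : ℕ) : ‖zb ξ x k‖ ≤ 2 * π * |x| * ww ^ (k + 1) := by
  unfold zb
  rw [norm_mul, Complex.norm_real, Real.norm_of_nonneg (pow_nonneg (inv_nonneg.2 ww_pos.le) _)]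
  have := norm_ee_sub_le (rho (k + 1) ξ + x / 2 ^ (k + 1)) (rho (k + 1) ξ)
  rw [add_sub_cancel_left, abs_div, abs_of_pos (by positivity : (0:ℝ) < 2 ^ (k + 1))] at this
  calc _ ≤ ww⁻¹ ^ (k + 1) * (2 * π * (|x| / 2 ^ (k + 1))) := by
        gcongr
        exact pow_nonneg (inv_nonneg.2 ww_pos.le) _
    _ = _ := by rw [ww_inv_pow]; field_simp

lemma summable_zb (ξ x : ℝ) : Summable (zb ξ x) :=
  Summable.of_norm_bounded
    (((summable_nat_add_iff 1).2 summable_ww).mul_left (2 * π * |x|)) (norm_zb_le ξ x)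

/-- The isometric identification of `ℂ` with the Euclidean plane. -/
def toE : ℂ ≃ₗᵢ[ℝ] E2 := Complex.orthonormalBasisOneI.repr

lemma toE_apply (z : ℂ) : toE z = (WithLp.equiv 2 (Fin 2 → ℝ)).symm ![z.re, z.im] := by
  ext i
  fin_cases i <;> simp [toE]

lemma toE_ee (t : ℝ) : toE (ee t) = cs (2 * π * t) := by
  rw [toE_apply]; unfold cs ee
  rw [Complex.exp_ofReal_mul_I_re, Complex.exp_ofReal_mul_I_im]

lemma toE_real_mul (a : ℝ) (z : ℂ) : toE ((a : ℂ) * z) = a • toE z := by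
  rw [← Complex.real_smul, map_smul]

lemma toE_one : toE 1 = (WithLp.equiv 2 (Fin 2 → ℝ)).symm ![1, 0] := by
  rw [toE_apply]; simp

lemma ww_pow_eq_rpow (n : ℕ) : ww ^ n = (2 : ℝ) ^ (-(n : ℝ) / 2) := by
  unfold ww
  rw [Real.sqrt_eq_rpow, ← Real.rpow_neg (by norm_num), ← Real.rpow_natCast,
    ← Real.rpow_mul (by norm_num)]
  congr 1; ring

lemma ww_inv_pow_eq_rpow (n : ℕ) : ww⁻¹ ^ n = (2 : ℝ) ^ ((n : ℝ) / 2) := by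
  rw [inv_pow, ww_pow_eq_rpow, ← Real.rpow_neg (by norm_num)]
  congr 1; ring

lemma Hfn_eq (ξ x : ℝ) : Hfn ξ x = toE (Zfn ξ x) := by
  unfold Hfn Zfn
  rw [map_add]
  have hm : ∀ f : ℕ → ℂ, toE (∑' n, f n) = ∑' n, toE (f n) := fun f =>
    toE.toContinuousLinearEquiv.map_tsum
  rw [hm, hm]
  congr 1
  · refine tsum_congr fun n => ?_
    rw [zf, toE_real_mul, map_sub, toE_ee, toE_one, ww_pow_eq_rpow]
    congr 3; ring
  · refine tsum_congr fun k => ?_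
    rw [zb, toE_real_mul, map_sub, toE_ee, toE_ee, ww_inv_pow_eq_rpow]
    push_cast; rfl

lemma norm_Hfn_sub (ξ x y : ℝ) : ‖Hfn ξ x - Hfn ξ y‖ = ‖Zfn ξ x - Zfn ξ y‖ := by
  rw [Hfn_eq, Hfn_eq, ← map_sub, LinearIsometryEquiv.norm_map]

lemma norm_Zfn_le (ξ x : ℝ) (hx : |x| ≤ 1) : ‖Zfn ξ x‖ ≤ 60 := by
  have h0 : (1 - ww)⁻¹ ≤ 5 := by
    rw [inv_le_comm₀ (by linarith [ww_lt_one]) (by norm_num)]; linarith [ww_lt]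
  have h1 : ‖∑' n, zf x n‖ ≤ 2 * (1 - ww)⁻¹ :=
    tsum_of_norm_bounded ((hasSum_geometric_of_lt_one ww_pos.le ww_lt_one).mul_left 2) (norm_zf_le x)
  have h2 : ‖∑' n, zb ξ x n‖ ≤ 2 * π * (1 - ww)⁻¹ := by
    refine tsum_of_norm_bounded
      ((hasSum_geometric_of_lt_one ww_pos.le ww_lt_one).mul_left (2 * π)) fun k => ?_
    refine (norm_zb_le ξ x k).trans ?_
    have : ww ^ (k + 1) ≤ ww ^ k := pow_le_pow_of_le_one ww_pos.le ww_lt_one.le (Nat.le_succ k)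
    have hp : 0 ≤ ww ^ (k + 1) := pow_nonneg ww_pos.le _
    calc 2 * π * |x| * ww ^ (k + 1) ≤ 2 * π * 1 * ww ^ k := by gcongr
      _ = _ := by ring
  unfold Zfn
  refine (norm_add_le _ _).trans ?_
  have := Real.pi_lt_four
  have := Real.pi_pos
  nlinarith

lemma norm_Zfn_sub_le (ξ x y : ℝ) (hx : |x| ≤ 1) (hy : |y| ≤ 1) : ‖Zfn ξ x - Zfn ξ y‖ ≤ 128 := by
  refine (norm_sub_le _ _).trans ?_
  linarith [norm_Zfn_le ξ x hx, norm_Zfn_le ξ y hy]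

lemma measurable_dig (j : ℕ) : Measurable (dig j) := by
  unfold dig
  have : Measurable (fun n : ℤ => ((n % 2 : ℤ) : ℝ)) := measurable_from_top
  exact this.comp (Int.measurable_floor.comp (measurable_const_mul _))

lemma measurable_rho (n : ℕ) : Measurable (rho n) := by
  unfold rho
  exact Finset.measurable_fun_sum _ fun i _ => (measurable_dig _).div_const _

lemma measurable_Zfn : Measurable (fun p : ℝ × ℝ => Zfn p.1 p.2) := by
  unfold Zfn
  have h1 : ∀ n : ℕ, Measurable (fun p : ℝ × ℝ => zf p.2 n) := fun n => by
    unfold zf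
    have := continuous_ee
    fun_prop
  have h2 : ∀ n : ℕ, Measurable (fun p : ℝ × ℝ => zb p.1 p.2 n) := fun n => by
    unfold zb
    have := continuous_ee.measurable
    have := measurable_rho (n + 1)
    fun_prop
  refine Measurable.add ?_ ?_
  · refine measurable_of_tendsto_metrizable
      (f := fun N (p : ℝ × ℝ) => ∑ n ∈ Finset.range N, zf p.2 n)
      (fun N => Finset.measurable_fun_sum _ fun i _ => h1 i) ?_
    rw [tendsto_pi_nhds]
    exact fun p => (summable_zf p.2).hasSum.tendsto_sum_nat
  · refine measurable_of_tendsto_metrizable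
      (f := fun N (p : ℝ × ℝ) => ∑ n ∈ Finset.range N, zb p.1 p.2 n)
      (fun N => Finset.measurable_fun_sum _ fun i _ => h2 i) ?_
    rw [tendsto_pi_nhds]
    exact fun p => (summable_zb p.1 p.2).hasSum.tendsto_sum_nat

/-- The inverse of the baker transformation. -/
def bb (p : ℝ × ℝ) : ℝ × ℝ := ((p.1 + (⌊2 * p.2⌋ : ℝ)) / 2, Int.fract (2 * p.2))

lemma floor_two_mul_fract (t : ℝ) : ⌊2 * Int.fract t⌋ = ⌊2 * t⌋ % 2 := by
  have h1 : ⌊2 * t⌋ / 2 = ⌊t⌋ := by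
    simpa using Int.natCast_mul_floor_div_cancel (n := 2) (by norm_num) t
  have h2 : 2 * Int.fract t = 2 * t - ((2 * ⌊t⌋ : ℤ) : ℝ) := by
    rw [Int.fract]; push_cast; ring
  rw [h2, Int.floor_sub_intCast]; omega

lemma fract_two_mul_fract (t : ℝ) : Int.fract (2 * Int.fract t) = Int.fract (2 * t) := by
  have h2 : 2 * Int.fract t = 2 * t - ((2 * ⌊t⌋ : ℤ) : ℝ) := by
    rw [Int.fract]; push_cast; ring
  rw [h2, Int.fract_sub_intCast]

lemma dig_succ_eq (N : ℕ) (x : ℝ) : dig (N + 1) x = (⌊2 * Int.fract (2 ^ N * x)⌋ : ℝ) := by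
  rw [floor_two_mul_fract, dig, show (2:ℝ) ^ (N + 1) * x = 2 * (2 ^ N * x) by ring]

lemma bakerInvN_succ (N : ℕ) (p : ℝ × ℝ) : bakerInvN (N + 1) p = bb (bakerInvN N p) := by
  unfold bakerInvN bb
  refine Prod.ext ?_ ?_
  · simp only
    rw [← dig_succ_eq, Finset.sum_Icc_succ_top (by omega)]
    have : ∑ k ∈ Finset.Icc 1 N, dig k p.2 / 2 ^ (N + 1 + 1 - k)
        = (∑ k ∈ Finset.Icc 1 N, dig k p.2 / 2 ^ (N + 1 - k)) / 2 := by
      rw [Finset.sum_div]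
      refine Finset.sum_congr rfl fun k hk => ?_
      have := (Finset.mem_Icc.1 hk).2
      rw [show N + 1 + 1 - k = (N + 1 - k) + 1 by omega, pow_succ, div_div]
    rw [this, show N + 1 + 1 - (N + 1) = 1 by omega]
    ring
  · simp only
    rw [fract_two_mul_fract]; congr 1; ring

lemma bakerInvN_eq (N : ℕ) (p : ℝ × ℝ) (hp : p ∈ usq) : bakerInvN N p = bb^[N] p := by
  induction N with
  | zero =>
    unfold bakerInvN
    simp only [Function.iterate_zero, id]
    refine Prod.ext ?_ ?_
    · simp
    · simpa using Int.fract_eq_self.2 hp.2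
  | succ n ih => rw [bakerInvN_succ, ih, Function.iterate_succ_apply']

lemma rho_succ (n : ℕ) (ξ : ℝ) : rho (n + 1) ξ = dig (n + 1) ξ / 2 + rho n ξ / 2 := by
  unfold rho
  have h : ∀ (n : ℕ) (f : ℕ → ℝ), ∑ i ∈ Finset.Icc 1 n, f i = ∑ i ∈ Finset.range n, f (i + 1) := by
    intro n f
    rw [Finset.range_eq_Ico, Finset.sum_Ico_add' f 0 n 1]
    rfl
  rw [h, h, Finset.sum_range_succ', Finset.sum_div, add_comm]
  congr 1
  · simp
  · refine Finset.sum_congr rfl fun i _ => ?_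
    rw [show n + 1 + 1 - (i + 1 + 1) = n + 1 - (i + 1) by omega, pow_succ, div_div]

lemma rho_zero (ξ : ℝ) : rho 0 ξ = 0 := by simp [rho]

lemma floor_bit {x : ℝ} (hx : x ∈ Ico (0:ℝ) 1) : ⌊2 * x⌋ = 0 ∨ ⌊2 * x⌋ = 1 := by
  have h1 : 0 ≤ ⌊2 * x⌋ := Int.floor_nonneg.2 (by linarith [hx.1])
  have h2 : ⌊2 * x⌋ < 2 := Int.floor_lt.2 (by push_cast; linarith [hx.2])
  omega

lemma dig_one_branch {ξ : ℝ} (hξ : ξ ∈ Ico (0:ℝ) 1) {d : ℤ} (hd : d = 0 ∨ d = 1) :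
    dig 1 ((ξ + d) / 2) = d := by
  unfold dig
  rw [show (2:ℝ) ^ 1 * ((ξ + d) / 2) = ξ + d by ring, Int.floor_add_intCast,
    Int.floor_eq_zero_iff.2 hξ]
  rcases hd with rfl | rfl <;> simp

lemma dig_succ_branch (ξ : ℝ) (d : ℤ) (j : ℕ) :
    dig (j + 2) ((ξ + d) / 2) = dig (j + 1) ξ := by
  unfold dig
  have h : (2:ℝ) ^ (j + 2) * ((ξ + d) / 2) = 2 ^ (j + 1) * ξ + ((2 * (2 ^ j * d) : ℤ) : ℝ) := by
    push_cast; ring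
  rw [h, Int.floor_add_intCast]
  congr 1; omega

lemma rho_branch {ξ : ℝ} (hξ : ξ ∈ Ico (0:ℝ) 1) {d : ℤ} (hd : d = 0 ∨ d = 1) (n : ℕ) :
    rho (n + 1) ((ξ + d) / 2) = rho n ξ + d / 2 ^ (n + 1) := by
  induction n with
  | zero => rw [rho_succ, rho_zero, rho_zero, zero_add, dig_one_branch hξ hd]; ring
  | succ n ih =>
    rw [rho_succ, ih, dig_succ_branch, rho_succ n ξ]
    rw [pow_succ _ (n + 1)]; field_simp; ring

lemma Zfn_sub (ξ x y : ℝ) :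
    Zfn ξ x - Zfn ξ y = (∑' n, (zf x n - zf y n)) + ∑' k, (zb ξ x k - zb ξ y k) := by
  unfold Zfn
  rw [(summable_zf x).tsum_sub (summable_zf y), (summable_zb ξ x).tsum_sub (summable_zb ξ y)]
  ring

lemma zf_sub (x y : ℝ) (n : ℕ) :
    zf x n - zf y n = (ww ^ n : ℝ) * (ee (2 ^ n * x) - ee (2 ^ n * y)) := by
  unfold zf; ring

lemma zb_sub (ξ x y : ℝ) (k : ℕ) :
    zb ξ x k - zb ξ y k = (ww⁻¹ ^ (k + 1) : ℝ) *
      (ee (rho (k + 1) ξ + x / 2 ^ (k + 1)) - ee (rho (k + 1) ξ + y / 2 ^ (k + 1))) := by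
  unfold zb; ring

lemma Zfn_branch {ξ : ℝ} (hξ : ξ ∈ Ico (0:ℝ) 1) {d : ℤ} (hd : d = 0 ∨ d = 1) (x y : ℝ) :
    Zfn ξ ((d + x) / 2) - Zfn ξ ((d + y) / 2)
      = (ww : ℂ) * (Zfn ((ξ + d) / 2) x - Zfn ((ξ + d) / 2) y) := by
  have hw : (ww : ℂ) ≠ 0 := by exact_mod_cast ww_pos.ne'
  rw [Zfn_sub, Zfn_sub, mul_add, ← tsum_mul_left, ← tsum_mul_left]
  have s1 := (summable_zf ((d + x) / 2)).sub (summable_zf ((d + y) / 2))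
  have s2 := ((summable_zb ((ξ + d) / 2) x).sub (summable_zb ((ξ + d) / 2) y)).mul_left (ww : ℂ)
  rw [s1.tsum_eq_zero_add, s2.tsum_eq_zero_add]
  have e1 : ∀ n, zf ((d + x) / 2) (n + 1) - zf ((d + y) / 2) (n + 1)
      = (ww : ℂ) * (zf x n - zf y n) := by
    intro n
    rw [zf_sub, zf_sub]
    have : ∀ u : ℝ, ee (2 ^ (n + 1) * ((d + u) / 2)) = ee (2 ^ n * u) := by
      intro u
      rw [← ee_add_int (2 ^ n * u) (2 ^ n * d)]
      congr 1; push_cast; ring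
    rw [this, this, pow_succ]; push_cast; ring
  have e2 : ∀ k, (ww : ℂ) * (zb ((ξ + d) / 2) x (k + 1) - zb ((ξ + d) / 2) y (k + 1))
      = zb ξ ((d + x) / 2) k - zb ξ ((d + y) / 2) k := by
    intro k
    rw [zb_sub, zb_sub, rho_branch hξ hd]
    have : ∀ u : ℝ, rho (k + 1) ξ + d / 2 ^ (k + 1 + 1) + u / 2 ^ (k + 1 + 1)
        = rho (k + 1) ξ + (d + u) / 2 / 2 ^ (k + 1) := by
      intro u; rw [pow_succ _ (k + 1)]; field_simp; ring
    rw [this, this, pow_succ _ (k + 1)]; push_cast; field_simp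
  have e0 : zf ((d + x) / 2) 0 - zf ((d + y) / 2) 0
      = (ww : ℂ) * (zb ((ξ + d) / 2) x 0 - zb ((ξ + d) / 2) y 0) := by
    rw [zb_sub, zf_sub, rho_branch hξ hd, rho_zero]
    have : ∀ u : ℝ, (0:ℝ) + d / 2 ^ (0 + 1) + u / 2 ^ (0 + 1) = 2 ^ 0 * ((d + u) / 2) := by
      intro u; ring
    rw [this, this]; push_cast; field_simp
  rw [tsum_congr e1, e0, ← tsum_congr e2]
  ring

lemma dig_eq_zero_or_one (m : ℕ) (ξ : ℝ) : dig m ξ = 0 ∨ dig m ξ = 1 := by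
  unfold dig
  rcases Int.emod_two_eq_zero_or_one ⌊(2:ℝ) ^ m * ξ⌋ with h | h <;> simp [h]

lemma floor_even_of_dig {m : ℕ} {ξ : ℝ} (h : dig m ξ = 0) : ⌊(2:ℝ) ^ m * ξ⌋ % 2 = 0 := by
  unfold dig at h; exact_mod_cast h

lemma dig_shift_lt {m k : ℕ} {ξ : ℝ} (h : dig m ξ = 0) (hk : k < m) :
    dig k (ξ + 1 / 2 ^ m) = dig k ξ := by
  have h0 := floor_even_of_dig h
  obtain ⟨j, rfl⟩ : ∃ j, m = k + (j + 1) := ⟨m - k - 1, by omega⟩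
  have key : ∀ t : ℝ, ⌊(2:ℝ) ^ k * t⌋ = ⌊(2:ℝ) ^ (k + (j + 1)) * t⌋ / 2 / 2 ^ j := by
    intro t
    have := Int.natCast_mul_floor_div_cancel (n := 2 ^ (j + 1)) (by positivity) ((2:ℝ) ^ k * t)
    rw [← this, Int.ediv_ediv_of_nonneg (by norm_num)]
    congr 1
    · congr 1; push_cast; ring
    · push_cast; ring
  have h1 : ⌊(2:ℝ) ^ (k + (j + 1)) * (ξ + 1 / 2 ^ (k + (j + 1)))⌋
      = ⌊(2:ℝ) ^ (k + (j + 1)) * ξ⌋ + 1 := by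
    rw [mul_add, mul_one_div_cancel (by positivity)]
    exact_mod_cast Int.floor_add_intCast _ 1
  unfold dig
  have h2 : (⌊(2:ℝ) ^ (k + (j + 1)) * ξ⌋ + 1) / 2 = ⌊(2:ℝ) ^ (k + (j + 1)) * ξ⌋ / 2 := by omega
  rw [key, key ξ, h1, h2]

lemma dig_shift_self {m : ℕ} {ξ : ℝ} (h : dig m ξ = 0) :
    dig m (ξ + 1 / 2 ^ m) = dig m ξ + 1 := by
  have h0 := floor_even_of_dig h
  have h1 : ⌊(2:ℝ) ^ m * (ξ + 1 / 2 ^ m)⌋ = ⌊(2:ℝ) ^ m * ξ⌋ + 1 := by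
    rw [mul_add, mul_one_div_cancel (by positivity)]
    exact_mod_cast Int.floor_add_intCast _ 1
  unfold dig
  rw [h1, Int.add_emod, h0]; norm_num

lemma dig_shift_gt {m k : ℕ} (ξ : ℝ) (hk : m < k) :
    dig k (ξ + 1 / 2 ^ m) = dig k ξ := by
  obtain ⟨j, rfl⟩ : ∃ j, k = m + (j + 1) := ⟨k - m - 1, by omega⟩
  have h1 : (2:ℝ) ^ (m + (j + 1)) * (ξ + 1 / 2 ^ m)
      = 2 ^ (m + (j + 1)) * ξ + ((2 * 2 ^ j : ℤ) : ℝ) := by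
    push_cast; rw [pow_add, pow_succ]; field_simp
  unfold dig
  rw [h1, Int.floor_add_intCast]
  congr 1; omega

lemma rho_shift_lt {m : ℕ} {ξ : ℝ} (h : dig m ξ = 0) (n : ℕ) (hn : n < m) :
    rho n (ξ + 1 / 2 ^ m) = rho n ξ := by
  induction n with
  | zero => simp [rho_zero]
  | succ n ih => rw [rho_succ, rho_succ n ξ, ih (by omega), dig_shift_lt h hn]

lemma rho_shift_ge {m : ℕ} (hm : 0 < m) {ξ : ℝ} (h : dig m ξ = 0) (i : ℕ) :
    rho (m + i) (ξ + 1 / 2 ^ m) = rho (m + i) ξ + 1 / 2 ^ (i + 1) := by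
  induction i with
  | zero =>
    obtain ⟨n, rfl⟩ : ∃ n, m = n + 1 := ⟨m - 1, by omega⟩
    rw [add_zero, rho_succ, rho_succ n ξ, dig_shift_self h, rho_shift_lt h n (by omega)]
    ring
  | succ i ih =>
    rw [← add_assoc, rho_succ, rho_succ (m + i) ξ, ih, dig_shift_gt ξ (by omega), pow_succ _ (i + 1)]
    field_simp; ring

/-- The `i`-th term of the series for the direction of the displacement caused by flipping the
`m`-th digit. -/
def vt (m : ℕ) (ξ : ℝ) (i : ℕ) : ℂ :=
  (ww ^ i : ℝ) * (ee (rho (m + i) ξ + 1 / 2 ^ (i + 1)) - ee (rho (m + i) ξ))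

/-- The direction of the displacement caused by flipping the `m`-th digit. -/
def VV (m : ℕ) (ξ : ℝ) : ℂ := ∑' i, vt m ξ i

lemma norm_vt_le (m : ℕ) (ξ : ℝ) (i : ℕ) : ‖vt m ξ i‖ ≤ π * ww ^ i * (1 / 2) ^ i := by
  unfold vt
  rw [norm_mul, Complex.norm_real, Real.norm_of_nonneg (pow_nonneg ww_pos.le i)]
  have h := norm_ee_sub_le (rho (m + i) ξ + 1 / 2 ^ (i + 1)) (rho (m + i) ξ)
  rw [add_sub_cancel_left, abs_of_pos (by positivity)] at h
  have hw := pow_nonneg ww_pos.le i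
  calc _ ≤ ww ^ i * (2 * π * (1 / 2 ^ (i + 1))) := by gcongr
    _ = _ := by rw [pow_succ, one_div_pow]; field_simp

lemma ww_half : ww * (1 / 2) < 0.3536 := by linarith [ww_lt]

lemma vt_bound_hasSum : HasSum (fun i => π * ww ^ i * (1 / 2 : ℝ) ^ i)
    (π * (1 - ww * (1 / 2))⁻¹) := by
  have := (hasSum_geometric_of_lt_one (r := ww * (1 / 2)) (by linarith [ww_pos])
    (by linarith [ww_half])).mul_left π
  refine this.congr_fun ?_ |> fun h => h
  intro i; simp only [mul_pow, mul_assoc]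

lemma summable_vt (m : ℕ) (ξ : ℝ) : Summable (vt m ξ) :=
  Summable.of_norm_bounded vt_bound_hasSum.summable (norm_vt_le m ξ)

lemma norm_VV_le (m : ℕ) (ξ : ℝ) : ‖VV m ξ‖ ≤ 5 := by
  refine (tsum_of_norm_bounded vt_bound_hasSum (norm_vt_le m ξ)).trans ?_
  have h := ww_half
  have h2 : (1 - ww * (1 / 2))⁻¹ ≤ 1.55 := by
    rw [inv_le_comm₀ (by linarith) (by norm_num)]; linarith
  have := Real.pi_lt_d2
  nlinarith [Real.pi_pos]

/-- Displacement estimate: flipping the `m`-th digit moves the fibre, up to a translation, by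
`(x - y) • v` with an error of smaller order. -/
lemma shift_estimate {m : ℕ} (hm : 0 < m) {ξ : ℝ} (h : dig m ξ = 0) {x y : ℝ}
    (hx : |x| ≤ 1) (hy : |y| ≤ 1) :
    ‖(Zfn (ξ + 1 / 2 ^ m) x - Zfn (ξ + 1 / 2 ^ m) y) - (Zfn ξ x - Zfn ξ y)
        - ((2 * π * (x - y) * ww ^ m : ℝ) : ℂ) * (Complex.I * VV m ξ)‖
      ≤ 1200 * ww ^ m * (1 / 2) ^ m := by
  set ξ' := ξ + 1 / 2 ^ m with hξ'
  obtain ⟨n, rfl⟩ : ∃ n, m = n + 1 := ⟨m - 1, by omega⟩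
  set g : ℕ → ℂ := fun k => (zb ξ' x k - zb ξ' y k) - (zb ξ x k - zb ξ y k) with hg
  have sg : Summable g :=
    ((summable_zb ξ' x).sub (summable_zb ξ' y)).sub ((summable_zb ξ x).sub (summable_zb ξ y))
  have e0 : (Zfn ξ' x - Zfn ξ' y) - (Zfn ξ x - Zfn ξ y) = ∑' i, g (i + n) := by
    rw [Zfn_sub, Zfn_sub, add_sub_add_left_eq_sub,
      ← (((summable_zb ξ' x).sub (summable_zb ξ' y)).tsum_sub
        ((summable_zb ξ x).sub (summable_zb ξ y))), ← sg.sum_add_tsum_nat_add n]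
    rw [Finset.sum_eq_zero, zero_add]
    intro k hk
    have hk := Finset.mem_range.1 hk
    rw [hg]; simp only
    rw [zb_sub, zb_sub, rho_shift_lt h (k + 1) (by omega), sub_self]
  set c : ℂ := ((2 * π * (x - y) * ww ^ (n + 1) : ℝ) : ℂ) * Complex.I with hc
  rw [← mul_assoc, ← hc, e0, VV, ← tsum_mul_left,
    ← ((summable_nat_add_iff n).2 sg).tsum_sub ((summable_vt _ _).mul_left c)]
  have hterm : ∀ i, ‖g (i + n) - c * vt (n + 1) ξ i‖
      ≤ (48 * π ^ 2 * ww ^ (n + 1) * (1 / 2) ^ (n + 1)) * (ww * (1 / 2)) ^ i := by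
    intro i
    set a := rho (n + 1 + i) ξ with ha
    set a' := a + 1 / 2 ^ (i + 1) with ha'
    set X := x / 2 ^ (n + 1 + i) with hX
    set Y := y / 2 ^ (n + 1 + i) with hY
    have e1 : g (i + n) = (ww⁻¹ ^ (n + 1 + i) : ℝ) *
        ((ee (a' + X) - ee (a' + Y)) - (ee (a + X) - ee (a + Y))) := by
      rw [hg]; simp only
      rw [zb_sub, zb_sub, show i + n + 1 = n + 1 + i by ring, rho_shift_ge hm h]
      ring
    have e2 : c * vt (n + 1) ξ i = (ww⁻¹ ^ (n + 1 + i) : ℝ) *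
        (((2 * π * (X - Y) : ℝ) : ℂ) * Complex.I * (ee a' - ee a)) := by
      rw [hc, vt, ww_inv_pow, hX, hY, ← ha, ← ha', ← sub_div]
      push_cast
      field_simp
      ring
    have e3 : ∀ b : ℝ, ‖(ee (b + X) - ee (b + Y)) - ((2 * π * (X - Y) : ℝ) : ℂ) * Complex.I * ee b‖
        ≤ 6 * (2 * π) ^ 2 / (2 ^ (n + 1 + i)) ^ 2 := by
      intro b
      have h1 := norm_ee_sub_sub_le (b + X) b
      have h2 := norm_ee_sub_sub_le (b + Y) b
      rw [add_sub_cancel_left] at h1 h2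
      have e4 : (ee (b + X) - ee (b + Y)) - ((2 * π * (X - Y) : ℝ) : ℂ) * Complex.I * ee b
          = (ee (b + X) - ee b - ((2 * π * X : ℝ) : ℂ) * Complex.I * ee b)
            - (ee (b + Y) - ee b - ((2 * π * Y : ℝ) : ℂ) * Complex.I * ee b) := by
        push_cast; ring
      rw [e4]
      refine (norm_sub_le _ _).trans ((add_le_add h1 h2).trans ?_)
      have hx2 : x ^ 2 ≤ 1 := by rw [← sq_abs]; nlinarith [abs_nonneg x]
      have hy2 : y ^ 2 ≤ 1 := by rw [← sq_abs]; nlinarith [abs_nonneg y]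
      have : 3 * (2 * π * X) ^ 2 + 3 * (2 * π * Y) ^ 2
          = (3 * (2 * π) ^ 2 * (x ^ 2 + y ^ 2)) / (2 ^ (n + 1 + i)) ^ 2 := by
        rw [hX, hY]; ring
      rw [this]
      refine div_le_div_of_nonneg_right ?_ (by positivity)
      nlinarith [sq_nonneg (2 * π)]
    have e5 : g (i + n) - c * vt (n + 1) ξ i = (ww⁻¹ ^ (n + 1 + i) : ℝ) *
        (((ee (a' + X) - ee (a' + Y)) - ((2 * π * (X - Y) : ℝ) : ℂ) * Complex.I * ee a')
        - ((ee (a + X) - ee (a + Y)) - ((2 * π * (X - Y) : ℝ) : ℂ) * Complex.I * ee a)) := by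
      rw [e1, e2]; ring
    rw [e5, norm_mul, Complex.norm_real,
      Real.norm_of_nonneg (pow_nonneg (inv_nonneg.2 ww_pos.le) _)]
    have e6 := (norm_sub_le _ _).trans (add_le_add (e3 a') (e3 a))
    refine (mul_le_mul_of_nonneg_left e6 (pow_nonneg (inv_nonneg.2 ww_pos.le) _)).trans ?_
    rw [ww_inv_pow, pow_add, pow_add ww, mul_pow ww, one_div_pow, one_div_pow]
    apply le_of_eq
    field_simp
    ring
  refine (tsum_of_norm_bounded ((hasSum_geometric_of_lt_one (by linarith [ww_pos])
    (by linarith [ww_half])).mul_left _) hterm).trans ?_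
  have hh := ww_half
  have h2 : (1 - ww * (1 / 2))⁻¹ ≤ 1.55 := by
    rw [inv_le_comm₀ (by linarith) (by norm_num)]; linarith
  have := Real.pi_lt_d2
  have hw : 0 ≤ ww ^ (n + 1) * (1 / 2) ^ (n + 1) := by have := ww_pos; positivity
  have : 48 * π ^ 2 * (1 - ww * (1 / 2))⁻¹ ≤ 1200 := by
    have : 0 ≤ (1 - ww * (1 / 2))⁻¹ := by rw [inv_nonneg]; linarith
    nlinarith [Real.pi_pos, sq_nonneg π]
  nlinarith

lemma dig_nonneg (n : ℕ) (ξ : ℝ) : 0 ≤ dig n ξ := by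
  rcases dig_eq_zero_or_one n ξ with h | h <;> simp [h]

lemma rho_nonneg (n : ℕ) (ξ : ℝ) : 0 ≤ rho n ξ :=
  Finset.sum_nonneg fun _ _ => div_nonneg (dig_nonneg _ _) (by positivity)

lemma rho_le_one (n : ℕ) (ξ : ℝ) : rho n ξ ≤ 1 := by
  induction n with
  | zero => simp [rho_zero]
  | succ n ih => rw [rho_succ]; rcases dig_eq_zero_or_one (n + 1) ξ with h | h <;> rw [h] <;> linarith

lemma dig_add_eq (m i : ℕ) (ξ : ℝ) :
    dig (m + (i + 1)) ξ = dig (i + 1) (Int.fract (2 ^ m * ξ)) := by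
  unfold dig
  have h : (2:ℝ) ^ (m + (i + 1)) * ξ
      = 2 ^ (i + 1) * Int.fract (2 ^ m * ξ) + ((2 * (2 ^ i * ⌊(2:ℝ) ^ m * ξ⌋) : ℤ) : ℝ) := by
    rw [Int.fract]; push_cast; ring
  rw [h, Int.floor_add_intCast]
  congr 1; omega

/-- The set of points whose first twelve binary digits are `000000000100`. -/
def Wd : Set ℝ := Ico (4 / 4096) (5 / 4096)

lemma dig_of_floor {k : ℕ} {ζ : ℝ} (n : ℤ) (h1 : (n:ℝ) ≤ 2 ^ k * ζ) (h2 : 2 ^ k * ζ < n + 1) :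
    dig k ζ = ((n % 2 : ℤ) : ℝ) := by
  unfold dig; rw [Int.floor_eq_iff.2 ⟨h1, h2⟩]

lemma dig_Wd {ζ : ℝ} (h : ζ ∈ Wd) : (∀ i < 9, dig (i + 1) ζ = 0) ∧ dig 10 ζ = 1 ∧
    dig 11 ζ = 0 ∧ dig 12 ζ = 0 := by
  obtain ⟨h1, h2⟩ := h
  refine ⟨fun i hi => ?_, ?_, ?_, ?_⟩
  · have h3 : (2:ℝ) ^ (i + 1) ≤ 2 ^ 9 := pow_le_pow_right₀ (by norm_num) (by omega)
    have h4 : (0:ℝ) < 2 ^ (i + 1) := by positivity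
    rw [dig_of_floor 0 (by push_cast; nlinarith) (by push_cast; nlinarith)]; simp
  · rw [dig_of_floor 1 (by norm_num; linarith) (by norm_num; linarith)]; norm_num
  · rw [dig_of_floor 2 (by norm_num; linarith) (by norm_num; linarith)]; norm_num
  · rw [dig_of_floor 4 (by norm_num; linarith) (by norm_num; linarith)]; norm_num

lemma VV_approx (m : ℕ) (ξ : ℝ) (a b : ℝ) (ha : |rho m ξ - a| ≤ 1 / 256)
    (hb : |rho (m + 1) ξ - b| ≤ 1 / 512) :
    ‖VV m ξ - ((ee (a + 1 / 2) - ee a) + (ww : ℂ) * (ee (b + 1 / 4) - ee b))‖ ≤ 0.69 := by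
  have htail : ‖∑' i, vt m ξ (i + 2)‖ ≤ 0.61 := by
    have : ∀ i, ‖vt m ξ (i + 2)‖ ≤ π * (1 / 8) * (ww * (1 / 2)) ^ i := by
      intro i
      refine (norm_vt_le m ξ (i + 2)).trans (le_of_eq ?_)
      rw [mul_pow, pow_add, ww_sq, pow_add (1 / 2 : ℝ)]; ring
    refine (tsum_of_norm_bounded ((hasSum_geometric_of_lt_one (by linarith [ww_pos])
      (by linarith [ww_half])).mul_left _) this).trans ?_
    have h := ww_half
    have h2 : (1 - ww * (1 / 2))⁻¹ ≤ 1.548 := by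
      rw [inv_le_comm₀ (by linarith) (by norm_num)]; norm_num; linarith
    have := Real.pi_lt_d2
    nlinarith [Real.pi_pos]
  have hsplit : VV m ξ = vt m ξ 0 + vt m ξ 1 + ∑' i, vt m ξ (i + 2) := by
    rw [VV, ← (summable_vt m ξ).sum_add_tsum_nat_add 2]
    simp [Finset.sum_range_succ]
  have h0 : vt m ξ 0 = ee (rho m ξ + 1 / 2) - ee (rho m ξ) := by unfold vt; norm_num
  have h1 : vt m ξ 1 = (ww : ℂ) * (ee (rho (m + 1) ξ + 1 / 4) - ee (rho (m + 1) ξ)) := by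
    unfold vt; norm_num
  have e : VV m ξ - ((ee (a + 1 / 2) - ee a) + (ww : ℂ) * (ee (b + 1 / 4) - ee b))
      = ((ee (rho m ξ + 1 / 2) - ee (a + 1 / 2)) - (ee (rho m ξ) - ee a))
        + (ww : ℂ) * ((ee (rho (m + 1) ξ + 1 / 4) - ee (b + 1 / 4)) - (ee (rho (m + 1) ξ) - ee b))
        + ∑' i, vt m ξ (i + 2) := by
    rw [hsplit, h0, h1]; ring
  have d1 := norm_ee_sub_le (rho m ξ + 1 / 2) (a + 1 / 2)
  have d2 := norm_ee_sub_le (rho m ξ) a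
  have d3 := norm_ee_sub_le (rho (m + 1) ξ + 1 / 4) (b + 1 / 4)
  have d4 := norm_ee_sub_le (rho (m + 1) ξ) b
  rw [add_sub_add_right_eq_sub] at d1 d3
  have hp := Real.pi_lt_d2
  have hp0 := Real.pi_pos
  have f1 : 2 * π * |rho m ξ - a| ≤ 0.0247 := by nlinarith [abs_nonneg (rho m ξ - a)]
  have f2 : 2 * π * |rho (m + 1) ξ - b| ≤ 0.0124 := by nlinarith [abs_nonneg (rho (m + 1) ξ - b)]
  rw [e]
  refine (norm_add_le _ _).trans ?_
  have g1 := norm_add_le ((ee (rho m ξ + 1 / 2) - ee (a + 1 / 2)) - (ee (rho m ξ) - ee a))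
    ((ww : ℂ) * ((ee (rho (m + 1) ξ + 1 / 4) - ee (b + 1 / 4)) - (ee (rho (m + 1) ξ) - ee b)))
  rw [norm_mul, Complex.norm_real, Real.norm_of_nonneg ww_pos.le] at g1
  have g2 := norm_sub_le (ee (rho m ξ + 1 / 2) - ee (a + 1 / 2)) (ee (rho m ξ) - ee a)
  have g3 := norm_sub_le (ee (rho (m + 1) ξ + 1 / 4) - ee (b + 1 / 4)) (ee (rho (m + 1) ξ) - ee b)
  have g4 := mul_le_mul_of_nonneg_left g3 ww_pos.le
  have := ww_lt
  have := ww_pos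
  nlinarith

lemma ee_add_half (t : ℝ) : ee (t + 1 / 2) = -ee t := by
  rw [ee_add]
  have : ee (1 / 2) = -1 := by
    unfold ee
    rw [show ((2 * π * (1 / 2) : ℝ) : ℂ) = π by push_cast; ring, Complex.exp_pi_mul_I]
  rw [this]; ring

lemma ee_quarter : ee (1 / 4) = Complex.I := by
  unfold ee
  rw [show ((2 * π * (1 / 4) : ℝ) : ℂ) = π / 2 by push_cast; ring, Complex.exp_pi_div_two_mul_I]

lemma ee_eighth : ee (1 / 8) = (ww : ℂ) * (1 + Complex.I) := by
  have hw : ww = √2 / 2 := by unfold ww; rw [Real.sqrt_div_self', one_div]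
  apply Complex.ext
  · unfold ee
    rw [Complex.exp_ofReal_mul_I_re, show 2 * π * (1 / 8) = π / 4 by ring, Real.cos_pi_div_four, hw]
    simp
  · unfold ee
    rw [Complex.exp_ofReal_mul_I_im, show 2 * π * (1 / 8) = π / 4 by ring, Real.sin_pi_div_four, hw]
    simp

lemma pattern_dig {m : ℕ} {ξ : ℝ} (h : Int.fract (2 ^ m * ξ) ∈ Wd) :
    dig (m + 8) ξ = 0 ∧ dig (m + 11) ξ = 0 := by
  obtain ⟨h1, -, h3, -⟩ := dig_Wd h
  exact ⟨by rw [dig_add_eq m 7]; exact h1 7 (by norm_num), by rw [dig_add_eq m 10]; exact h3⟩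

/-- The two displacement directions produced by the pattern are quantitatively independent. -/
lemma pattern_indep {m : ℕ} {ξ : ℝ} (h : Int.fract (2 ^ m * ξ) ∈ Wd) (p q : ℝ) :
    |p| ≤ 2 * ‖(p : ℂ) * VV (m + 8) ξ + (q : ℂ) * VV (m + 11) ξ‖ ∧
    |q| ≤ 2 * ‖(p : ℂ) * VV (m + 8) ξ + (q : ℂ) * VV (m + 11) ξ‖ := by
  obtain ⟨z, h10, h11, h12⟩ := dig_Wd h
  have z' : ∀ i < 9, dig (m + (i + 1)) ξ = 0 := fun i hi => by rw [dig_add_eq]; exact z i hi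
  have d10 : dig (m + 10) ξ = 1 := by rw [dig_add_eq m 9]; exact h10
  have d11 : dig (m + 11) ξ = 0 := by rw [dig_add_eq m 10]; exact h11
  have d12 : dig (m + 12) ξ = 0 := by rw [dig_add_eq m 11]; exact h12
  have r0 : ∀ i ≤ 9, rho (m + i) ξ = rho m ξ / 2 ^ i := by
    intro i hi
    induction i with
    | zero => simp
    | succ i ih =>
      rw [← add_assoc, rho_succ, ih (by omega), add_assoc, z' i (by omega), pow_succ]
      ring
  have n0 := rho_nonneg m ξ
  have n1 := rho_le_one m ξ
  have r8 := r0 8 (by norm_num)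
  have r9 := r0 9 (by norm_num)
  have r10 : rho (m + 10) ξ = 1 / 2 + rho m ξ / 2 ^ 10 := by
    rw [show m + 10 = m + 9 + 1 by ring, rho_succ, r9, show m + 9 + 1 = m + 10 by ring, d10]; ring
  have r11 : rho (m + 11) ξ = 1 / 4 + rho m ξ / 2 ^ 11 := by
    rw [show m + 11 = m + 10 + 1 by ring, rho_succ, r10, show m + 10 + 1 = m + 11 by ring, d11]; ring
  have r12 : rho (m + 11 + 1) ξ = 1 / 8 + rho m ξ / 2 ^ 12 := by
    rw [rho_succ, r11, show m + 11 + 1 = m + 12 by ring, d12]; ring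
  have hV1 := VV_approx (m + 8) ξ 0 0
    (by rw [r8, sub_zero, abs_of_nonneg (by positivity)]; norm_num; linarith)
    (by rw [show m + 8 + 1 = m + 9 by ring, r9, sub_zero, abs_of_nonneg (by positivity)]
        norm_num; linarith)
  have hV2 := VV_approx (m + 11) ξ (1 / 4) (1 / 8)
    (by rw [r11, add_sub_cancel_left, abs_of_nonneg (by positivity)]; norm_num; linarith)
    (by rw [r12, add_sub_cancel_left, abs_of_nonneg (by positivity)]; norm_num; linarith)
  have hb1 := norm_VV_le (m + 8) ξ
  have hb2 := norm_VV_le (m + 11) ξ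
  rw [ee_add_half, zero_add, ee_quarter, ee_zero] at hV1
  rw [ee_add_half, ee_quarter, ee_add, ee_quarter, ee_eighth] at hV2
  generalize VV (m + 8) ξ = V1 at *
  generalize VV (m + 11) ξ = V2 at *
  have e2 : (-Complex.I - Complex.I) + (ww : ℂ) * ((ww : ℂ) * (1 + Complex.I) * Complex.I
      - (ww : ℂ) * (1 + Complex.I)) = -1 - 2 * Complex.I := by
    have hw : (ww : ℂ) * ww = 1 / 2 := by
      rw [← Complex.ofReal_mul, ww_mul_self]; norm_num
    linear_combination (-1 - 1 : ℂ) * hw + (ww : ℂ) * ww * Complex.I_mul_I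
  rw [e2] at hV2
  have w1 := ww_gt
  have w2 := ww_lt
  have re1 := (abs_le.1 ((Complex.abs_re_le_norm _).trans hV1)).2
  have im1 := (abs_le.1 ((Complex.abs_im_le_norm _).trans hV1)).1
  have re2 := (abs_le.1 ((Complex.abs_re_le_norm _).trans hV2)).2
  have im2 := (abs_le.1 ((Complex.abs_im_le_norm _).trans hV2)).2
  simp at re1 im1 re2 im2
  have hdet : 2.6 ≤ V1.re * V2.im - V1.im * V2.re := by nlinarith
  set D := V1.re * V2.im - V1.im * V2.re
  set u := (p : ℂ) * V1 + (q : ℂ) * V2 with hu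
  have hre : u.re = p * V1.re + q * V2.re := by simp [hu]
  have him : u.im = p * V1.im + q * V2.im := by simp [hu]
  have cross : ∀ z w : ℂ, |z.re * w.im - z.im * w.re| ≤ ‖z‖ * ‖w‖ := by
    intro z w
    have : z.re * w.im - z.im * w.re = (starRingEnd ℂ z * w).im := by simp; ring
    rw [this]
    refine (Complex.abs_im_le_norm _).trans ?_
    rw [norm_mul, Complex.norm_conj]
  have c1 := cross u V2
  have c2 := cross u V1
  have k1 : u.re * V2.im - u.im * V2.re = p * D := by rw [hre, him]; ring
  have k2 : u.re * V1.im - u.im * V1.re = -(q * D) := by rw [hre, him]; ring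
  rw [k1, abs_mul, abs_of_pos (by linarith : 0 < D)] at c1
  rw [k2, abs_neg, abs_mul, abs_of_pos (by linarith : 0 < D)] at c2
  constructor
  · nlinarith [abs_nonneg p, norm_nonneg u]
  · nlinarith [abs_nonneg q, norm_nonneg u]

/-- The unit interval `[0,1)`. -/
abbrev II : Set ℝ := Ico (0:ℝ) 1

/-- Lebesgue measure on `[0,1)`. -/
def lam : Measure ℝ := volume.restrict II

/-- Lebesgue measure on the unit square. -/
def PP : Measure (ℝ × ℝ) := lam.prod lam

instance : IsProbabilityMeasure lam := ⟨by simp [lam]⟩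
instance : IsProbabilityMeasure PP := by unfold PP; infer_instance

lemma PP_eq : PP = (volume : Measure (ℝ × ℝ)).restrict usq := by
  unfold PP lam usq
  rw [Measure.prod_restrict]; rfl

lemma ae_lam_mem : ∀ᵐ x ∂lam, x ∈ II := ae_restrict_mem measurableSet_Ico

lemma ae_PP_mem : ∀ᵐ p ∂PP, p ∈ usq := by
  rw [PP_eq]; exact ae_restrict_mem (measurableSet_Ico.prod measurableSet_Ico)

lemma lintegral_half_branch (F : ℝ → ENNReal) (hF : Measurable F) (d : ℤ) :
    ∫⁻ x in Ico ((d:ℝ) / 2) ((d + 1) / 2), F x = 2⁻¹ * ∫⁻ y in II, F ((d + y) / 2) := by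
  have hmap : (volume : Measure ℝ).map (fun y : ℝ => ((d:ℝ) + y) / 2) = (2 : ENNReal) • volume := by
    have h1 : (fun y : ℝ => ((d:ℝ) + y) / 2) = (fun y => (1 / 2 : ℝ) * y) ∘ (fun y => d + y) := by
      ext y; simp; ring
    rw [h1, ← Measure.map_map (by fun_prop) (by fun_prop), map_add_left_eq_self,
      Real.map_volume_mul_left (by norm_num)]
    norm_num
  set G := (Ico ((d:ℝ) / 2) ((d + 1) / 2)).indicator F with hG
  have hGm : Measurable G := hF.indicator measurableSet_Ico
  have h2 : ∫⁻ y, G ((d + y) / 2) = 2 * ∫⁻ x, G x := by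
    rw [← lintegral_map (f := G) hGm (by fun_prop : Measurable fun y : ℝ => ((d:ℝ) + y) / 2), hmap,
      lintegral_smul_measure, smul_eq_mul]
  have h3 : ∫⁻ y, G ((d + y) / 2) = ∫⁻ y in II, F ((d + y) / 2) := by
    rw [← lintegral_indicator measurableSet_Ico]
    refine lintegral_congr fun y => ?_
    simp only [hG, indicator]
    have : ((d + y) / 2 ∈ Ico ((d:ℝ) / 2) ((d + 1) / 2)) ↔ y ∈ Ico (0:ℝ) 1 := by
      simp only [mem_Ico]
      constructor
      · rintro ⟨a, b⟩; constructor <;> linarith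
      · rintro ⟨a, b⟩; constructor <;> linarith
    simp only [this]
  rw [← h3, h2, ← mul_assoc, ENNReal.inv_mul_cancel (by norm_num) (by norm_num), one_mul, hG,
    lintegral_indicator measurableSet_Ico]

lemma lintegral_doubling (F : ℝ → ENNReal) (hF : Measurable F) :
    ∫⁻ x, F x ∂lam = 2⁻¹ * ((∫⁻ y, F (y / 2) ∂lam) + ∫⁻ y, F ((1 + y) / 2) ∂lam) := by
  have h0 := lintegral_half_branch F hF 0
  have h1 := lintegral_half_branch F hF 1
  norm_num at h0 h1
  unfold lam
  rw [mul_add, ← h0, ← h1, ← lintegral_union measurableSet_Ico]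
  · congr 2
    ext x; simp only [mem_Ico, mem_union]
    constructor
    · rintro ⟨a, b⟩
      rcases lt_or_ge x (1 / 2) with h | h
      · exact Or.inl ⟨a, h⟩
      · exact Or.inr ⟨h, b⟩
    · rintro (⟨a, b⟩ | ⟨a, b⟩) <;> constructor <;> linarith
  · rw [Set.disjoint_left]
    rintro x ⟨_, a⟩ ⟨b, _⟩
    linarith

lemma measurable_bb : Measurable bb := by
  unfold bb
  have : Measurable (fun n : ℤ => (n : ℝ)) := measurable_from_top
  have h2 : Measurable (fun p : ℝ × ℝ => ((⌊2 * p.2⌋ : ℤ) : ℝ)) :=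
    this.comp (Int.measurable_floor.comp (by fun_prop))
  have h3 : Measurable (fun p : ℝ × ℝ => Int.fract (2 * p.2)) :=
    measurable_fract.comp (by fun_prop)
  exact ((measurable_fst.add h2).div_const 2).prodMk h3

lemma bb_branch (ξ y : ℝ) (hy : y ∈ II) (d : ℤ) : bb (ξ, (d + y) / 2) = ((ξ + d) / 2, y) := by
  have h : (2:ℝ) * ((d + y) / 2) = y + d := by ring
  have hf : ⌊y⌋ = 0 := Int.floor_eq_zero_iff.2 hy
  unfold bb
  simp only [h, Int.floor_add_intCast, Int.fract_add_intCast, hf, zero_add]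
  rw [Int.fract_eq_self.2 hy]

lemma measurePreserving_bb : MeasurePreserving bb PP PP := by
  refine ⟨measurable_bb, ?_⟩
  refine Measure.ext_of_lintegral _ fun f hf => ?_
  rw [lintegral_map hf measurable_bb]
  unfold PP
  rw [lintegral_prod (fun p => f (bb p)) (hf.comp measurable_bb).aemeasurable,
    lintegral_prod_symm _ hf.aemeasurable]
  have e1 : ∀ ξ, ∫⁻ x, f (bb (ξ, x)) ∂lam
      = 2⁻¹ * ((∫⁻ y, f (ξ / 2, y) ∂lam) + ∫⁻ y, f ((1 + ξ) / 2, y) ∂lam) := by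
    intro ξ
    rw [lintegral_doubling (fun x => f (bb (ξ, x)))
      (hf.comp (measurable_bb.comp measurable_prodMk_left))]
    congr 2
    · refine lintegral_congr_ae (ae_lam_mem.mono fun y hy => ?_)
      have := bb_branch ξ y hy 0
      simp only [Int.cast_zero, zero_add, add_zero] at this
      simp only [this]
    · refine lintegral_congr_ae (ae_lam_mem.mono fun y hy => ?_)
      have := bb_branch ξ y hy 1
      simp only [Int.cast_one] at this
      simp only [this, add_comm (1:ℝ) ξ]
  have e2 : ∀ y, ∫⁻ ξ, f (ξ, y) ∂lam
      = 2⁻¹ * ((∫⁻ ξ, f (ξ / 2, y) ∂lam) + ∫⁻ ξ, f ((1 + ξ) / 2, y) ∂lam) := by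
    intro y
    rw [lintegral_doubling (fun ξ => f (ξ, y)) (hf.comp measurable_prodMk_right)]
  have m1 : Measurable (fun q : ℝ × ℝ => f (q.1 / 2, q.2)) := hf.comp (by fun_prop)
  have m2 : Measurable (fun q : ℝ × ℝ => f ((1 + q.1) / 2, q.2)) := hf.comp (by fun_prop)
  simp_rw [e1, e2]
  have a1 : Measurable (fun x => ∫⁻ y, f (x / 2, y) ∂lam) := m1.lintegral_prod_right'
  have a2 : Measurable (fun x => ∫⁻ y, f ((1 + x) / 2, y) ∂lam) := m2.lintegral_prod_right'
  have b1 : Measurable (fun y => ∫⁻ x, f (x / 2, y) ∂lam) := m1.lintegral_prod_left'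
  have b2 : Measurable (fun y => ∫⁻ x, f ((1 + x) / 2, y) ∂lam) := m2.lintegral_prod_left'
  rw [lintegral_const_mul' _ _ (by norm_num), lintegral_const_mul' _ _ (by norm_num),
    lintegral_add_left a1, lintegral_add_left b1]
  congr 2
  · rw [lintegral_lintegral_swap]; exact m1.aemeasurable
  · rw [lintegral_lintegral_swap]; exact m2.aemeasurable

lemma measurePreserving_bb_iterate (n : ℕ) : MeasurePreserving (bb^[n]) PP PP :=
  measurePreserving_bb.iterate n

lemma bb_mem {p : ℝ × ℝ} (hp : p ∈ usq) : bb p ∈ usq := by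
  obtain ⟨h1, h2⟩ := hp
  refine ⟨?_, Int.fract_nonneg _, Int.fract_lt_one _⟩
  rcases floor_bit h2 with h | h <;> unfold bb <;> rw [h] <;> constructor <;> push_cast <;>
    linarith [h1.1, h1.2]

lemma bb_iterate_mem {p : ℝ × ℝ} (hp : p ∈ usq) (n : ℕ) : bb^[n] p ∈ usq := by
  induction n with
  | zero => exact hp
  | succ n ih => rw [Function.iterate_succ_apply']; exact bb_mem ih

lemma measurePreserving_fract_two : MeasurePreserving (fun x : ℝ => Int.fract (2 * x)) lam lam := by
  have hm : Measurable (fun x : ℝ => Int.fract (2 * x)) := measurable_fract.comp (by fun_prop)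
  refine ⟨hm, ?_⟩
  refine Measure.ext_of_lintegral _ fun f hf => ?_
  rw [lintegral_map hf hm, lintegral_doubling (fun x => f (Int.fract (2 * x))) (hf.comp hm)]
  have h1 : ∫⁻ y, f (Int.fract (2 * (y / 2))) ∂lam = ∫⁻ y, f y ∂lam := by
    refine lintegral_congr_ae (ae_lam_mem.mono fun y hy => ?_)
    simp only
    rw [mul_div_cancel₀ _ (by norm_num : (2:ℝ) ≠ 0), Int.fract_eq_self.2 hy]
  have h2 : ∫⁻ y, f (Int.fract (2 * ((1 + y) / 2))) ∂lam = ∫⁻ y, f y ∂lam := by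
    refine lintegral_congr_ae (ae_lam_mem.mono fun y hy => ?_)
    simp only
    rw [mul_div_cancel₀ _ (by norm_num : (2:ℝ) ≠ 0), add_comm, Int.fract_add_one,
      Int.fract_eq_self.2 hy]
  rw [h1, h2, ← two_mul, ← mul_assoc, ENNReal.inv_mul_cancel (by norm_num) (by norm_num), one_mul]

lemma measurePreserving_fract_pow (n : ℕ) :
    MeasurePreserving (fun x : ℝ => Int.fract (2 ^ n * x)) lam lam := by
  induction n with
  | zero =>
    have : (fun x : ℝ => Int.fract (2 ^ 0 * x)) =ᵐ[lam] id :=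
      ae_lam_mem.mono fun x hx => by simpa using Int.fract_eq_self.2 hx
    refine ⟨measurable_fract.comp (by fun_prop), ?_⟩
    rw [Measure.map_congr this, Measure.map_id]
  | succ n ih =>
    have := measurePreserving_fract_two.comp ih
    convert this using 2 with x
    simp only [Function.comp]
    rw [fract_two_mul_fract]; congr 1; ring

/-- The dyadic cylinder of level `L` with index `k`. -/
def CL (L : ℕ) (k : ℤ) : Set ℝ := {y | y ∈ II ∧ ⌊(2:ℝ) ^ L * y⌋ = k}

/-- The dyadic cylinder of level `n` containing `x`. -/
def cyl (n : ℕ) (x : ℝ) : Set ℝ := CL n ⌊(2:ℝ) ^ n * x⌋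

/-- The mass of the points of `C` that `Zfn ξ` sends to the closed ball of centre `z` and
radius `r`. -/
def mass (C : Set ℝ) (ξ : ℝ) (z : ℂ) (r : ℝ) : ENNReal := volume {y | y ∈ C ∧ ‖Zfn ξ y - z‖ ≤ r}

lemma measurableSet_CL (L : ℕ) (k : ℤ) : MeasurableSet (CL L k) := by
  have : Measurable (fun y : ℝ => ⌊(2:ℝ) ^ L * y⌋) := Int.measurable_floor.comp (by fun_prop)
  exact measurableSet_Ico.inter (this (measurableSet_singleton k))

lemma CL_subset (L : ℕ) (k : ℤ) : CL L k ⊆ II := fun _ h => h.1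

lemma cyl_zero {x : ℝ} (hx : x ∈ II) : cyl 0 x = II := by
  ext y
  simp only [cyl, CL, pow_zero, one_mul, mem_ofPred_eq]
  constructor
  · exact fun h => h.1
  · exact fun h => ⟨h, by rw [Int.floor_eq_zero_iff.2 h, Int.floor_eq_zero_iff.2 hx]⟩

lemma mem_cyl_succ {x : ℝ} (hx : x ∈ II) (n : ℕ) (y : ℝ) :
    y ∈ cyl (n + 1) x ↔ 2 * y - ⌊2 * x⌋ ∈ cyl n (Int.fract (2 * x)) := by
  have hd := floor_bit hx
  set d := ⌊2 * x⌋ with hd'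
  have hfl : ∀ u : ℝ, ⌊(2:ℝ) ^ n * (2 * u - d)⌋ = ⌊(2:ℝ) ^ (n + 1) * u⌋ - 2 ^ n * d := by
    intro u
    rw [show (2:ℝ) ^ n * (2 * u - d) = 2 ^ (n + 1) * u - ((2 ^ n * d : ℤ) : ℝ) by push_cast; ring,
      Int.floor_sub_intCast]
  have hdiv : ∀ u : ℝ, ⌊(2:ℝ) ^ (n + 1) * u⌋ / 2 ^ n = ⌊2 * u⌋ := by
    intro u
    have := Int.natCast_mul_floor_div_cancel (n := 2 ^ n) (by positivity) (2 * u)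
    rw [← this]; congr 1
    congr 1; push_cast; ring
  have hfr : Int.fract (2 * x) = 2 * x - d := rfl
  unfold cyl CL
  simp only [mem_ofPred_eq]
  rw [hfr, hfl, hfl, sub_left_inj]
  constructor
  · rintro ⟨h1, h2⟩
    refine ⟨?_, h2⟩
    have : ⌊2 * y⌋ = d := by rw [← hdiv, h2, hdiv]
    rw [← this]
    exact ⟨Int.fract_nonneg (2 * y), Int.fract_lt_one (2 * y)⟩
  · rintro ⟨h1, h2⟩
    refine ⟨?_, h2⟩
    obtain ⟨a, b⟩ := h1
    rcases hd with h | h <;> rw [h] at a b <;> push_cast at a b <;> constructor <;> linarith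

lemma mass_cyl_succ {p : ℝ × ℝ} (hp : p ∈ usq) (n : ℕ) (r : ℝ) :
    mass (cyl (n + 1) p.2) p.1 (Zfn p.1 p.2) (ww * r)
      = 2⁻¹ * mass (cyl n (bb p).2) (bb p).1 (Zfn (bb p).1 (bb p).2) r := by
  obtain ⟨ξ, x⟩ := p
  obtain ⟨hξ, hx⟩ := hp
  simp only at hξ hx ⊢
  have hd := floor_bit hx
  set d := ⌊2 * x⌋ with hd'
  have hb : bb (ξ, x) = ((ξ + d) / 2, Int.fract (2 * x)) := rfl
  rw [hb]
  simp only
  have hset : {y | y ∈ cyl (n + 1) x ∧ ‖Zfn ξ y - Zfn ξ x‖ ≤ ww * r}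
      = (fun y => 2 * y) ⁻¹' ((fun y => y - (d:ℝ)) ⁻¹' {y | y ∈ cyl n (Int.fract (2 * x)) ∧
        ‖Zfn ((ξ + d) / 2) y - Zfn ((ξ + d) / 2) (Int.fract (2 * x))‖ ≤ r}) := by
    ext y
    simp only [mem_ofPred_eq, mem_preimage]
    rw [mem_cyl_succ hx]
    have key := Zfn_branch hξ hd (2 * y - d) (Int.fract (2 * x))
    have ey : ((d:ℝ) + (2 * y - d)) / 2 = y := by ring
    have ex : ((d:ℝ) + Int.fract (2 * x)) / 2 = x := by rw [Int.fract, ← hd']; ring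
    rw [ey, ex] at key
    rw [key, norm_mul, Complex.norm_real, Real.norm_of_nonneg ww_pos.le,
      mul_le_mul_iff_right₀ ww_pos]
  unfold mass
  rw [hset, Real.volume_preimage_mul_left (by norm_num)]
  congr 1
  · norm_num
    rw [ENNReal.ofReal_div_of_pos (by norm_num)]; simp
  · simp_rw [sub_eq_add_neg]
    exact measure_preimage_add_right _ _ _

/-- `FF j p` is the mass of the ball of radius `2^{-j/2}` around the image of `p`. -/
def FF (j : ℕ) (p : ℝ × ℝ) : ENNReal := mass II p.1 (Zfn p.1 p.2) (ww ^ j)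

lemma mass_cyl_eq {p : ℝ × ℝ} (hp : p ∈ usq) (n j : ℕ) :
    mass (cyl n p.2) p.1 (Zfn p.1 p.2) (ww ^ (j + n)) = 2⁻¹ ^ n * FF j (bb^[n] p) := by
  induction n generalizing p with
  | zero => simp [FF, cyl_zero hp.2]
  | succ n ih =>
    rw [← add_assoc, pow_succ' ww, mass_cyl_succ hp, ih (bb_mem hp), pow_succ', mul_assoc,
      Function.iterate_succ_apply]

lemma measurable_section {α β γ : Type*} [MeasurableSpace α] [MeasurableSpace β]
    [MeasurableSpace γ] {f : α → β → γ} (hf : Measurable fun p : α × β => f p.1 p.2) (x : α) :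
    Measurable (f x) :=
  hf.comp measurable_prodMk_left

lemma measurable_pull {α β γ δ : Type*} [MeasurableSpace α] [MeasurableSpace β]
    [MeasurableSpace γ] [MeasurableSpace δ] {f : α → β → γ}
    (hf : Measurable fun p : α × β => f p.1 p.2) {u : δ → α} {v : δ → β} (hu : Measurable u)
    (hv : Measurable v) : Measurable fun q => f (u q) (v q) :=
  hf.comp (hu.prodMk hv)

lemma measurable_Zfn_left (ξ : ℝ) : Measurable (Zfn ξ) := measurable_section measurable_Zfn ξ

/-- The image under `Zfn ξ` of Lebesgue measure on `C`. -/
def nu (C : Set ℝ) (ξ : ℝ) : Measure ℂ := (volume.restrict C).map (Zfn ξ)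

lemma mass_eq_nu {C : Set ℝ} (hC : MeasurableSet C) (ξ : ℝ) (z : ℂ) (r : ℝ) :
    mass C ξ z r = nu C ξ (Metric.closedBall z r) := by
  unfold mass nu
  rw [Measure.map_apply (measurable_Zfn_left ξ) Metric.isClosed_closedBall.measurableSet,
    Measure.restrict_apply' hC]
  congr 1
  ext y
  simp [dist_eq_norm, and_comm]

lemma volume_II : volume II = 1 := by simp

lemma mass_mono_set {C D : Set ℝ} (h : C ⊆ D) (ξ : ℝ) (z : ℂ) (r : ℝ) :
    mass C ξ z r ≤ mass D ξ z r := measure_mono fun _ hy => ⟨h hy.1, hy.2⟩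

lemma mass_mono_radius (C : Set ℝ) (ξ : ℝ) (z : ℂ) {r s : ℝ} (h : r ≤ s) :
    mass C ξ z r ≤ mass C ξ z s := measure_mono fun _ hy => ⟨hy.1, hy.2.trans h⟩

lemma mass_le_one {C : Set ℝ} (h : C ⊆ II) (ξ : ℝ) (z : ℂ) (r : ℝ) : mass C ξ z r ≤ 1 :=
  volume_II ▸ measure_mono fun _ hy => h hy.1

lemma measurable_mass {C : Set ℝ} (hC : MeasurableSet C) (r : ℝ) :
    Measurable (fun p : ℝ × ℂ => mass C p.1 p.2 r) := by
  have h : MeasurableSet {q : (ℝ × ℂ) × ℝ | q.2 ∈ C ∧ ‖Zfn q.1.1 q.2 - q.1.2‖ ≤ r} := by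
    refine (measurable_snd hC).inter ?_
    have : Measurable (fun q : (ℝ × ℂ) × ℝ => Zfn q.1.1 q.2) :=
      measurable_pull measurable_Zfn (by fun_prop) (by fun_prop)
    have h2 : Measurable (fun q : (ℝ × ℂ) × ℝ => q.1.2) := by fun_prop
    have h3 : Measurable (fun q : (ℝ × ℂ) × ℝ => Zfn q.1.1 q.2 - q.1.2) := this.sub h2
    exact measurableSet_le h3.norm measurable_const
  exact measurable_measure_prodMk_left h

/-- The ratio of the mass in `C` to the total mass near `z` at scale `j`. -/
def ratio (C : Set ℝ) (j : ℕ) (ξ : ℝ) (z : ℂ) : ENNReal :=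
  mass C ξ z (ww ^ j) / mass II ξ z (ww ^ j)

/-- The density of the image of `C` with respect to the image of `[0,1)`. -/
def DD (C : Set ℝ) (ξ : ℝ) (z : ℂ) : ENNReal := limsup (fun j => ratio C j ξ z) atTop

/-- The conditional probability of `C` given the image point. -/
def gg (C : Set ℝ) (p : ℝ × ℝ) : ENNReal := DD C p.1 (Zfn p.1 p.2)

lemma measurable_ratio {C : Set ℝ} (hC : MeasurableSet C) (j : ℕ) :
    Measurable (fun p : ℝ × ℂ => ratio C j p.1 p.2) :=
  (measurable_mass hC _).div (measurable_mass measurableSet_Ico _)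

lemma measurable_DD {C : Set ℝ} (hC : MeasurableSet C) :
    Measurable (fun p : ℝ × ℂ => DD C p.1 p.2) :=
  Measurable.limsup fun j => measurable_ratio hC j

lemma measurable_gg {C : Set ℝ} (hC : MeasurableSet C) : Measurable (gg C) :=
  measurable_pull (measurable_DD hC) measurable_fst measurable_Zfn

lemma ratio_le_one {C : Set ℝ} (h : C ⊆ II) (j : ℕ) (ξ : ℝ) (z : ℂ) : ratio C j ξ z ≤ 1 :=
  ENNReal.div_le_of_le_mul (by rw [one_mul]; exact mass_mono_set h _ _ _)

lemma DD_le_one {C : Set ℝ} (h : C ⊆ II) (ξ : ℝ) (z : ℂ) : DD C ξ z ≤ 1 :=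
  limsup_le_of_le (by isBoundedDefault) (Eventually.of_forall fun j => ratio_le_one h j ξ z)

lemma gg_le_one {C : Set ℝ} (h : C ⊆ II) (p : ℝ × ℝ) : gg C p ≤ 1 := DD_le_one h _ _

lemma nu_le {C : Set ℝ} (h : C ⊆ II) (ξ : ℝ) : nu C ξ ≤ nu II ξ :=
  Measure.map_mono (Measure.restrict_mono h le_rfl) (measurable_Zfn_left ξ)

lemma isFiniteMeasure_nu {C : Set ℝ} (h : C ⊆ II) (ξ : ℝ) : IsFiniteMeasure (nu C ξ) := by
  have : IsFiniteMeasure (volume.restrict C) :=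
    ⟨by rw [Measure.restrict_apply_univ]; exact (measure_mono h).trans_lt (by simp)⟩
  unfold nu
  infer_instance

lemma tendsto_ww_pow : Tendsto (fun j : ℕ => ww ^ j) atTop (nhdsWithin 0 (Ioi 0)) := by
  refine tendsto_nhdsWithin_iff.2 ⟨tendsto_pow_atTop_nhds_zero_of_lt_one ww_pos.le ww_lt_one, ?_⟩
  exact Eventually.of_forall fun j => pow_pos ww_pos j

lemma ae_tendsto_ratio {C : Set ℝ} (hC : MeasurableSet C) (h : C ⊆ II) (ξ : ℝ) :
    ∀ᵐ z ∂nu II ξ, Tendsto (fun j => ratio C j ξ z) atTop (nhds (DD C ξ z)) ∧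
      DD C ξ z = (nu C ξ).rnDeriv (nu II ξ) z := by
  have := isFiniteMeasure_nu h ξ
  have := isFiniteMeasure_nu le_rfl ξ
  filter_upwards [Besicovitch.ae_tendsto_rnDeriv (nu C ξ) (nu II ξ)] with z hz
  have h2 : Tendsto (fun j => ratio C j ξ z) atTop (nhds ((nu C ξ).rnDeriv (nu II ξ) z)) := by
    refine (hz.comp tendsto_ww_pow).congr fun j => ?_
    simp only [Function.comp, ratio, mass_eq_nu hC, mass_eq_nu measurableSet_Ico]
  have h3 : DD C ξ z = (nu C ξ).rnDeriv (nu II ξ) z := h2.limsup_eq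
  exact ⟨h3 ▸ h2, h3⟩

lemma nu_eq_withDensity {C : Set ℝ} (hC : MeasurableSet C) (h : C ⊆ II) (ξ : ℝ) :
    nu C ξ = (nu II ξ).withDensity (DD C ξ) := by
  have := isFiniteMeasure_nu h ξ
  have := isFiniteMeasure_nu le_rfl ξ
  rw [withDensity_congr_ae ((ae_tendsto_ratio hC h ξ).mono fun z hz => hz.2),
    Measure.withDensity_rnDeriv_eq _ _ (Measure.absolutelyContinuous_of_le (nu_le h ξ))]

lemma ae_gg_tendsto {C : Set ℝ} (hC : MeasurableSet C) (h : C ⊆ II) :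
    ∀ᵐ p ∂PP, Tendsto (fun j => ratio C j p.1 (Zfn p.1 p.2)) atTop (nhds (gg C p)) := by
  have hm : MeasurableSet {p : ℝ × ℝ | DD C p.1 (Zfn p.1 p.2) ≤
      liminf (fun j => ratio C j p.1 (Zfn p.1 p.2)) atTop} :=
    measurableSet_le (measurable_gg hC)
      (Measurable.liminf fun j =>
        measurable_pull (measurable_ratio hC j) measurable_fst measurable_Zfn)
  have h2 : ∀ᵐ p ∂PP, p ∈ {p : ℝ × ℝ | DD C p.1 (Zfn p.1 p.2) ≤
      liminf (fun j => ratio C j p.1 (Zfn p.1 p.2)) atTop} := by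
    unfold PP
    rw [Measure.ae_prod_mem_iff_ae_ae_mem hm]
    refine Eventually.of_forall fun ξ => ?_
    have := ae_of_ae_map (measurable_Zfn_left ξ).aemeasurable (ae_tendsto_ratio hC h ξ)
    refine this.mono fun y hy => ?_
    exact hy.1.liminf_eq.ge
  refine h2.mono fun p hp => ?_
  exact tendsto_of_le_liminf_of_limsup_le hp le_rfl

lemma lintegral_gg_eq {C : Set ℝ} (hC : MeasurableSet C) (h : C ⊆ II) (ξ : ℝ)
    {a : ℂ → ENNReal} (ha : Measurable a) :
    ∫⁻ y, gg C (ξ, y) * a (Zfn ξ y) ∂lam = ∫⁻ y in C, a (Zfn ξ y) := by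
  have hD : Measurable (DD C ξ) := measurable_section (measurable_DD hC) ξ
  have h1 : ∫⁻ z, a z ∂nu C ξ = ∫⁻ y in C, a (Zfn ξ y) := lintegral_map ha (measurable_Zfn_left ξ)
  have h2 : ∫⁻ z, DD C ξ z * a z ∂nu II ξ = ∫⁻ y, gg C (ξ, y) * a (Zfn ξ y) ∂lam :=
    lintegral_map (hD.mul ha) (measurable_Zfn_left ξ)
  rw [← h1, ← h2, nu_eq_withDensity hC h, lintegral_withDensity_eq_lintegral_mul _ hD ha]
  rfl

lemma lintegral_gg_symm {C D : Set ℝ} (hC : MeasurableSet C) (h : C ⊆ II) (hD : MeasurableSet D)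
    (h' : D ⊆ II) (ξ : ℝ) {a : ℂ → ENNReal} (ha : Measurable a) :
    ∫⁻ y in C, gg D (ξ, y) * a (Zfn ξ y) = ∫⁻ y in D, gg C (ξ, y) * a (Zfn ξ y) := by
  have mC : Measurable (DD C ξ) := measurable_section (measurable_DD hC) ξ
  have mD : Measurable (DD D ξ) := measurable_section (measurable_DD hD) ξ
  have h1 := lintegral_gg_eq hC h ξ (mD.mul ha)
  have h2 := lintegral_gg_eq hD h' ξ (mC.mul ha)
  calc _ = _ := h1.symm
    _ = _ := by
      refine lintegral_congr fun y => ?_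
      simp only [gg, Pi.mul_apply]; ring
    _ = _ := h2

/-- The conditional probability of `C` has total integral the measure of `C`. -/
lemma lintegral_gg {C : Set ℝ} (hC : MeasurableSet C) (h : C ⊆ II) (ξ : ℝ) :
    ∫⁻ y, gg C (ξ, y) ∂lam = volume C := by
  have := lintegral_gg_eq hC h ξ (a := fun _ => 1) measurable_const
  simpa using this

/-- The ratio of the masses of two concentric balls. -/
def Psi (C : Set ℝ) (a b ξ : ℝ) (z : ℂ) : ENNReal := mass C ξ z a / mass C ξ z b

lemma measurable_Psi {C : Set ℝ} (hC : MeasurableSet C) (a b : ℝ) :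
    Measurable (fun p : ℝ × ℂ => Psi C a b p.1 p.2) :=
  (measurable_mass hC _).div (measurable_mass hC _)

lemma measurable_Psi_add {C : Set ℝ} (hC : MeasurableSet C) (a b ξ : ℝ) (t : ℂ) :
    Measurable (fun z => Psi C a b ξ (z + t)) := by
  have h := measurable_section (measurable_Psi hC a b) ξ
  exact h.comp (measurable_add_const t)

lemma Psi_le_one (C : Set ℝ) {a b : ℝ} (h : a ≤ b) (ξ : ℝ) (z : ℂ) : Psi C a b ξ z ≤ 1 :=
  ENNReal.div_le_of_le_mul (by rw [one_mul]; exact mass_mono_radius C ξ z h)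

lemma mass_le_mass {C : Set ℝ} {ξ ξ' : ℝ} {z z' : ℂ} {a d : ℝ}
    (h : ∀ x ∈ C, ‖(Zfn ξ' x - z') - (Zfn ξ x - z)‖ ≤ d) : mass C ξ z a ≤ mass C ξ' z' (a + d) := by
  refine measure_mono fun x hx => ⟨hx.1, ?_⟩
  calc ‖Zfn ξ' x - z'‖ = ‖(Zfn ξ x - z) + ((Zfn ξ' x - z') - (Zfn ξ x - z))‖ := by congr 1; ring
    _ ≤ a + d := (norm_add_le _ _).trans (add_le_add hx.2 (h x hx.1))

lemma Psi_le_Psi {C : Set ℝ} {ξ ξ' : ℝ} {z z' : ℂ} {a b d : ℝ}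
    (h : ∀ x ∈ C, ‖(Zfn ξ' x - z') - (Zfn ξ x - z)‖ ≤ d) :
    Psi C a b ξ z ≤ Psi C (a + d) (b - d) ξ' z' := by
  refine ENNReal.div_le_div (mass_le_mass h) ?_
  have := mass_le_mass (a := b - d) (fun x hx => (norm_sub_rev _ _).trans_le (h x hx))
  rwa [sub_add_cancel] at this

lemma mul_le_mul_add_tsub {p p' u u' : ENNReal} (hu : u ≤ u') (h1 : u ≤ 1) :
    p * u ≤ p' * u' + (p - p') := by
  calc p * u ≤ (p' + (p - p')) * u := by gcongr; exact le_add_tsub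
    _ = p' * u + (p - p') * u := add_mul _ _ _
    _ ≤ p' * u' + (p - p') * 1 := by gcongr
    _ = _ := by rw [mul_one]

/-- The overlap integral of two cylinders, weighted by a translated ratio of masses. -/
def overlap (C D A : Set ℝ) (a b : ℝ) (t : ℝ → ℂ) : ENNReal :=
  ∫⁻ ξ in A, ∫⁻ y in D, gg C (ξ, y) * Psi C a b ξ (Zfn ξ y + t ξ)

/-- The `L¹` defect of the densities under a translation of the first variable. -/
def defect (C D A : Set ℝ) (τ : ℝ) : ENNReal :=
  (∫⁻ ξ in A, ∫⁻ x in C, (gg D (ξ, x) - gg D (ξ + τ, x))) +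
    ∫⁻ ξ in A, ∫⁻ y in D, (gg C (ξ + τ, y) - gg C (ξ, y))

lemma overlap_step {C D A : Set ℝ} (hC : MeasurableSet C) (hCI : C ⊆ II) (hD : MeasurableSet D)
    (hDI : D ⊆ II) (hA : MeasurableSet A) {τ a b d : ℝ} (hab : a + d ≤ b - d) (hd : 0 ≤ d)
    {t w : ℝ → ℂ}
    (h0 : ∀ ξ ∈ A, ∀ x ∈ C, ∀ x' ∈ C,
      ‖(Zfn (ξ + τ) x' - Zfn (ξ + τ) x) - (Zfn ξ x' - Zfn ξ x)‖ ≤ d)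
    (h1 : ∀ ξ ∈ A, ∀ x ∈ C, ∀ y ∈ D,
      ‖(Zfn (ξ + τ) x - Zfn (ξ + τ) y) - (Zfn ξ x - Zfn ξ y) - w ξ‖ ≤ d) :
    overlap C D A a b t ≤
      overlap C D A (a + 2 * d) (b - 2 * d) (fun ξ => t ξ - w ξ) + defect C D A τ := by
  have mC := measurable_gg hC
  have mD := measurable_gg hD
  have mC' : Measurable (fun p : ℝ × ℝ => gg C (p.1 + τ, p.2)) := mC.comp (by fun_prop)
  have mD' : Measurable (fun p : ℝ × ℝ => gg D (p.1 + τ, p.2)) := mD.comp (by fun_prop)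
  have m1 : Measurable (fun p : ℝ × ℝ => gg D p - gg D (p.1 + τ, p.2)) := mD.sub mD'
  have m2 : Measurable (fun p : ℝ × ℝ => gg C (p.1 + τ, p.2) - gg C p) := mC'.sub mC
  have key : ∀ ξ ∈ A, ∫⁻ y in D, gg C (ξ, y) * Psi C a b ξ (Zfn ξ y + t ξ) ≤
      (∫⁻ y in D, gg C (ξ, y) * Psi C (a + 2 * d) (b - 2 * d) ξ (Zfn ξ y + (t ξ - w ξ))) +
      ((∫⁻ x in C, (gg D (ξ, x) - gg D (ξ + τ, x))) +
        ∫⁻ y in D, (gg C (ξ + τ, y) - gg C (ξ, y))) := by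
    intro ξ hξ
    rw [lintegral_gg_symm hD hDI hC hCI ξ (measurable_Psi_add hC a b ξ (t ξ))]
    have e1 : ∫⁻ x in C, gg D (ξ, x) * Psi C a b ξ (Zfn ξ x + t ξ) ≤
        (∫⁻ x in C, gg D (ξ + τ, x) * Psi C (a + d) (b - d) (ξ + τ) (Zfn (ξ + τ) x + t ξ)) +
          ∫⁻ x in C, (gg D (ξ, x) - gg D (ξ + τ, x)) := by
      have m1' : Measurable (fun x => gg D (ξ, x) - gg D (ξ + τ, x)) :=
        measurable_section (f := fun ξ x => gg D (ξ, x) - gg D (ξ + τ, x)) m1 ξ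
      rw [← lintegral_add_right _ m1']
      refine setLIntegral_mono' hC fun x hx => ?_
      refine mul_le_mul_add_tsub (Psi_le_Psi fun x' hx' => ?_) (Psi_le_one _ (by linarith) _ _)
      refine le_trans (le_of_eq ?_) (h0 ξ hξ x hx x' hx')
      congr 1; ring
    have e2 : ∫⁻ y in D, gg C (ξ + τ, y) * Psi C (a + d) (b - d) (ξ + τ) (Zfn (ξ + τ) y + t ξ) ≤
        (∫⁻ y in D, gg C (ξ, y) * Psi C (a + 2 * d) (b - 2 * d) ξ (Zfn ξ y + (t ξ - w ξ))) +
          ∫⁻ y in D, (gg C (ξ + τ, y) - gg C (ξ, y)) := by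
      have m2' : Measurable (fun y => gg C (ξ + τ, y) - gg C (ξ, y)) :=
        measurable_section (f := fun ξ y => gg C (ξ + τ, y) - gg C (ξ, y)) m2 ξ
      rw [← lintegral_add_right _ m2']
      refine setLIntegral_mono' hD fun y hy => ?_
      have ea : a + 2 * d = (a + d) + d := by ring
      have eb : b - 2 * d = (b - d) - d := by ring
      rw [ea, eb]
      refine mul_le_mul_add_tsub (Psi_le_Psi fun x hx => ?_) (Psi_le_one _ hab _ _)
      refine le_trans (le_of_eq ?_) (h1 ξ hξ x hx y hy)
      rw [← norm_neg]
      congr 1; ring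
    rw [lintegral_gg_symm hC hCI hD hDI (ξ + τ)
      (measurable_Psi_add hC (a + d) (b - d) (ξ + τ) (t ξ))] at e1
    calc _ ≤ _ := e1
      _ ≤ _ := add_le_add_left e2 _
      _ = _ := by ring
  unfold overlap defect
  calc _ ≤ _ := setLIntegral_mono' hA key
    _ = _ := by
      have n1 : Measurable fun ξ => ∫⁻ x in C, (gg D (ξ, x) - gg D (ξ + τ, x)) :=
        m1.lintegral_prod_right'
      have n2 : Measurable fun ξ => ∫⁻ y in D, (gg C (ξ + τ, y) - gg C (ξ, y)) :=
        m2.lintegral_prod_right'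
      have n3 : Measurable fun ξ => (∫⁻ x in C, (gg D (ξ, x) - gg D (ξ + τ, x))) +
          ∫⁻ y in D, (gg C (ξ + τ, y) - gg C (ξ, y)) := n1.add n2
      rw [lintegral_add_right _ n3, lintegral_add_right _ n2]

lemma overlap_mono {C D A : Set ℝ} {a a' b b' : ℝ} (ha : a ≤ a') (hb : b' ≤ b) (t : ℝ → ℂ) :
    overlap C D A a b t ≤ overlap C D A a' b' t := by
  unfold overlap
  gcongr with ξ y
  exact ENNReal.div_le_div (mass_mono_radius _ _ _ ha) (mass_mono_radius _ _ _ hb)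

/-- Iteration of the translation step with the same translation. -/
lemma overlap_iterate {C D A : Set ℝ} (hC : MeasurableSet C) (hCI : C ⊆ II) (hD : MeasurableSet D)
    (hDI : D ⊆ II) (hA : MeasurableSet A) {τ d : ℝ} (hd : 0 ≤ d) {w : ℝ → ℂ}
    (h0 : ∀ ξ ∈ A, ∀ x ∈ C, ∀ x' ∈ C,
      ‖(Zfn (ξ + τ) x' - Zfn (ξ + τ) x) - (Zfn ξ x' - Zfn ξ x)‖ ≤ d)
    (h1 : ∀ ξ ∈ A, ∀ x ∈ C, ∀ y ∈ D,
      ‖(Zfn (ξ + τ) x - Zfn (ξ + τ) y) - (Zfn ξ x - Zfn ξ y) - w ξ‖ ≤ d) (i : ℕ) :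
    ∀ {a b : ℝ} (t : ℝ → ℂ), a + 2 * d * i ≤ b - 2 * d * i →
      overlap C D A a b t ≤ overlap C D A (a + 2 * d * i) (b - 2 * d * i)
        (fun ξ => t ξ - i * w ξ) + i * defect C D A τ := by
  induction i with
  | zero => intro a b t _; simp
  | succ i ih =>
    intro a b t hab
    push_cast at hab
    refine (overlap_step hC hCI hD hDI hA (by nlinarith [mul_nonneg hd (Nat.cast_nonneg (α := ℝ) i)])
      hd h0 h1).trans ?_
    refine (add_le_add_left (ih (a := a + 2 * d) (b := b - 2 * d) (fun ξ => t ξ - w ξ)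
      (by linarith)) _).trans ?_
    have e1 : a + 2 * d + 2 * d * i = a + 2 * d * (i + 1 : ℕ) := by push_cast; ring
    have e2 : b - 2 * d - 2 * d * i = b - 2 * d * (i + 1 : ℕ) := by push_cast; ring
    have e3 : (fun ξ => t ξ - w ξ - i * w ξ) = fun ξ => t ξ - (i + 1 : ℕ) * w ξ := by
      ext ξ; push_cast; ring
    rw [e1, e2, e3]
    push_cast
    rw [add_mul, one_mul, add_assoc]

lemma tendsto_lintegral_translate {F : ℝ × ℝ → ℝ} (hF : Integrable F) :
    Tendsto (fun τ : ℝ => ∫⁻ p : ℝ × ℝ, ‖F (p.1 + τ, p.2) - F p‖ₑ) (nhds 0) (nhds 0) := by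
  let G : C(ℝ, C(ℝ × ℝ, ℝ × ℝ)) :=
    (ContinuousMap.mk (fun q : ℝ × (ℝ × ℝ) => (q.2.1 + q.1, q.2.2)) (by fun_prop)).curry
  have hG : ∀ τ, ⇑(G τ) = fun p : ℝ × ℝ => (p.1 + τ, p.2) := fun τ => rfl
  have hmp : ∀ τ, MeasurePreserving (G τ) volume volume := fun τ => by
    rw [hG]
    exact (measurePreserving_add_right volume τ).prod (MeasurePreserving.id volume)
  let f : Lp ℝ 1 (volume : Measure (ℝ × ℝ)) := hF.toL1 F
  have hf : f =ᵐ[volume] F := hF.coeFn_toL1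
  have key := Filter.Tendsto.compMeasurePreservingLp (l := nhds (0:ℝ)) (f := fun _ => f) (f₀ := f)
    (g := fun τ => G τ) (g₀ := G 0) tendsto_const_nhds (G.continuous.tendsto 0) hmp (hmp 0)
    ENNReal.one_ne_top
  rw [tendsto_iff_edist_tendsto_0] at key
  refine key.congr fun τ => ?_
  rw [Lp.edist_def, eLpNorm_one_eq_lintegral_enorm]
  refine lintegral_congr_ae ?_
  have h1 := Lp.coeFn_compMeasurePreserving f (hmp τ)
  have h2 := Lp.coeFn_compMeasurePreserving f (hmp 0)
  have h3 := (hmp τ).quasiMeasurePreserving.ae_eq_comp hf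
  have h4 := (hmp 0).quasiMeasurePreserving.ae_eq_comp hf
  filter_upwards [h1, h2, h3, h4] with p a1 a2 a3 a4
  rw [Pi.sub_apply, a1, a2, a3, a4]
  simp [hG]

lemma tendsto_lintegral_tsub_translate {g : ℝ × ℝ → ENNReal} (hg : Measurable g)
    (h1 : ∀ p, g p ≤ 1) :
    Tendsto (fun τ : ℝ => (∫⁻ ξ in II, ∫⁻ x in II, (g (ξ, x) - g (ξ + τ, x))) +
      ∫⁻ ξ in II, ∫⁻ x in II, (g (ξ + τ, x) - g (ξ, x))) (nhds 0) (nhds 0) := by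
  set S : Set (ℝ × ℝ) := Icc (-1:ℝ) 2 ×ˢ II with hS
  have mS : MeasurableSet S := measurableSet_Icc.prod measurableSet_Ico
  set F : ℝ × ℝ → ℝ := S.indicator (fun p => (g p).toReal) with hFdef
  have hF : Integrable F := by
    rw [integrable_indicator_iff mS]
    have hvol : (volume : Measure (ℝ × ℝ)) S < ⊤ := by
      rw [hS, Measure.volume_eq_prod, Measure.prod_prod]; simp
    refine Measure.integrableOn_of_bounded hvol.ne hg.ennreal_toReal.aestronglyMeasurable
      (M := 1) (Eventually.of_forall fun p => ?_)
    rw [Real.norm_of_nonneg ENNReal.toReal_nonneg]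
    exact ENNReal.toReal_le_of_le_ofReal zero_le_one (by simpa using h1 p)
  have hlim := tendsto_lintegral_translate hF
  have hsub : ∀ a b : ENNReal, a ≤ 1 → b ≤ 1 → a - b ≤ ‖a.toReal - b.toReal‖ₑ := by
    intro a b ha hb
    have h := ENNReal.ofReal_sub a.toReal (q := b.toReal) ENNReal.toReal_nonneg
    rw [ENNReal.ofReal_toReal (ne_top_of_le_ne_top ENNReal.one_ne_top ha),
      ENNReal.ofReal_toReal (ne_top_of_le_ne_top ENNReal.one_ne_top hb)] at h
    rw [← h]
    exact Real.ofReal_le_enorm _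
  have hFm : Measurable F := (hg.ennreal_toReal).indicator mS
  have bound : ∀ τ ∈ Icc (-1:ℝ) 1, ∀ u : ℝ × ℝ → ENNReal,
      (∀ p ∈ usq, u p ≤ ‖F (p.1 + τ, p.2) - F p‖ₑ) →
      ∫⁻ ξ in II, ∫⁻ x in II, u (ξ, x) ≤ ∫⁻ p : ℝ × ℝ, ‖F (p.1 + τ, p.2) - F p‖ₑ := by
    intro τ _ u hu
    have hm : Measurable (fun p : ℝ × ℝ => ‖F (p.1 + τ, p.2) - F p‖ₑ) :=
      ((hFm.comp (by fun_prop : Measurable fun p : ℝ × ℝ => (p.1 + τ, p.2))).sub hFm).enorm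
    calc ∫⁻ ξ in II, ∫⁻ x in II, u (ξ, x)
        ≤ ∫⁻ ξ in II, ∫⁻ x in II, ‖F (ξ + τ, x) - F (ξ, x)‖ₑ :=
          setLIntegral_mono' measurableSet_Ico fun ξ hξ =>
            setLIntegral_mono' measurableSet_Ico fun x hx => hu (ξ, x) ⟨hξ, hx⟩
      _ = ∫⁻ p in usq, ‖F (p.1 + τ, p.2) - F p‖ₑ := by
          unfold usq
          rw [Measure.volume_eq_prod, ← Measure.prod_restrict, lintegral_prod _ hm.aemeasurable]
      _ ≤ _ := setLIntegral_le_lintegral _ _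
  have hFv : ∀ τ ∈ Icc (-1:ℝ) 1, ∀ p ∈ usq, F p = (g p).toReal ∧
      F (p.1 + τ, p.2) = (g (p.1 + τ, p.2)).toReal := by
    rintro τ ⟨hτ1, hτ2⟩ p ⟨hp1, hp2⟩
    obtain ⟨a, b⟩ := hp1
    constructor
    · exact indicator_of_mem (show p ∈ S from ⟨⟨by linarith, by linarith⟩, hp2⟩) _
    · exact indicator_of_mem (show (p.1 + τ, p.2) ∈ S from
        ⟨⟨by simp only; linarith, by simp only; linarith⟩, hp2⟩) (fun p => (g p).toReal)
  have hlim2 : Tendsto (fun τ : ℝ => (∫⁻ p : ℝ × ℝ, ‖F (p.1 + τ, p.2) - F p‖ₑ) +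
      ∫⁻ p : ℝ × ℝ, ‖F (p.1 + τ, p.2) - F p‖ₑ) (nhds 0) (nhds 0) := by
    simpa using hlim.add hlim
  refine tendsto_of_tendsto_of_tendsto_of_le_of_le' tendsto_const_nhds hlim2
    (Eventually.of_forall fun _ => zero_le) ?_
  filter_upwards [Icc_mem_nhds (by norm_num : (-1:ℝ) < 0) (by norm_num : (0:ℝ) < 1)] with τ hτ
  refine add_le_add (bound τ hτ (fun p => g p - g (p.1 + τ, p.2)) fun p hp => ?_)
    (bound τ hτ (fun p => g (p.1 + τ, p.2) - g p) fun p hp => ?_)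
  · obtain ⟨e1, e2⟩ := hFv τ hτ p hp
    rw [e1, e2, enorm_sub_rev]
    exact hsub _ _ (h1 _) (h1 _)
  · obtain ⟨e1, e2⟩ := hFv τ hτ p hp
    rw [e1, e2]
    exact hsub _ _ (h1 _) (h1 _)

lemma defect_le {C D A : Set ℝ} (hCI : C ⊆ II) (hDI : D ⊆ II) (hA : A ⊆ II) (τ : ℝ) :
    defect C D A τ ≤
      ((∫⁻ ξ in II, ∫⁻ x in II, (gg D (ξ, x) - gg D (ξ + τ, x))) +
        ∫⁻ ξ in II, ∫⁻ x in II, (gg D (ξ + τ, x) - gg D (ξ, x))) +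
      ((∫⁻ ξ in II, ∫⁻ x in II, (gg C (ξ, x) - gg C (ξ + τ, x))) +
        ∫⁻ ξ in II, ∫⁻ x in II, (gg C (ξ + τ, x) - gg C (ξ, x))) := by
  have h : ∀ (B : Set ℝ), B ⊆ II → ∀ u : ℝ → ℝ → ENNReal,
      ∫⁻ ξ in A, ∫⁻ x in B, u ξ x ≤ ∫⁻ ξ in II, ∫⁻ x in II, u ξ x := fun B hB u =>
    (lintegral_mono_set hA).trans (lintegral_mono fun ξ => lintegral_mono_set hB)
  exact add_le_add ((h C hCI fun ξ x => gg D (ξ, x) - gg D (ξ + τ, x)).trans le_self_add)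
    ((h D hDI fun ξ x => gg C (ξ + τ, x) - gg C (ξ, x)).trans le_add_self)

/-- For fixed cylinders the defect of small translations is uniformly small. -/
lemma exists_defect_le {C D : Set ℝ} (hC : MeasurableSet C) (hCI : C ⊆ II) (hD : MeasurableSet D)
    (hDI : D ⊆ II) {e : ENNReal} (he : 0 < e) :
    ∀ᶠ n : ℕ in atTop, ∀ m ≥ n, ∀ A ⊆ II, defect C D A (1 / 2 ^ m) ≤ e := by
  have hlim := (tendsto_lintegral_tsub_translate (measurable_gg hD) (gg_le_one hDI)).add
    (tendsto_lintegral_tsub_translate (measurable_gg hC) (gg_le_one hCI))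
  rw [add_zero] at hlim
  have ht : Tendsto (fun m : ℕ => (1:ℝ) / 2 ^ m) atTop (nhds 0) := by
    simp_rw [← one_div_pow]
    exact tendsto_pow_atTop_nhds_zero_of_lt_one (by norm_num) (by norm_num)
  obtain ⟨n₀, hn₀⟩ := eventually_atTop.1 ((hlim.comp ht).eventually_le_const he)
  filter_upwards [eventually_ge_atTop n₀] with n hn m hm A hA
  exact (defect_le hCI hDI hA _).trans (hn₀ m (hn.trans hm))

lemma finsetSum_lintegral_le {α ι : Type*} [MeasurableSpace α] (μ : Measure α) (s : Finset ι)
    (f : ι → α → ENNReal) : ∑ i ∈ s, ∫⁻ x, f i x ∂μ ≤ ∫⁻ x, ∑ i ∈ s, f i x ∂μ := by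
  classical
  induction s using Finset.induction_on with
  | empty => simp
  | insert a s ha ih =>
    simp_rw [Finset.sum_insert ha]
    exact (add_le_add_right ih _).trans (le_lintegral_add _ _)

lemma measurableSet_ball_preimage {C : Set ℝ} (hC : MeasurableSet C) (ξ : ℝ) (z : ℂ) (r : ℝ) :
    MeasurableSet {y | y ∈ C ∧ ‖Zfn ξ y - z‖ ≤ r} := by
  have h : Measurable (fun y => Zfn ξ y - z) := (measurable_Zfn_left ξ).sub measurable_const
  exact hC.inter (measurableSet_le h.norm measurable_const)

lemma sum_Psi_le_one {ι : Type*} {C : Set ℝ} (hC : MeasurableSet C) {ξ a b T : ℝ} (z : ℂ)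
    (s : Finset ι) (t : ι → ℂ) (hsep : ∀ i ∈ s, ∀ j ∈ s, i ≠ j → 2 * a < ‖t i - t j‖)
    (hT : ∀ i ∈ s, ‖t i‖ ≤ T) (hab : a + 2 * T ≤ b) : ∑ i ∈ s, Psi C a b ξ (z + t i) ≤ 1 := by
  have h1 : ∀ i ∈ s, Psi C a b ξ (z + t i) ≤ mass C ξ (z + t i) a / mass C ξ z (b - T) := by
    intro i hi
    refine ENNReal.div_le_div le_rfl (measure_mono fun y hy => ⟨hy.1, ?_⟩)
    calc ‖Zfn ξ y - (z + t i)‖ = ‖(Zfn ξ y - z) - t i‖ := by congr 1; ring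
      _ ≤ (b - T) + T := (norm_sub_le _ _).trans (add_le_add hy.2 (hT i hi))
      _ = b := by ring
  have h2 : ∑ i ∈ s, mass C ξ (z + t i) a ≤ mass C ξ z (b - T) := by
    unfold mass
    rw [← measure_biUnion_finset]
    · refine measure_mono fun y hy => ?_
      simp only [mem_iUnion, mem_ofPred_eq] at hy
      obtain ⟨i, hi, hyC, hy⟩ := hy
      refine ⟨hyC, ?_⟩
      calc ‖Zfn ξ y - z‖ = ‖(Zfn ξ y - (z + t i)) + t i‖ := by congr 1; ring
        _ ≤ a + T := (norm_add_le _ _).trans (add_le_add hy (hT i hi))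
        _ ≤ b - T := by linarith
    · intro i hi j hj hij
      rw [Function.onFun, Set.disjoint_left]
      rintro y ⟨_, h1⟩ ⟨_, h2⟩
      have := hsep i hi j hj hij
      have h3 : ‖t i - t j‖ ≤ 2 * a := by
        calc ‖t i - t j‖ = ‖(Zfn ξ y - (z + t j)) - (Zfn ξ y - (z + t i))‖ := by congr 1; ring
          _ ≤ a + a := (norm_sub_le _ _).trans (add_le_add h2 h1)
          _ = 2 * a := by ring
      linarith
    · exact fun i _ => measurableSet_ball_preimage hC ξ _ _
  calc _ ≤ ∑ i ∈ s, mass C ξ (z + t i) a / mass C ξ z (b - T) := Finset.sum_le_sum h1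
    _ = (∑ i ∈ s, mass C ξ (z + t i) a) / mass C ξ z (b - T) := by
      simp_rw [div_eq_mul_inv]; rw [Finset.sum_mul]
    _ ≤ mass C ξ z (b - T) / mass C ξ z (b - T) := ENNReal.div_le_div h2 le_rfl
    _ ≤ 1 := ENNReal.div_self_le_one

/-- The two-directional translation argument. -/
lemma overlap_le {C D A : Set ℝ} (hC : MeasurableSet C) (hCI : C ⊆ II) (hD : MeasurableSet D)
    (hDI : D ⊆ II) (hA : MeasurableSet A) {τ₁ τ₂ d r R T : ℝ} (hd : 0 ≤ d) {w₁ w₂ : ℝ → ℂ}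
    (h0 : ∀ ξ ∈ A, ∀ x ∈ C, ∀ x' ∈ C,
      ‖(Zfn (ξ + τ₁) x' - Zfn (ξ + τ₁) x) - (Zfn ξ x' - Zfn ξ x)‖ ≤ d)
    (h1 : ∀ ξ ∈ A, ∀ x ∈ C, ∀ y ∈ D,
      ‖(Zfn (ξ + τ₁) x - Zfn (ξ + τ₁) y) - (Zfn ξ x - Zfn ξ y) - w₁ ξ‖ ≤ d)
    (h0' : ∀ ξ ∈ A, ∀ x ∈ C, ∀ x' ∈ C,
      ‖(Zfn (ξ + τ₂) x' - Zfn (ξ + τ₂) x) - (Zfn ξ x' - Zfn ξ x)‖ ≤ d)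
    (h1' : ∀ ξ ∈ A, ∀ x ∈ C, ∀ y ∈ D,
      ‖(Zfn (ξ + τ₂) x - Zfn (ξ + τ₂) y) - (Zfn ξ x - Zfn ξ y) - w₂ ξ‖ ≤ d)
    {K : ℕ} (hKd : 4 * K * d ≤ r) (hR : 2 * r + 2 * T ≤ R - r)
    (hT0 : 0 ≤ T) (hr : 0 ≤ r)
    (hT : ∀ ξ ∈ A, ∀ i < K, ∀ j < K, ‖i * w₁ ξ + j * w₂ ξ‖ ≤ T)
    (hsep : ∀ ξ ∈ A, ∀ p q : ℤ, (p, q) ≠ (0, 0) → 4 * r < ‖p * w₁ ξ + q * w₂ ξ‖)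
    {e : ENNReal} (he₁ : defect C D A τ₁ ≤ e) (he₂ : defect C D A τ₂ ≤ e) :
    K ^ 2 * overlap C D A r R (fun _ => 0) ≤
      (∫⁻ ξ in A, ∫⁻ y in D, gg C (ξ, y)) + K ^ 2 * (2 * K * e) := by
  set s : Finset (ℕ × ℕ) := Finset.range K ×ˢ Finset.range K with hs
  set t : ℕ × ℕ → ℝ → ℂ := fun q ξ => -(q.1 * w₁ ξ + q.2 * w₂ ξ) with ht
  have each : ∀ q ∈ s, overlap C D A r R (fun _ => 0) ≤
      overlap C D A (2 * r) (R - r) (t q) + 2 * K * e := by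
    rintro ⟨i, j⟩ hq
    simp only [hs, Finset.mem_product, Finset.mem_range] at hq
    obtain ⟨hi, hj⟩ := hq
    have hi' : (i:ℝ) ≤ K := by exact_mod_cast hi.le
    have hj' : (j:ℝ) ≤ K := by exact_mod_cast hj.le
    have b1 : 2 * d * i ≤ 2 * d * K := by gcongr
    have b2 : 2 * d * j ≤ 2 * d * K := by gcongr
    have s1 := overlap_iterate hC hCI hD hDI hA hd h0 h1 i (a := r) (b := R) (fun _ => 0)
      (by linarith)
    have s2 := overlap_iterate hC hCI hD hDI hA hd h0' h1' j (a := r + 2 * d * i)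
      (b := R - 2 * d * i) (fun ξ => 0 - i * w₁ ξ) (by linarith)
    have s3 := overlap_mono (C := C) (D := D) (A := A) (a := r + 2 * d * i + 2 * d * j)
      (a' := 2 * r) (b := R - 2 * d * i - 2 * d * j) (b' := R - r) (by linarith) (by linarith)
      (fun ξ => 0 - i * w₁ ξ - j * w₂ ξ)
    have et : (fun ξ => 0 - i * w₁ ξ - j * w₂ ξ) = t (i, j) := by
      ext ξ; simp only [ht]; ring
    rw [et] at s2 s3
    have hi2 : (i : ENNReal) ≤ K := by exact_mod_cast hi.le
    have hj2 : (j : ENNReal) ≤ K := by exact_mod_cast hj.le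
    calc _ ≤ _ := s1
      _ ≤ (overlap C D A (2 * r) (R - r) (t (i, j)) + j * defect C D A τ₂)
          + i * defect C D A τ₁ := by gcongr; exact s2.trans (by gcongr)
      _ ≤ (overlap C D A (2 * r) (R - r) (t (i, j)) + K * e) + K * e := by gcongr
      _ = _ := by ring
  have hcard : (s.card : ENNReal) = K ^ 2 := by simp [hs, sq]
  have hsum : ∑ q ∈ s, overlap C D A (2 * r) (R - r) (t q) ≤
      ∫⁻ ξ in A, ∫⁻ y in D, gg C (ξ, y) := by
    unfold overlap
    refine (finsetSum_lintegral_le _ _ _).trans (setLIntegral_mono' hA fun ξ hξ => ?_)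
    refine (finsetSum_lintegral_le _ _ _).trans (lintegral_mono fun y => ?_)
    simp only
    rw [← Finset.mul_sum]
    refine mul_le_of_le_one_right' (sum_Psi_le_one (T := T) hC _ s (fun q => t q ξ) ?_ ?_
      (by linarith))
    · intro q _ q' _ hne
      have := hsep ξ hξ ((q'.1:ℤ) - q.1) ((q'.2:ℤ) - q.2) (by
        intro h
        simp only [Prod.mk.injEq] at h
        exact hne (Prod.ext (by omega) (by omega)))
      refine lt_of_lt_of_eq (by linarith) (congrArg norm (?_ : _ = t q ξ - t q' ξ))
      simp only [ht]; push_cast; ring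
    · intro q hq
      simp only [hs, Finset.mem_product, Finset.mem_range] at hq
      simp only [ht, norm_neg]
      exact hT ξ hξ _ hq.1 _ hq.2
  calc _ = ∑ q ∈ s, overlap C D A r R (fun _ => 0) := by
        rw [Finset.sum_const, nsmul_eq_mul, hcard]
    _ ≤ ∑ q ∈ s, (overlap C D A (2 * r) (R - r) (t q) + 2 * K * e) := Finset.sum_le_sum each
    _ = (∑ q ∈ s, overlap C D A (2 * r) (R - r) (t q)) + K ^ 2 * (2 * K * e) := by
        rw [Finset.sum_add_distrib, Finset.sum_const, nsmul_eq_mul, hcard]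
    _ ≤ _ := by gcongr

lemma CL_abs_sub_le {L : ℕ} {k₀ k₁ : ℤ} {x y : ℝ} (hx : x ∈ CL L k₀) (hy : y ∈ CL L k₁) :
    |x - y - ((k₀ - k₁ : ℤ) : ℝ) / 2 ^ L| ≤ 1 / 2 ^ L := by
  have p2 : (0:ℝ) < 2 ^ L := by positivity
  have a1 := Int.floor_le ((2:ℝ) ^ L * x)
  have a2 := Int.lt_floor_add_one ((2:ℝ) ^ L * x)
  have b1 := Int.floor_le ((2:ℝ) ^ L * y)
  have b2 := Int.lt_floor_add_one ((2:ℝ) ^ L * y)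
  rw [hx.2] at a1 a2
  rw [hy.2] at b1 b2
  have e : x - y - ((k₀ - k₁ : ℤ) : ℝ) / 2 ^ L
      = ((2 ^ L * x - k₀) - (2 ^ L * y - k₁)) / 2 ^ L := by
    field_simp; push_cast; ring
  rw [e, abs_div, abs_of_pos p2]
  gcongr
  rw [abs_le]; constructor <;> linarith

lemma abs_le_one_of_mem_II {x : ℝ} (h : x ∈ II) : |x| ≤ 1 :=
  abs_le.2 ⟨by linarith [h.1], h.2.le⟩

lemma two_pi_mul_five_le : 2 * π * 5 ≤ 32 := by nlinarith [pi_lt_d2]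

/-- The increment of `Zfn (ξ + 2⁻ᵐ) - Zfn ξ` between two points at distance close to `h`. -/
lemma shift_close {m : ℕ} (hm : 0 < m) {ξ : ℝ} (h : dig m ξ = 0) {x y h' d : ℝ} (hx : x ∈ II)
    (hy : y ∈ II) (hd : |x - y - h'| ≤ d) :
    ‖(Zfn (ξ + 1 / 2 ^ m) x - Zfn (ξ + 1 / 2 ^ m) y) - (Zfn ξ x - Zfn ξ y)
      - ((2 * π * h' * ww ^ m : ℝ) : ℂ) * (Complex.I * VV m ξ)‖
      ≤ ww ^ m * (32 * d + 1200 * (1 / 2) ^ m) := by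
  have h1 := shift_estimate hm h (abs_le_one_of_mem_II hx) (abs_le_one_of_mem_II hy)
  have hw : 0 < ww ^ m := pow_pos ww_pos m
  have h2 : ‖((2 * π * (x - y - h') * ww ^ m : ℝ) : ℂ) * (Complex.I * VV m ξ)‖
      ≤ ww ^ m * (32 * d) := by
    rw [norm_mul, norm_mul, Complex.norm_I, one_mul, Complex.norm_real, norm_mul, norm_mul,
      Real.norm_of_nonneg hw.le, Real.norm_of_nonneg two_pi_pos.le, Real.norm_eq_abs]
    have hd0 : 0 ≤ d := (abs_nonneg _).trans hd
    calc 2 * π * |x - y - h'| * ww ^ m * ‖VV m ξ‖ ≤ 2 * π * d * ww ^ m * 5 := by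
          gcongr; exact norm_VV_le m ξ
      _ = (2 * π * 5) * (d * ww ^ m) := by ring
      _ ≤ 32 * (d * ww ^ m) := by
          gcongr; exact two_pi_mul_five_le
      _ = _ := by ring
  refine le_trans (le_of_eq ?_) ((norm_add_le _ _).trans (add_le_add h1 h2) |>.trans
    (le_of_eq (by ring)))
  congr 1; push_cast; ring

/-- The translations produced by two patterns are well separated. -/
lemma translation_sep {m : ℕ} {ξ : ℝ} (h : Int.fract (2 ^ m * ξ) ∈ Wd) (c : ℝ) (p q : ℤ)
    (hpq : (p, q) ≠ (0, 0)) :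
    3 * |c| * ww ^ (m + 11) ≤ ‖p * (((2 * π * c * ww ^ (m + 8) : ℝ) : ℂ) * (Complex.I * VV (m + 8) ξ))
      + q * (((2 * π * c * ww ^ (m + 11) : ℝ) : ℂ) * (Complex.I * VV (m + 11) ξ))‖ := by
  have e : (p * (((2 * π * c * ww ^ (m + 8) : ℝ) : ℂ) * (Complex.I * VV (m + 8) ξ))
      + q * (((2 * π * c * ww ^ (m + 11) : ℝ) : ℂ) * (Complex.I * VV (m + 11) ξ)))
      = ((2 * π * c : ℝ) : ℂ) * (Complex.I * (((p * ww ^ (m + 8) : ℝ) : ℂ) * VV (m + 8) ξ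
        + ((q * ww ^ (m + 11) : ℝ) : ℂ) * VV (m + 11) ξ)) := by push_cast; ring
  rw [e, norm_mul, norm_mul, Complex.norm_I, one_mul, Complex.norm_real, norm_mul,
    Real.norm_of_nonneg two_pi_pos.le, Real.norm_eq_abs]
  obtain ⟨a, b⟩ := pattern_indep h (p * ww ^ (m + 8)) (q * ww ^ (m + 11))
  set N := ‖((p * ww ^ (m + 8) : ℝ) : ℂ) * VV (m + 8) ξ
        + ((q * ww ^ (m + 11) : ℝ) : ℂ) * VV (m + 11) ξ‖ with hN
  have w1 := pow_pos ww_pos (m + 8)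
  have w2 := pow_pos ww_pos (m + 11)
  have w12 : ww ^ (m + 11) ≤ ww ^ (m + 8) := pow_le_pow_of_le_one ww_pos.le ww_lt_one.le (by omega)
  have key : ww ^ (m + 11) ≤ 2 * N := by
    rw [abs_mul, abs_of_pos w1] at a
    rw [abs_mul, abs_of_pos w2] at b
    rcases eq_or_ne p 0 with hp | hp
    · have hq : q ≠ 0 := fun hq => hpq (by rw [hp, hq])
      have : (1:ℝ) ≤ |(q:ℝ)| := by exact_mod_cast Int.one_le_abs hq
      nlinarith
    · have : (1:ℝ) ≤ |(p:ℝ)| := by exact_mod_cast Int.one_le_abs hp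
      nlinarith
  have := abs_nonneg c
  calc 3 * |c| * ww ^ (m + 11) ≤ 3 * |c| * (2 * N) := by gcongr
    _ = (2 * 3 * |c|) * N := by ring
    _ ≤ (2 * π * |c|) * N := by gcongr; exact pi_gt_three.le

lemma translation_le {m K : ℕ} (ξ c : ℝ) (hc : |c| ≤ 1) {i j : ℕ} (hi : i < K) (hj : j < K) :
    ‖i * (((2 * π * c * ww ^ (m + 8) : ℝ) : ℂ) * (Complex.I * VV (m + 8) ξ))
      + j * (((2 * π * c * ww ^ (m + 11) : ℝ) : ℂ) * (Complex.I * VV (m + 11) ξ))‖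
      ≤ 64 * K * ww ^ m := by
  have one : ∀ (l i : ℕ), i < K → ‖i * (((2 * π * c * ww ^ (m + l) : ℝ) : ℂ) *
      (Complex.I * VV (m + l) ξ))‖ ≤ 32 * K * ww ^ m := by
    intro l i hi
    have w1 := pow_pos ww_pos (m + l)
    have w0 := pow_pos ww_pos m
    have hw : ww ^ (m + l) ≤ ww ^ m := pow_le_pow_of_le_one ww_pos.le ww_lt_one.le (by omega)
    have hi' : (i:ℝ) ≤ K := by exact_mod_cast hi.le
    rw [norm_mul, norm_mul, norm_mul, Complex.norm_I, one_mul, Complex.norm_real, norm_mul, norm_mul,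
      Real.norm_of_nonneg w1.le, Real.norm_of_nonneg two_pi_pos.le, Real.norm_eq_abs,
      Complex.norm_natCast]
    calc i * (2 * π * |c| * ww ^ (m + l) * ‖VV (m + l) ξ‖)
        ≤ K * (2 * π * 1 * ww ^ m * 5) := by gcongr; exact norm_VV_le _ _
      _ = (2 * π * 5) * (K * ww ^ m) := by ring
      _ ≤ 32 * (K * ww ^ m) := by gcongr; exact two_pi_mul_five_le
      _ = _ := by ring
  refine (norm_add_le _ _).trans ((add_le_add (one 8 i hi) (one 11 j hj)).trans (le_of_eq ?_))
  ring

/-- The set of `ξ` that carry the pattern at position `m`. -/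
def AA (m : ℕ) : Set ℝ := {ξ | ξ ∈ II ∧ Int.fract (2 ^ m * ξ) ∈ Wd}

lemma measurableSet_AA (m : ℕ) : MeasurableSet (AA m) := by
  have : Measurable (fun ξ : ℝ => Int.fract (2 ^ m * ξ)) := measurable_fract.comp (by fun_prop)
  exact measurableSet_Ico.inter (this measurableSet_Ico)

/-- Ratio of the masses of two balls around the image point. -/
def rr (j k : ℕ) (p : ℝ × ℝ) : ENNReal := FF j p / FF (j - k) p

lemma overlap_CL_eq {L j k : ℕ} (k₀ k₁ : ℤ) {A : Set ℝ} (hA : MeasurableSet A) (hAI : A ⊆ II) :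
    overlap (CL L k₀) (CL L k₁) A (ww ^ (j + L)) (ww ^ (j - k + L)) (fun _ => 0) =
      ∫⁻ ξ in A, ∫⁻ x in CL L k₀, gg (CL L k₁) (ξ, x) * rr j k (bb^[L] (ξ, x)) := by
  refine setLIntegral_congr_fun hA fun ξ hξ => ?_
  simp only
  rw [lintegral_gg_symm (measurableSet_CL _ _) (CL_subset _ _) (measurableSet_CL _ _)
    (CL_subset _ _) ξ (measurable_Psi_add (measurableSet_CL _ _) _ _ ξ 0)]
  refine setLIntegral_congr_fun (measurableSet_CL _ _) fun x hx => ?_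
  have hp : (ξ, x) ∈ usq := ⟨hAI hξ, hx.1⟩
  have hc : CL L k₀ = cyl L x := by unfold cyl; rw [hx.2]
  simp only [add_zero]
  congr 1
  unfold Psi rr
  rw [hc, mass_cyl_eq hp L j, mass_cyl_eq hp L (j - k),
    ENNReal.mul_div_mul_left _ _ (by simp) (by simp)]

/-- The overlap of two well separated cylinders on the set where the pattern occurs. -/
lemma overlap_CL_le {M s κ K L L₂ : ℕ} (hK : 1 ≤ K) (h1 : (256:ℝ) * K * 2 ^ s ≤ 2 ^ L)
    (h2 : (3:ℝ) + 128 * K * 2 ^ s ≤ 2 ^ κ) (h3 : (4:ℝ) * 2 ^ L₂ < 3 * 2 ^ s * ww ^ (M + 11))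
    {k₀ k₁ : ℤ} (hfar : (2:ℝ) ^ L ≤ |((k₀ - k₁ : ℤ) : ℝ)| * 2 ^ L₂)
    (hle : |((k₀ - k₁ : ℤ) : ℝ)| ≤ 2 ^ L) {e : ENNReal} (he : 0 < e) :
    ∀ᶠ j : ℕ in atTop, ∀ m ≥ j + L - 2 * s, m ≤ j + L - 2 * s + M →
      K ^ 2 * overlap (CL L k₀) (CL L k₁) (AA m) (ww ^ (j + L)) (ww ^ (j - 2 * κ + L)) (fun _ => 0)
        ≤ (∫⁻ ξ in AA m, ∫⁻ y in CL L k₁, gg (CL L k₀) (ξ, y)) + K ^ 2 * (2 * K * e) := by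
  obtain ⟨N, hN⟩ := eventually_atTop.1 (exists_defect_le (measurableSet_CL L k₀) (CL_subset L k₀)
    (measurableSet_CL L k₁) (CL_subset L k₁) he)
  have hlim : Tendsto (fun n : ℕ => (8:ℝ) * K * 2 ^ s * 1200 * (1 / 2) ^ n) atTop (nhds 0) := by
    simpa using (tendsto_pow_atTop_nhds_zero_of_lt_one (r := (1/2:ℝ)) (by norm_num)
      (by norm_num)).const_mul ((8:ℝ) * K * 2 ^ s * 1200)
  obtain ⟨N', hN'⟩ := eventually_atTop.1 (hlim.eventually_le_const (zero_lt_one))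
  have hK0 : (0:ℝ) < K := by exact_mod_cast hK
  filter_upwards [eventually_ge_atTop (N + N' + 2 * s + 2 * κ + 1)] with j hj m hm hmM
  set n := j + L - 2 * s with hn
  set r := ww ^ (j + L) with hr
  have hr0 : 0 < r := pow_pos ww_pos _
  have hwn : ww ^ n = r * 2 ^ s := by
    have : r = ww ^ n * ww ^ (2 * s) := by rw [hr, ← pow_add]; congr 1; omega
    rw [this, ww_pow_two_mul, mul_assoc, ← mul_pow]; norm_num
  have hRr : ww ^ (j - 2 * κ + L) = r * 2 ^ κ := by
    have : r = ww ^ (j - 2 * κ + L) * ww ^ (2 * κ) := by rw [hr, ← pow_add]; congr 1; omega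
    rw [this, ww_pow_two_mul, mul_assoc, ← mul_pow]; norm_num
  have hsmall : ∀ l, ww ^ (m + l) * (32 * (1 / 2 ^ L) + 1200 * (1 / 2) ^ (m + l)) ≤ r / (4 * K) := by
    intro l
    have a1 : ww ^ (m + l) ≤ r * 2 ^ s := hwn ▸
      pow_le_pow_of_le_one ww_pos.le ww_lt_one.le (by omega)
    have a2 := hN' (m + l) (by omega)
    have a3 : (256:ℝ) * K * 2 ^ s * (1 / 2 ^ L) ≤ 1 := by
      rw [mul_one_div]; exact div_le_one_of_le₀ h1 (by positivity)
    calc _ ≤ r * 2 ^ s * (32 * (1 / 2 ^ L) + 1200 * (1 / 2) ^ (m + l)) := by gcongr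
      _ = r / (8 * K) * (256 * K * 2 ^ s * (1 / 2 ^ L) + 8 * K * 2 ^ s * 1200 * (1 / 2) ^ (m + l)) := by
          field_simp; ring
      _ ≤ r / (8 * K) * (1 + 1) := by gcongr
      _ = r / (4 * K) := by field_simp; norm_num
  set c : ℝ := ((k₀ - k₁ : ℤ) : ℝ) / 2 ^ L with hc
  have p2 : (0:ℝ) < 2 ^ L := by positivity
  have hcabs : |c| = |((k₀ - k₁ : ℤ) : ℝ)| / 2 ^ L := by rw [hc, abs_div, abs_of_pos p2]
  have hc1 : |c| ≤ 1 := by rw [hcabs]; exact div_le_one_of_le₀ hle p2.le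
  have hc2 : 1 ≤ |c| * 2 ^ L₂ := by
    rw [hcabs, div_mul_eq_mul_div, le_div_iff₀ p2, one_mul]; exact hfar
  have hdig : ∀ ξ ∈ AA m, dig (m + 8) ξ = 0 ∧ dig (m + 11) ξ = 0 := fun ξ hξ => pattern_dig hξ.2
  have same : ∀ l, 0 < l → (∀ ξ ∈ AA m, dig (m + l) ξ = 0) → ∀ ξ ∈ AA m, ∀ x ∈ CL L k₀,
      ∀ x' ∈ CL L k₀, ‖(Zfn (ξ + 1 / 2 ^ (m + l)) x' - Zfn (ξ + 1 / 2 ^ (m + l)) x)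
        - (Zfn ξ x' - Zfn ξ x)‖ ≤ r / (4 * K) := by
    intro l hl hd ξ hξ x hx x' hx'
    have := shift_close (m := m + l) (by omega) (hd ξ hξ) hx'.1 hx.1 (h' := 0) (d := 1 / 2 ^ L)
      (by simpa using CL_abs_sub_le hx' hx)
    refine le_trans (le_of_eq ?_) (this.trans (hsmall l))
    simp
  have diff : ∀ l, 0 < l → (∀ ξ ∈ AA m, dig (m + l) ξ = 0) → ∀ ξ ∈ AA m, ∀ x ∈ CL L k₀,
      ∀ y ∈ CL L k₁, ‖(Zfn (ξ + 1 / 2 ^ (m + l)) x - Zfn (ξ + 1 / 2 ^ (m + l)) y)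
        - (Zfn ξ x - Zfn ξ y) - ((2 * π * c * ww ^ (m + l) : ℝ) : ℂ) * (Complex.I * VV (m + l) ξ)‖
        ≤ r / (4 * K) := by
    intro l hl hd ξ hξ x hx y hy
    exact (shift_close (m := m + l) (by omega) (hd ξ hξ) hx.1 hy.1 (CL_abs_sub_le hx hy)).trans
      (hsmall l)
  refine overlap_le (measurableSet_CL _ _) (CL_subset _ _) (measurableSet_CL _ _) (CL_subset _ _)
    (measurableSet_AA m) (τ₁ := 1 / 2 ^ (m + 8)) (τ₂ := 1 / 2 ^ (m + 11)) (d := r / (4 * K))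
    (T := 64 * K * ww ^ n) (by positivity)
    (w₁ := fun ξ => ((2 * π * c * ww ^ (m + 8) : ℝ) : ℂ) * (Complex.I * VV (m + 8) ξ))
    (w₂ := fun ξ => ((2 * π * c * ww ^ (m + 11) : ℝ) : ℂ) * (Complex.I * VV (m + 11) ξ))
    (same 8 (by norm_num) fun ξ hξ => (hdig ξ hξ).1)
    (diff 8 (by norm_num) fun ξ hξ => (hdig ξ hξ).1)
    (same 11 (by norm_num) fun ξ hξ => (hdig ξ hξ).2)
    (diff 11 (by norm_num) fun ξ hξ => (hdig ξ hξ).2)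
    (le_of_eq (by field_simp)) ?_ (by have := pow_pos ww_pos n; positivity) hr0.le ?_ ?_
    (hN N le_rfl _ (by omega) _ fun ξ hξ => hξ.1) (hN N le_rfl _ (by omega) _ fun ξ hξ => hξ.1)
  · rw [hwn, hRr]; nlinarith
  · intro ξ hξ i hi i' hi'
    refine (translation_le ξ c hc1 hi hi').trans ?_
    gcongr ?_ * ?_
    exact pow_le_pow_of_le_one ww_pos.le ww_lt_one.le hm
  · intro ξ hξ p q hpq
    refine lt_of_lt_of_le ?_ (translation_sep hξ.2 c p q hpq)
    have b1 : ww ^ n * ww ^ (M + 11) ≤ ww ^ (m + 11) := by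
      rw [← pow_add]; exact pow_le_pow_of_le_one ww_pos.le ww_lt_one.le (by omega)
    rw [hwn] at b1
    have b2 : 4 < |c| * (3 * 2 ^ s * ww ^ (M + 11)) := by
      have : (0:ℝ) < 2 ^ L₂ := by positivity
      have hcp : 0 < |c| := by by_contra h; nlinarith [abs_nonneg c]
      nlinarith
    have hc0 := abs_nonneg c
    calc 4 * r < |c| * (3 * 2 ^ s * ww ^ (M + 11)) * r := by gcongr
      _ = 3 * |c| * (r * 2 ^ s * ww ^ (M + 11)) := by ring
      _ ≤ _ := by gcongr

lemma II_eq_iUnion_CL (L : ℕ) : II = ⋃ k ∈ Finset.range (2 ^ L), CL L (k : ℤ) := by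
  ext x
  simp only [mem_iUnion, Finset.mem_range, exists_prop]
  constructor
  · intro hx
    have p2 : (0:ℝ) < 2 ^ L := by positivity
    have h0 : 0 ≤ ⌊(2:ℝ) ^ L * x⌋ := Int.floor_nonneg.2 (mul_nonneg p2.le hx.1)
    have h1 : ⌊(2:ℝ) ^ L * x⌋ < 2 ^ L := by
      rw [Int.floor_lt]; push_cast; nlinarith [hx.2]
    refine ⟨⌊(2:ℝ) ^ L * x⌋.toNat, ?_, hx, (Int.toNat_of_nonneg h0).symm⟩
    zify; rw [Int.toNat_of_nonneg h0]; exact_mod_cast h1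
  · rintro ⟨k, -, hx, -⟩
    exact hx

lemma lintegral_II_eq_sum (L : ℕ) (f : ℝ → ENNReal) :
    ∫⁻ x in II, f x = ∑ k ∈ Finset.range (2 ^ L), ∫⁻ x in CL L (k : ℤ), f x := by
  conv_lhs => rw [II_eq_iUnion_CL L]
  rw [lintegral_biUnion_finset]
  · intro a _ b _ hab
    refine Set.disjoint_left.2 fun x ha hb => hab ?_
    exact_mod_cast ha.2.symm.trans hb.2
  · exact fun k _ => measurableSet_CL L k

lemma sum_volume_CL (L : ℕ) : ∑ k ∈ Finset.range (2 ^ L), volume (CL L (k : ℤ)) = 1 := by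
  have := lintegral_II_eq_sum L (fun _ => 1)
  simpa [volume_II] using this.symm

/-- Two cylinders of level `L` at distance at least about `2 ^ (-L₂)`. -/
def far (L L₂ : ℕ) (k₀ k₁ : ℤ) : Prop := (2:ℤ) ^ L ≤ |k₀ - k₁| * 2 ^ L₂

open Classical in
/-- The conditional probability that the second preimage is far away. -/
def Gam (L L₂ : ℕ) (p : ℝ × ℝ) : ENNReal :=
  ∑ k ∈ Finset.range (2 ^ L), if far L L₂ ⌊(2:ℝ) ^ L * p.2⌋ k then gg (CL L k) p else 0

lemma measurable_Gam (L L₂ : ℕ) : Measurable (Gam L L₂) := by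
  refine Finset.measurable_sum _ fun k _ => ?_
  refine Measurable.ite ?_ (measurable_gg (measurableSet_CL _ _)) measurable_const
  have : Measurable (fun p : ℝ × ℝ => ⌊(2:ℝ) ^ L * p.2⌋) := Int.measurable_floor.comp (by fun_prop)
  exact this (MeasurableSet.of_discrete (s := {z : ℤ | far L L₂ z k}))

lemma measurable_FF (j : ℕ) : Measurable (FF j) :=
  measurable_pull (f := fun ξ z => mass II ξ z (ww ^ j)) (measurable_mass measurableSet_Ico _)
    measurable_fst measurable_Zfn

lemma measurable_rr (j k : ℕ) : Measurable (rr j k) := (measurable_FF _).div (measurable_FF _)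

/-- Points whose first coordinate carries the pattern at one of the positions `n, …, n + M`. -/
def GG (n M : ℕ) : Set (ℝ × ℝ) := ⋃ m ∈ Finset.Icc n (n + M), Prod.fst ⁻¹' AA m

lemma measurableSet_GG (n M : ℕ) : MeasurableSet (GG n M) :=
  Finset.measurableSet_biUnion _ fun m _ => measurable_fst (measurableSet_AA m)

lemma setLIntegral_fst_preimage {A : Set ℝ} (hA : MeasurableSet A) (hAI : A ⊆ II)
    {f : ℝ × ℝ → ENNReal} (hf : Measurable f) :
    ∫⁻ p in Prod.fst ⁻¹' A, f p ∂PP = ∫⁻ ξ in A, ∫⁻ x in II, f (ξ, x) := by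
  have e : PP.restrict (Prod.fst ⁻¹' A) = (volume.restrict A).prod lam := by
    unfold PP
    rw [← Set.prod_univ, ← Measure.prod_restrict, Measure.restrict_univ]
    congr 1
    unfold lam
    rw [Measure.restrict_restrict hA, Set.inter_eq_left.2 hAI]
  rw [e, lintegral_prod _ hf.aemeasurable]; rfl

lemma setLIntegral_biUnion_finset_le {α ι : Type*} [MeasurableSpace α] (μ : Measure α)
    (s : Finset ι) (t : ι → Set α) (f : α → ENNReal) :
    ∫⁻ x in ⋃ i ∈ s, t i, f x ∂μ ≤ ∑ i ∈ s, ∫⁻ x in t i, f x ∂μ := by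
  classical
  induction s using Finset.induction_on with
  | empty => simp
  | insert a s ha ih =>
    rw [Finset.set_biUnion_insert, Finset.sum_insert ha]
    exact (lintegral_union_le _ _ _).trans (by gcongr)

lemma lintegral_Gam_le {M s κ K L L₂ : ℕ} (hK : 1 ≤ K) (h1 : (256:ℝ) * K * 2 ^ s ≤ 2 ^ L)
    (h2 : (3:ℝ) + 128 * K * 2 ^ s ≤ 2 ^ κ) (h3 : (4:ℝ) * 2 ^ L₂ < 3 * 2 ^ s * ww ^ (M + 11)) :
    ∀ᶠ j : ℕ in atTop,
      K ^ 2 * ∫⁻ p in GG (j + L - 2 * s) M, Gam L L₂ p * rr j (2 * κ) (bb^[L] p) ∂PP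
        ≤ 2 * (M + 1) := by
  classical
  set e : ENNReal := (2 ^ L * 2 ^ L * (K ^ 2 * (2 * K)))⁻¹ with he
  have hK0 : (K : ENNReal) ≠ 0 := by simp; omega
  have hD0 : (2 ^ L * 2 ^ L * (K ^ 2 * (2 * K)) : ENNReal) ≠ 0 := by positivity
  have hDt : (2 ^ L * 2 ^ L * (K ^ 2 * (2 * K)) : ENNReal) ≠ ⊤ := by
    have : (2 ^ L * 2 ^ L * (K ^ 2 * (2 * K)) : ENNReal)
        = ((2 ^ L * 2 ^ L * (K ^ 2 * (2 * K)) : ℕ) : ENNReal) := by push_cast; rfl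
    rw [this]; exact ENNReal.natCast_ne_top _
  have he0 : 0 < e := ENNReal.inv_pos.2 hDt
  have hpair : ∀ᶠ j : ℕ in atTop, ∀ a ∈ Finset.range (2 ^ L), ∀ b ∈ Finset.range (2 ^ L),
      far L L₂ a b → ∀ m ≥ j + L - 2 * s, m ≤ j + L - 2 * s + M →
      K ^ 2 * overlap (CL L a) (CL L b) (AA m) (ww ^ (j + L)) (ww ^ (j - 2 * κ + L)) (fun _ => 0)
        ≤ (∫⁻ ξ in AA m, ∫⁻ y in CL L b, gg (CL L a) (ξ, y)) + K ^ 2 * (2 * K * e) := by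
    rw [Finset.eventually_all]
    intro a ha
    rw [Finset.eventually_all]
    intro b hb
    rw [Finset.mem_range] at ha hb
    by_cases hf : far L L₂ a b
    · have hle : |((a:ℤ) - (b:ℤ))| ≤ 2 ^ L := by
        have : ((2 ^ L : ℕ) : ℤ) = 2 ^ L := by push_cast; rfl
        rw [abs_le]; omega
      have := overlap_CL_le (k₀ := a) (k₁ := b) hK h1 h2 h3
        (by unfold far at hf; exact_mod_cast hf) (by exact_mod_cast hle) he0
      exact this.mono fun j hj _ => hj
    · exact Eventually.of_forall fun _ h => absurd h hf
  filter_upwards [hpair] with j hj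
  set n := j + L - 2 * s with hn
  have mGam := measurable_Gam L L₂
  have mrr : Measurable (fun p => rr j (2 * κ) (bb^[L] p)) :=
    (measurable_rr j _).comp (measurePreserving_bb_iterate L).measurable
  have hone : ∀ m ∈ Finset.Icc n (n + M),
      K ^ 2 * ∫⁻ p in Prod.fst ⁻¹' AA m, Gam L L₂ p * rr j (2 * κ) (bb^[L] p) ∂PP ≤ 2 := by
    intro m hm
    rw [Finset.mem_Icc] at hm
    rw [setLIntegral_fst_preimage (measurableSet_AA m) (fun ξ h => h.1)
      (f := fun p => Gam L L₂ p * rr j (2 * κ) (bb^[L] p)) (mGam.mul mrr)]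
    have mterm : ∀ b : ℤ, Measurable fun p : ℝ × ℝ => gg (CL L b) p * rr j (2 * κ) (bb^[L] p) :=
      fun b => (measurable_gg (measurableSet_CL _ _)).mul mrr
    have e1 : ∫⁻ ξ in AA m, ∫⁻ x in II, Gam L L₂ (ξ, x) * rr j (2 * κ) (bb^[L] (ξ, x))
        = ∑ a ∈ Finset.range (2 ^ L), ∑ b ∈ Finset.range (2 ^ L), if far L L₂ a b then
          overlap (CL L a) (CL L b) (AA m) (ww ^ (j + L)) (ww ^ (j - 2 * κ + L)) (fun _ => 0)
          else 0 := by
      have e2 : ∀ ξ, ∫⁻ x in II, Gam L L₂ (ξ, x) * rr j (2 * κ) (bb^[L] (ξ, x)) =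
          ∑ a ∈ Finset.range (2 ^ L), ∑ b ∈ Finset.range (2 ^ L), if far L L₂ a b then
            ∫⁻ x in CL L a, gg (CL L b) (ξ, x) * rr j (2 * κ) (bb^[L] (ξ, x)) else 0 := by
        intro ξ
        rw [lintegral_II_eq_sum L]
        refine Finset.sum_congr rfl fun a _ => ?_
        have e3 : ∫⁻ x in CL L a, Gam L L₂ (ξ, x) * rr j (2 * κ) (bb^[L] (ξ, x)) =
            ∫⁻ x in CL L a, ∑ b ∈ Finset.range (2 ^ L), (if far L L₂ a b then
              gg (CL L b) (ξ, x) * rr j (2 * κ) (bb^[L] (ξ, x)) else 0) := by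
          refine setLIntegral_congr_fun (measurableSet_CL L a) fun x hx => ?_
          simp only [Gam, hx.2]
          rw [Finset.sum_mul]
          refine Finset.sum_congr rfl fun b _ => ?_
          split_ifs <;> simp
        rw [e3, lintegral_finsetSum]
        · refine Finset.sum_congr rfl fun b _ => ?_
          split_ifs <;> simp
        · intro b _
          split_ifs
          · exact (mterm b).comp measurable_prodMk_left
          · exact measurable_const
      simp_rw [e2]
      have mm : ∀ a b : ℤ, Measurable fun ξ : ℝ => ∫⁻ x in CL L a, gg (CL L b) (ξ, x) *
          rr j (2 * κ) (bb^[L] (ξ, x)) := fun a b => (mterm b).lintegral_prod_right'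
      rw [lintegral_finsetSum]
      · refine Finset.sum_congr rfl fun a _ => ?_
        rw [lintegral_finsetSum]
        · refine Finset.sum_congr rfl fun b _ => ?_
          split_ifs
          · rw [overlap_CL_eq a b (measurableSet_AA m) (fun ξ h => h.1)]
          · simp
        · intro b _
          split_ifs
          · exact mm a b
          · exact measurable_const
      · intro a _
        refine Finset.measurable_sum _ fun b _ => ?_
        split_ifs
        · exact mm a b
        · exact measurable_const
    rw [e1, Finset.mul_sum]
    have e4 : ∀ a ∈ Finset.range (2 ^ L), ∀ b ∈ Finset.range (2 ^ L),
        K ^ 2 * (if far L L₂ a b then overlap (CL L a) (CL L b) (AA m) (ww ^ (j + L))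
          (ww ^ (j - 2 * κ + L)) (fun _ => 0) else 0) ≤
        (∫⁻ ξ in AA m, ∫⁻ y in CL L b, gg (CL L a) (ξ, y)) + K ^ 2 * (2 * K * e) := by
      intro a ha b hb
      split_ifs with hf
      · exact hj a ha b hb hf m hm.1 hm.2
      · simp
    have e5 : ∀ a : ℤ, ∑ b ∈ Finset.range (2 ^ L), (∫⁻ ξ in AA m, ∫⁻ y in CL L b,
        gg (CL L a) (ξ, y)) ≤ volume (CL L a) := by
      intro a
      rw [← lintegral_finsetSum]
      · calc _ = ∫⁻ ξ in AA m, volume (CL L a) := by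
              refine lintegral_congr fun ξ => ?_
              rw [← lintegral_II_eq_sum L]
              exact lintegral_gg (measurableSet_CL _ _) (CL_subset _ _) ξ
          _ = volume (CL L a) * volume (AA m) := by simp
          _ ≤ volume (CL L a) * 1 := by
              gcongr; exact volume_II ▸ measure_mono fun ξ h => h.1
          _ = _ := mul_one _
      · exact fun b _ => (measurable_gg (measurableSet_CL _ _)).lintegral_prod_right'
    calc _ ≤ ∑ a ∈ Finset.range (2 ^ L), ∑ b ∈ Finset.range (2 ^ L),
          ((∫⁻ ξ in AA m, ∫⁻ y in CL L b, gg (CL L a) (ξ, y)) + K ^ 2 * (2 * K * e)) := by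
          refine Finset.sum_le_sum fun a ha => ?_
          rw [Finset.mul_sum]
          exact Finset.sum_le_sum fun b hb => e4 a ha b hb
      _ ≤ ∑ a ∈ Finset.range (2 ^ L), (volume (CL L (a:ℤ)) + 2 ^ L * (K ^ 2 * (2 * K * e))) := by
          refine Finset.sum_le_sum fun a ha => ?_
          rw [Finset.sum_add_distrib]
          gcongr
          · exact e5 a
          · simp
      _ = 1 + 2 ^ L * (2 ^ L * (K ^ 2 * (2 * K * e))) := by
          rw [Finset.sum_add_distrib, sum_volume_CL]; simp
      _ = 1 + (2 ^ L * 2 ^ L * (K ^ 2 * (2 * K))) * e := by ring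
      _ = 2 := by rw [he, ENNReal.mul_inv_cancel hD0 hDt]; norm_num
  calc _ ≤ K ^ 2 * ∑ m ∈ Finset.Icc n (n + M),
        ∫⁻ p in Prod.fst ⁻¹' AA m, Gam L L₂ p * rr j (2 * κ) (bb^[L] p) ∂PP := by
        gcongr
        unfold GG
        exact setLIntegral_biUnion_finset_le _ _ _ _
    _ ≤ ∑ m ∈ Finset.Icc n (n + M), 2 := by
        rw [Finset.mul_sum]; exact Finset.sum_le_sum hone
    _ = 2 * (M + 1) := by
        rw [Finset.sum_const, Nat.card_Icc, nsmul_eq_mul]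
        rw [show n + M + 1 - n = M + 1 by omega]; push_cast; ring

lemma fract_pow_add (n m : ℕ) (x : ℝ) :
    Int.fract ((2:ℝ) ^ (n + m) * x) = Int.fract (2 ^ m * Int.fract (2 ^ n * x)) := by
  rw [Int.fract_eq_fract]
  refine ⟨2 ^ m * ⌊(2:ℝ) ^ n * x⌋, ?_⟩
  unfold Int.fract
  push_cast
  ring

/-- The points of `[0,1)` whose first `M + 1` iterates avoid the pattern. -/
def Bad (M : ℕ) : Set ℝ := {x | x ∈ II ∧ ∀ i ≤ M, Int.fract (2 ^ i * x) ∉ Wd}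

lemma measurableSet_Bad (M : ℕ) : MeasurableSet (Bad M) := by
  have e : Bad M = II ∩ ⋂ i, ⋂ (_ : i ≤ M), (fun x : ℝ => Int.fract (2 ^ i * x)) ⁻¹' Wdᶜ := by
    ext x; simp [Bad]
  rw [e]
  refine measurableSet_Ico.inter (MeasurableSet.iInter fun i => MeasurableSet.iInter fun _ => ?_)
  exact (measurePreserving_fract_pow i).measurable measurableSet_Ico.compl

lemma antitone_Bad : Antitone Bad := fun _ _ h _ hx => ⟨hx.1, fun i hi => hx.2 i (hi.trans h)⟩

lemma lam_iInter_Bad : lam (⋂ M, Bad M) = 0 := by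
  set Z := ⋂ M, Bad M with hZ
  have mZ : MeasurableSet Z := MeasurableSet.iInter measurableSet_Bad
  have memZ : ∀ x, x ∈ Z ↔ x ∈ II ∧ ∀ i : ℕ, Int.fract (2 ^ i * x) ∉ Wd := by
    intro x
    rw [hZ, mem_iInter]
    exact ⟨fun h => ⟨(h 0).1, fun i => (h i).2 i le_rfl⟩, fun h M => ⟨h.1, fun i _ => h.2 i⟩⟩
  have hII : Z ⊆ II := fun x hx => ((memZ x).1 hx).1
  have hlam : ∀ A ⊆ II, lam A = volume A := fun A hA => Measure.restrict_eq_self _ hA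
  set B : Set ℝ := (fun x : ℝ => 4096 * x - 4) ⁻¹' Z with hB
  have hBI : B ⊆ Wd := by
    intro x hx
    have := hII hx
    constructor <;> [have := this.1; have := this.2] <;> linarith
  have hWI : Wd ⊆ II := Ico_subset_Ico (by norm_num) (by norm_num)
  have hf : ∀ x ∈ B, Int.fract ((2:ℝ) ^ 12 * x) = 4096 * x - 4 := by
    intro x hx
    have h := hII hx
    rw [Int.fract_eq_iff]
    exact ⟨h.1, h.2, 4, by norm_num⟩
  have hBm : MeasurableSet B := (show Measurable fun x : ℝ => 4096 * x - 4 by fun_prop) mZ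
  have vB : lam B = ENNReal.ofReal (1 / 4096) * lam Z := by
    rw [hlam _ (hBI.trans hWI), hlam _ hII]
    have : B = (fun x : ℝ => 4096 * x) ⁻¹' ((fun x => x + -4) ⁻¹' Z) := rfl
    rw [this, Real.volume_preimage_mul_left (by norm_num), measure_preimage_add_right]
    norm_num
  have hdisj : Disjoint Z B := by
    refine Set.disjoint_left.2 fun x hx hb => ?_
    have := ((memZ x).1 hx).2 0
    rw [pow_zero, one_mul, Int.fract_eq_self.2 ((memZ x).1 hx).1] at this
    exact this (hBI hb)
  have hsub : Z ∪ B ⊆ (fun x : ℝ => Int.fract (2 ^ 12 * x)) ⁻¹' Z := by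
    rintro x (hx | hx)
    · refine (memZ _).2 ⟨⟨Int.fract_nonneg _, Int.fract_lt_one _⟩, fun i => ?_⟩
      rw [← fract_pow_add]
      exact ((memZ x).1 hx).2 _
    · rw [mem_preimage, hf x hx]; exact hx
  have h := measure_mono (μ := lam) hsub
  rw [(measurePreserving_fract_pow 12).measure_preimage mZ.nullMeasurableSet,
    measure_union hdisj hBm, vB] at h
  have h0 : ENNReal.ofReal (1 / 4096) * lam Z = 0 := by
    have : lam Z + ENNReal.ofReal (1 / 4096) * lam Z ≤ lam Z + 0 := by simpa using h
    exact le_antisymm ((ENNReal.add_le_add_iff_left (measure_ne_top _ _)).1 this) bot_le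
  rcases mul_eq_zero.1 h0 with h1 | h1
  · norm_num at h1
  · exact h1

lemma exists_PP_compl_GG_le {ε : ENNReal} (hε : 0 < ε) : ∃ M, ∀ n, PP (GG n M)ᶜ ≤ ε := by
  have h : Tendsto (fun M => lam (Bad M)) atTop (nhds 0) := by
    rw [← lam_iInter_Bad]
    exact tendsto_measure_iInter_atTop (fun M => (measurableSet_Bad M).nullMeasurableSet)
      antitone_Bad ⟨0, measure_ne_top _ _⟩
  obtain ⟨M, hM⟩ := (h.eventually_le_const hε).exists
  refine ⟨M, fun n => le_trans ?_ hM⟩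
  have e : PP (Prod.fst ⁻¹' ((fun x : ℝ => Int.fract (2 ^ n * x)) ⁻¹' Bad M)) = lam (Bad M) := by
    have hm := (measurePreserving_fract_pow n).measurable (measurableSet_Bad M)
    unfold PP
    rw [← Set.prod_univ, Measure.prod_prod, measure_univ, mul_one,
      (measurePreserving_fract_pow n).measure_preimage (measurableSet_Bad M).nullMeasurableSet]
  rw [← e]
  refine measure_mono_ae (ae_PP_mem.mono fun p hp hG => ?_)
  refine ⟨⟨Int.fract_nonneg _, Int.fract_lt_one _⟩, fun i hi hW => hG ?_⟩
  unfold GG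
  simp only [mem_iUnion, Finset.mem_Icc]
  refine ⟨n + i, ⟨by omega, by omega⟩, hp.1, ?_⟩
  rw [fract_pow_add]; exact hW

lemma mass_cyl_pow {p : ℝ × ℝ} (hp : p ∈ usq) (n : ℕ) (r : ℝ) :
    mass (cyl n p.2) p.1 (Zfn p.1 p.2) (ww ^ n * r)
      = 2⁻¹ ^ n * mass II (bb^[n] p).1 (Zfn (bb^[n] p).1 (bb^[n] p).2) r := by
  induction n generalizing p with
  | zero => simp [cyl_zero hp.2]
  | succ n ih =>
    rw [pow_succ' ww, mul_assoc, mass_cyl_succ hp, ih (bb_mem hp), pow_succ', mul_assoc,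
      Function.iterate_succ_apply]

lemma le_FF {p : ℝ × ℝ} (hp : p ∈ usq) (j : ℕ) : 2⁻¹ ^ (j + 14) ≤ FF j p := by
  have h := mass_cyl_pow hp (j + 14) 128
  have e : ww ^ (j + 14) * 128 = ww ^ j := by
    rw [pow_add, show 14 = 2 * 7 by norm_num, ww_pow_two_mul]; norm_num; ring
  have hq := bb_iterate_mem hp (j + 14)
  have hone : mass II (bb^[j + 14] p).1 (Zfn (bb^[j + 14] p).1 (bb^[j + 14] p).2) 128 = 1 := by
    rw [← volume_II]
    unfold mass
    congr 1
    ext y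
    exact ⟨fun h => h.1, fun h => ⟨h, norm_Zfn_sub_le _ _ _ (abs_le_one_of_mem_II h)
      (abs_le_one_of_mem_II hq.2)⟩⟩
  rw [e, hone, mul_one] at h
  rw [← h]
  exact mass_mono_set (CL_subset _ _) _ _ _

lemma FF_ne_zero {p : ℝ × ℝ} (hp : p ∈ usq) (j : ℕ) : FF j p ≠ 0 :=
  ((ENNReal.pow_pos (by simp) _).trans_le (le_FF hp j)).ne'

lemma FF_le_one (j : ℕ) (p : ℝ × ℝ) : FF j p ≤ 1 := mass_le_one le_rfl _ _ _

lemma FF_ne_top (j : ℕ) (p : ℝ × ℝ) : FF j p ≠ ⊤ := ((FF_le_one j p).trans_lt (by simp)).ne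

lemma FF_antitone (p : ℝ × ℝ) : Antitone fun j => FF j p := fun _ _ h =>
  mass_mono_radius _ _ _ (pow_le_pow_of_le_one ww_pos.le ww_lt_one.le h)

/-- The conditional probability of the cylinder of level `L` that contains the point. -/
def pc (L : ℕ) (p : ℝ × ℝ) : ENNReal := gg (cyl L p.2) p

lemma measurable_comp_countable {α ι β : Type*} [MeasurableSpace α] [MeasurableSpace β]
    [MeasurableSpace ι] [Countable ι] [MeasurableSingletonClass ι] {f : ι → α → β}
    (hf : ∀ i, Measurable (f i)) {u : α → ι} (hu : Measurable u) : Measurable fun a => f (u a) a := by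
  have h : Measurable (fun q : ι × α => f q.1 q.2) := measurable_from_prod_countable_right hf
  exact h.comp (hu.prodMk measurable_id)

lemma measurable_pc (L : ℕ) : Measurable (pc L) := by
  have hf : Measurable (fun p : ℝ × ℝ => ⌊(2:ℝ) ^ L * p.2⌋) := Int.measurable_floor.comp (by fun_prop)
  exact measurable_comp_countable (fun k => measurable_gg (measurableSet_CL L k)) hf

lemma pc_le_one (L : ℕ) (p : ℝ × ℝ) : pc L p ≤ 1 := gg_le_one (CL_subset _ _) p

lemma ae_tendsto_CL (L : ℕ) : ∀ᵐ p ∂PP, ∀ k : ℤ,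
    Tendsto (fun j => ratio (CL L k) j p.1 (Zfn p.1 p.2)) atTop (nhds (gg (CL L k) p)) :=
  ae_all_iff.2 fun k => ae_gg_tendsto (measurableSet_CL L k) (CL_subset L k)

lemma ratio_cyl {p : ℝ × ℝ} (hp : p ∈ usq) (L j : ℕ) :
    ratio (cyl L p.2) (j + L) p.1 (Zfn p.1 p.2) = 2⁻¹ ^ L * FF j (bb^[L] p) / FF (j + L) p := by
  unfold ratio
  rw [mass_cyl_eq hp]; rfl

lemma ae_tendsto_pc (L : ℕ) : ∀ᵐ p ∂PP,
    Tendsto (fun j => 2⁻¹ ^ L * FF j (bb^[L] p) / FF (j + L) p) atTop (nhds (pc L p)) := by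
  filter_upwards [ae_tendsto_CL L, ae_PP_mem] with p h hp
  refine ((h ⌊(2:ℝ) ^ L * p.2⌋).comp (tendsto_add_atTop_nat L)).congr fun j => ?_
  exact ratio_cyl hp L j

lemma ae_pc_succ (L : ℕ) : ∀ᵐ p ∂PP, pc (L + 1) p = pc 1 p * pc L (bb p) := by
  filter_upwards [ae_tendsto_pc (L + 1), ae_tendsto_pc 1,
    measurePreserving_bb.quasiMeasurePreserving.ae (ae_tendsto_pc L), ae_PP_mem] with p h1 h2 h3 hp
  refine tendsto_nhds_unique h1 ?_
  have h2' := h2.comp (tendsto_add_atTop_nat L)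
  have hne : ∀ {a : ENNReal}, a ≤ 1 → a ≠ ⊤ := fun h => (h.trans_lt (by simp)).ne
  refine (ENNReal.Tendsto.mul h2' (Or.inr (hne (pc_le_one _ _))) h3
    (Or.inr (hne (pc_le_one _ _)))).congr fun j => ?_
  have a1 := FF_ne_zero (bb_mem hp) (j + L)
  have a2 := FF_ne_top (j + L) (bb p)
  simp only [Function.comp, Function.iterate_one, pow_one]
  rw [← Function.iterate_succ_apply, div_eq_mul_inv, div_eq_mul_inv, div_eq_mul_inv, pow_succ',
    ← add_assoc]
  calc _ = 2⁻¹ * 2⁻¹ ^ L * FF j (bb^[L + 1] p) * (FF (j + L + 1) p)⁻¹ *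
        (FF (j + L) (bb p) * (FF (j + L) (bb p))⁻¹) := by ring
    _ = _ := by rw [ENNReal.mul_inv_cancel a1 a2, mul_one]

lemma ae_pc_zero : ∀ᵐ p ∂PP, pc 0 p = 1 := by
  filter_upwards [ae_tendsto_pc 0, ae_PP_mem] with p h hp
  refine tendsto_nhds_unique h (tendsto_const_nhds.congr fun j => ?_)
  simp [ENNReal.div_self (FF_ne_zero hp j) (FF_ne_top j p)]

/-- The product of the conditional probabilities along the orbit. -/
def Qp (L : ℕ) (p : ℝ × ℝ) : ENNReal := ∏ i ∈ Finset.range L, pc 1 (bb^[i] p)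

lemma Qp_succ (L : ℕ) (p : ℝ × ℝ) : Qp (L + 1) p = pc 1 p * Qp L (bb p) := by
  unfold Qp
  rw [Finset.prod_range_succ', mul_comm]; rfl

lemma ae_pc_eq_Qp (L : ℕ) : ∀ᵐ p ∂PP, pc L p = Qp L p := by
  induction L with
  | zero => exact ae_pc_zero.mono fun p hp => by simpa [Qp] using hp
  | succ L ih =>
    filter_upwards [ae_pc_succ L, measurePreserving_bb.quasiMeasurePreserving.ae ih] with p h1 h2
    rw [h1, h2, Qp_succ]

lemma Qp_antitone (p : ℝ × ℝ) : Antitone fun L => Qp L p := by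
  refine antitone_nat_of_succ_le fun L => ?_
  unfold Qp
  rw [Finset.prod_range_succ]
  exact mul_le_of_le_one_right' (pc_le_one _ _)

lemma measurable_Qp (L : ℕ) : Measurable (Qp L) :=
  Finset.measurable_fun_prod _ fun i _ =>
    (measurable_pc 1).comp (measurePreserving_bb_iterate i).measurable

/-- The limit of the conditional probabilities of the cylinders containing the point. -/
def mm (p : ℝ × ℝ) : ENNReal := ⨅ L, Qp L p

lemma measurable_mm : Measurable mm := Measurable.iInf measurable_Qp

lemma tendsto_Qp (p : ℝ × ℝ) : Tendsto (fun L => Qp L p) atTop (nhds (mm p)) :=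
  tendsto_atTop_iInf (Qp_antitone p)

lemma mm_eq (p : ℝ × ℝ) : mm p = pc 1 p * mm (bb p) := by
  refine tendsto_nhds_unique ((tendsto_Qp p).comp (tendsto_add_atTop_nat 1)) ?_
  refine (ENNReal.Tendsto.const_mul (tendsto_Qp (bb p))
    (Or.inr ((pc_le_one 1 p).trans_lt (by simp)).ne)).congr fun L => ?_
  exact (Qp_succ L p).symm

lemma mm_le_one (p : ℝ × ℝ) : mm p ≤ 1 := (iInf_le _ 0).trans (by simp [Qp])

lemma ae_mm_bb : ∀ᵐ p ∂PP, mm (bb p) = mm p := by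
  have hle : ∀ p, mm p ≤ mm (bb p) := fun p => by
    conv_lhs => rw [mm_eq p]
    exact mul_le_of_le_one_left' (pc_le_one _ _)
  have hintegral : ∫⁻ p, mm (bb p) ∂PP = ∫⁻ p, mm p ∂PP :=
    measurePreserving_bb.lintegral_comp measurable_mm
  have hfin : ∫⁻ p, mm p ∂PP ≠ ⊤ :=
    ((lintegral_mono mm_le_one).trans_lt (by simp)).ne
  exact (ae_eq_of_ae_le_of_lintegral_le (Eventually.of_forall hle) hfin
    (measurable_mm.comp measurable_bb).aemeasurable hintegral.le).symm

lemma ae_pc_one_of_mm : ∀ᵐ p ∂PP, mm p ≠ 0 → pc 1 p = 1 := by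
  filter_upwards [ae_mm_bb] with p h h0
  have h1 := mm_eq p
  rw [h] at h1
  have ht : mm p ≠ ⊤ := ((mm_le_one p).trans_lt (by simp)).ne
  calc pc 1 p = pc 1 p * mm p / mm p := (ENNReal.mul_div_cancel_right h0 ht).symm
    _ = 1 := by rw [← h1, ENNReal.div_self h0 ht]

/-- The set of points on which the fibres are infinite. -/
def UU : Set (ℝ × ℝ) := {p | mm p = 0}

lemma measurableSet_UU : MeasurableSet UU := measurable_mm (measurableSet_singleton 0)

lemma ae_UU_bb : ∀ᵐ p ∂PP, (bb p ∈ UU ↔ p ∈ UU) :=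
  ae_mm_bb.mono fun p h => by unfold UU; simp only [mem_ofPred_eq, h]

lemma ae_UU_iterate (n : ℕ) : ∀ᵐ p ∂PP, (bb^[n] p ∈ UU ↔ p ∈ UU) := by
  induction n with
  | zero => simp
  | succ n ih =>
    filter_upwards [ae_UU_bb, measurePreserving_bb.quasiMeasurePreserving.ae ih] with p h1 h2
    rw [Function.iterate_succ_apply, h2, h1]

lemma ae_pc_ne_zero (L : ℕ) : ∀ᵐ p ∂PP, pc L p ≠ 0 := by
  have hk : ∀ k : ℤ, PP {p | p.2 ∈ CL L k ∧ gg (CL L k) p = 0} = 0 := by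
    intro k
    have mC := measurableSet_CL L k
    have mS : MeasurableSet {p : ℝ × ℝ | p.2 ∈ CL L k ∧ gg (CL L k) p = 0} :=
      (measurable_snd mC).inter (measurable_gg mC (measurableSet_singleton 0))
    unfold PP
    rw [Measure.measure_prod_null mS]
    refine Eventually.of_forall fun ξ => ?_
    have mD : MeasurableSet {z | DD (CL L k) ξ z = 0} :=
      measurable_section (measurable_DD mC) ξ (measurableSet_singleton 0)
    have h := lintegral_gg_eq mC (CL_subset L k) ξ
      (a := ({z | DD (CL L k) ξ z = 0}).indicator 1) (measurable_one.indicator mD)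
    have h0 : ∀ y, gg (CL L k) (ξ, y) * ({z | DD (CL L k) ξ z = 0}).indicator 1 (Zfn ξ y) = 0 := by
      intro y
      by_cases hy : DD (CL L k) ξ (Zfn ξ y) = 0
      · simp [gg, hy]
      · simp [hy]
    simp only [h0, lintegral_zero] at h
    have e : ∫⁻ y in CL L k, ({z | DD (CL L k) ξ z = 0}).indicator (1 : ℂ → ENNReal) (Zfn ξ y)
        = volume.restrict (CL L k) ((Zfn ξ) ⁻¹' {z | DD (CL L k) ξ z = 0}) := by
      rw [← lintegral_indicator_one (measurable_Zfn_left ξ mD)]; rfl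
    rw [e] at h
    refine le_antisymm ?_ bot_le
    refine le_trans ?_ h.symm.le
    rw [Measure.restrict_apply (measurable_Zfn_left ξ mD)]
    refine (Measure.restrict_apply_le _ _).trans (measure_mono fun y hy => ?_)
    exact ⟨hy.2, hy.1⟩
  have := ae_all_iff.2 fun k => measure_eq_zero_iff_ae_notMem.1 (hk k)
  filter_upwards [this, ae_PP_mem] with p h hp h0
  exact h ⌊(2:ℝ) ^ L * p.2⌋ ⟨⟨hp.2, rfl⟩, h0⟩

lemma sum_setVolume_CL (L : ℕ) {E : Set ℝ} (hE : MeasurableSet E) (s : Finset ℕ) :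
    ∑ k ∈ s, volume (CL L (k : ℤ) ∩ E) = volume (⋃ k ∈ s, CL L (k : ℤ) ∩ E) := by
  refine (measure_biUnion_finset (f := fun k : ℕ => CL L (k : ℤ) ∩ E) ?_
    fun k _ => (measurableSet_CL L k).inter hE).symm
  intro a _ b _ hab
  refine Set.disjoint_left.2 fun x ha hb => hab ?_
  exact_mod_cast ha.1.2.symm.trans hb.1.2

lemma mass_eq_inter (C : Set ℝ) (ξ : ℝ) (z : ℂ) (r : ℝ) :
    mass C ξ z r = volume (C ∩ {y | ‖Zfn ξ y - z‖ ≤ r}) := rfl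

lemma measurableSet_near (ξ : ℝ) (z : ℂ) (r : ℝ) : MeasurableSet {y | ‖Zfn ξ y - z‖ ≤ r} :=
  measurableSet_le ((measurable_Zfn_left ξ).sub_const z).norm measurable_const

lemma sum_mass_CL (L : ℕ) (ξ : ℝ) (z : ℂ) (r : ℝ) :
    ∑ k ∈ Finset.range (2 ^ L), mass (CL L (k : ℤ)) ξ z r = mass II ξ z r := by
  simp only [mass_eq_inter]
  rw [sum_setVolume_CL L (measurableSet_near ξ z r), II_eq_iUnion_CL L]
  simp only [iUnion_inter]

lemma ae_sum_gg_CL (L : ℕ) : ∀ᵐ p ∂PP, ∑ k ∈ Finset.range (2 ^ L), gg (CL L (k : ℤ)) p = 1 := by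
  filter_upwards [ae_tendsto_CL L, ae_PP_mem] with p h hp
  have h1 : Tendsto (fun j => ∑ k ∈ Finset.range (2 ^ L), ratio (CL L (k : ℤ)) j p.1 (Zfn p.1 p.2))
      atTop (nhds (∑ k ∈ Finset.range (2 ^ L), gg (CL L (k : ℤ)) p)) :=
    tendsto_finsetSum _ fun k _ => h k
  refine tendsto_nhds_unique h1 (tendsto_const_nhds.congr fun j => ?_)
  unfold ratio
  simp only [div_eq_mul_inv]
  rw [← Finset.sum_mul, sum_mass_CL]
  exact (ENNReal.mul_inv_cancel (FF_ne_zero hp j) (FF_ne_top j p)).symm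

/-- The points close to the boundary of a cylinder of level `L₀`. -/
def SS (L₀ : ℕ) (δ : ℝ) : Set ℝ := {y | y ∈ II ∧ Int.fract (2 ^ L₀ * y) ∉ Ico δ (1 - δ)}

lemma measurableSet_SS (L₀ : ℕ) (δ : ℝ) : MeasurableSet (SS L₀ δ) :=
  measurableSet_Ico.inter
    ((measurePreserving_fract_pow L₀).measurable measurableSet_Ico.compl)

lemma SS_subset (L₀ : ℕ) (δ : ℝ) : SS L₀ δ ⊆ II := fun _ h => h.1

lemma volume_SS_le (L₀ : ℕ) (δ : ℝ) : volume (SS L₀ δ) ≤ 2 * ENNReal.ofReal δ := by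
  rw [← Measure.restrict_eq_self volume (SS_subset L₀ δ)]
  change lam _ ≤ _
  have h1 : lam (SS L₀ δ) ≤ lam ((fun x : ℝ => Int.fract (2 ^ L₀ * x)) ⁻¹' (Ico δ (1 - δ))ᶜ) :=
    measure_mono fun y hy => hy.2
  rw [(measurePreserving_fract_pow L₀).measure_preimage measurableSet_Ico.compl.nullMeasurableSet]
    at h1
  refine h1.trans ?_
  unfold lam
  rw [Measure.restrict_apply measurableSet_Ico.compl]
  calc volume ((Ico δ (1 - δ))ᶜ ∩ II) ≤ volume (Ico 0 δ ∪ Ico (1 - δ) 1) := by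
        refine measure_mono fun x hx => ?_
        by_cases h : x < δ
        · exact Or.inl ⟨hx.2.1, h⟩
        · refine Or.inr ⟨?_, hx.2.2⟩
          by_contra h2
          exact hx.1 ⟨not_lt.1 h, not_le.1 h2⟩
    _ ≤ volume (Ico 0 δ) + volume (Ico (1 - δ) 1) := measure_union_le _ _
    _ = 2 * ENNReal.ofReal δ := by
        rw [Real.volume_Ico, Real.volume_Ico, two_mul]; congr 2 <;> ring

lemma mem_cyl_or_mem_SS {L L₀ L₂ : ℕ} (hL : L₂ ≤ L) {x y : ℝ} (hx : x ∈ II) {k : ℤ}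
    (hy : y ∈ CL L k) (hk : ¬ far L L₂ ⌊(2:ℝ) ^ L * x⌋ k) :
    y ∈ cyl L₀ x ∪ SS L₀ (2 * 2 ^ L₀ / 2 ^ L₂) := by
  set δ : ℝ := 2 * 2 ^ L₀ / 2 ^ L₂ with hδ
  have h1 := CL_abs_sub_le (L := L) (k₀ := ⌊(2:ℝ) ^ L * x⌋) ⟨hx, rfl⟩ hy
  unfold far at hk
  have h2 : |((⌊(2:ℝ) ^ L * x⌋ - k : ℤ) : ℝ)| * 2 ^ L₂ < 2 ^ L := by exact_mod_cast not_le.1 hk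
  set c : ℝ := ((⌊(2:ℝ) ^ L * x⌋ - k : ℤ) : ℝ) with hc
  have q2 : (0:ℝ) < 2 ^ L := by positivity
  have q3 : (0:ℝ) < 2 ^ L₂ := by positivity
  have q4 : (0:ℝ) < 2 ^ L₀ := by positivity
  have h3 : |c / 2 ^ L| < 1 / 2 ^ L₂ := by
    rw [abs_div, abs_of_pos q2, div_lt_div_iff₀ q2 q3]; linarith
  have h4 : (1:ℝ) / 2 ^ L ≤ 1 / 2 ^ L₂ :=
    one_div_le_one_div_of_le q3 (pow_le_pow_right₀ (by norm_num) hL)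
  have h5 : |x - y| < 2 / 2 ^ L₂ := by
    calc |x - y| = |(x - y - c / 2 ^ L) + c / 2 ^ L| := by rw [sub_add_cancel]
      _ ≤ |x - y - c / 2 ^ L| + |c / 2 ^ L| := abs_add_le _ _
      _ < 1 / 2 ^ L₂ + 1 / 2 ^ L₂ := by linarith
      _ = 2 / 2 ^ L₂ := by ring
  have h6 : |2 ^ L₀ * x - 2 ^ L₀ * y| < δ := by
    rw [← mul_sub, abs_mul, abs_of_pos q4, hδ]
    calc 2 ^ L₀ * |x - y| < 2 ^ L₀ * (2 / 2 ^ L₂) := by gcongr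
      _ = _ := by ring
  by_cases hs : Int.fract ((2:ℝ) ^ L₀ * y) ∈ Ico δ (1 - δ)
  · left
    refine ⟨hy.1, ?_⟩
    rw [abs_lt] at h6
    have := Int.self_sub_floor ((2:ℝ) ^ L₀ * y)
    symm
    rw [Int.floor_eq_iff]
    constructor <;> linarith [hs.1, hs.2]
  · exact Or.inr ⟨hy.1, hs⟩

lemma ae_one_le_Gam {L L₀ L₂ : ℕ} (hL : L₂ ≤ L) : ∀ᵐ p ∂PP,
    1 ≤ Gam L L₂ p + (pc L₀ p + gg (SS L₀ (2 * 2 ^ L₀ / 2 ^ L₂)) p) := by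
  classical
  set S := SS L₀ (2 * 2 ^ L₀ / 2 ^ L₂) with hS
  filter_upwards [ae_tendsto_CL L, ae_tendsto_CL L₀, ae_PP_mem, ae_sum_gg_CL L,
    ae_gg_tendsto (measurableSet_SS _ _) (SS_subset L₀ (2 * 2 ^ L₀ / 2 ^ L₂))] with p h h₀ hp hs hS'
  rw [← hs, ← Finset.sum_filter_add_sum_filter_not (Finset.range (2 ^ L))
    (fun k : ℕ => far L L₂ ⌊(2:ℝ) ^ L * p.2⌋ k)]
  refine add_le_add (le_of_eq ?_) ?_
  · unfold Gam
    rw [Finset.sum_filter]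
  · set s := Finset.filter (fun k : ℕ => ¬ far L L₂ ⌊(2:ℝ) ^ L * p.2⌋ k) (Finset.range (2 ^ L))
    have h1 : Tendsto (fun j => ∑ k ∈ s, ratio (CL L (k : ℤ)) j p.1 (Zfn p.1 p.2))
        atTop (nhds (∑ k ∈ s, gg (CL L (k : ℤ)) p)) := tendsto_finsetSum _ fun k _ => h k
    refine le_of_tendsto_of_tendsto h1 ((h₀ ⌊(2:ℝ) ^ L₀ * p.2⌋).add hS')
      (Eventually.of_forall fun j => ?_)
    unfold ratio
    simp only [div_eq_mul_inv]
    rw [← Finset.sum_mul, ← add_mul]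
    gcongr
    simp only [mass_eq_inter]
    rw [sum_setVolume_CL L (measurableSet_near _ _ _)]
    refine le_trans (measure_mono ?_) (measure_union_le _ _)
    intro y hy
    simp only [mem_iUnion] at hy
    obtain ⟨k, hk, hy1, hy2⟩ := hy
    have := mem_cyl_or_mem_SS (L₀ := L₀) hL hp.2 hy1 (Finset.mem_filter.1 hk).2
    exact this.imp (fun h => ⟨h, hy2⟩) (fun h => ⟨h, hy2⟩)

lemma lintegral_gg_PP {C : Set ℝ} (hC : MeasurableSet C) (h : C ⊆ II) :
    ∫⁻ p, gg C p ∂PP = volume C := by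
  unfold PP
  rw [lintegral_prod _ (measurable_gg hC).aemeasurable]
  simp [lintegral_gg hC h]

lemma exists_pc_small {ε : ENNReal} (hε : 0 < ε) :
    ∃ L₀, PP (UU ∩ {p | 1 / 4 ≤ pc L₀ p}) ≤ ε := by
  have hm : ∀ L, MeasurableSet (UU ∩ {p | 1 / 4 ≤ Qp L p}) := fun L =>
    measurableSet_UU.inter (measurableSet_le measurable_const (measurable_Qp L))
  have h : Tendsto (fun L => PP (UU ∩ {p | 1 / 4 ≤ Qp L p})) atTop (nhds 0) := by
    have e : (⋂ L, UU ∩ {p | 1 / 4 ≤ Qp L p}) = ∅ := by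
      refine eq_empty_of_forall_notMem fun p hp => ?_
      rw [mem_iInter] at hp
      have h0 : mm p = 0 := (hp 0).1
      have h1 : 1 / 4 ≤ mm p := le_iInf fun L => (hp L).2
      rw [h0] at h1
      simp at h1
    rw [← measure_empty (μ := PP), ← e]
    refine tendsto_measure_iInter_atTop (fun L => (hm L).nullMeasurableSet) ?_ ⟨0, measure_ne_top _ _⟩
    exact fun a b hab p hp => ⟨hp.1, le_trans hp.2 (Qp_antitone p hab)⟩
  obtain ⟨L, hL⟩ := (h.eventually_le_const hε).exists
  refine ⟨L, le_trans (measure_mono_ae ?_) hL⟩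
  filter_upwards [ae_pc_eq_Qp L] with p hp h
  exact ⟨h.1, le_of_le_of_eq h.2 hp⟩

lemma exists_Gam_large {ε : ENNReal} (hε : 0 < ε) :
    ∃ L₂, ∀ L ≥ L₂, PP (UU ∩ {p | Gam L L₂ p < 1 / 2}) ≤ ε := by
  have hε2 : 0 < ε / 2 := ENNReal.half_pos hε.ne'
  obtain ⟨L₀, hL₀⟩ := exists_pc_small hε2
  have hlim : Tendsto (fun n : ℕ => 8 * ENNReal.ofReal (2 * 2 ^ L₀ / 2 ^ n)) atTop (nhds 0) := by
    have h1 : Tendsto (fun n : ℕ => (2 * 2 ^ L₀ / 2 ^ n : ℝ)) atTop (nhds 0) :=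
      tendsto_const_nhds.div_atTop (tendsto_pow_atTop_atTop_of_one_lt (by norm_num))
    have h2 := ENNReal.Tendsto.const_mul (ENNReal.tendsto_ofReal h1) (a := 8) (Or.inr (by simp))
    simpa using h2
  obtain ⟨L₂, hL₂⟩ := (hlim.eventually_le_const hε2).exists
  refine ⟨L₂, fun L hL => ?_⟩
  set S := SS L₀ (2 * 2 ^ L₀ / 2 ^ L₂) with hS
  have hSb : PP {p | 1 / 4 ≤ gg S p} ≤ ε / 2 := by
    have h1 := mul_meas_ge_le_lintegral (μ := PP)
      (measurable_gg (measurableSet_SS L₀ (2 * 2 ^ L₀ / 2 ^ L₂)))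
      (1 / 4)
    rw [lintegral_gg_PP (measurableSet_SS _ _) (SS_subset _ _)] at h1
    refine le_trans ?_ hL₂
    have h2 := h1.trans (volume_SS_le _ _)
    calc PP {p | 1 / 4 ≤ gg S p} = 4 * (1 / 4 * PP {p | 1 / 4 ≤ gg S p}) := by
          rw [← mul_assoc, one_div, ENNReal.mul_inv_cancel (by simp) (by simp), one_mul]
      _ ≤ 4 * (2 * ENNReal.ofReal (2 * 2 ^ L₀ / 2 ^ L₂)) := by gcongr
      _ = _ := by ring
  calc _ ≤ PP ((UU ∩ {p | 1 / 4 ≤ pc L₀ p}) ∪ {p | 1 / 4 ≤ gg S p}) := by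
        refine measure_mono_ae ?_
        filter_upwards [ae_one_le_Gam (L₀ := L₀) hL] with p hp h
        by_contra hcon
        have hcon := not_or.1 hcon
        have a1 : pc L₀ p < 1 / 4 := by
          by_contra h4; exact hcon.1 ⟨h.1, not_lt.1 h4⟩
        have a2 : gg S p < 1 / 4 := not_le.1 hcon.2
        have a3 : Gam L L₂ p < 1 / 2 := h.2
        have := ENNReal.add_lt_add a3 (ENNReal.add_lt_add a1 a2)
        refine absurd hp (not_le.2 (this.trans_le (le_of_eq ?_)))
        rw [← ENNReal.toReal_eq_toReal_iff' (by finiteness) (by finiteness)]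
        rw [ENNReal.toReal_add (by finiteness) (by finiteness),
          ENNReal.toReal_add (by finiteness) (by finiteness)]
        norm_num
    _ ≤ ε / 2 + ε / 2 := (measure_union_le _ _).trans (add_le_add hL₀ hSb)
    _ = ε := ENNReal.add_halves ε

/-- Weak type bound from the Besicovitch covering theorem. -/
lemma exists_weak_type_bound : ∃ N : ℕ, ∀ (ν μ : Measure ℂ) (ε : ENNReal) (A : Set ℂ),
    (∀ z ∈ A, ∃ j : ℕ, ν (Metric.closedBall z (ww ^ j)) ≤ ε * μ (Metric.closedBall z (ww ^ j))) →
    ν A ≤ N * (ε * μ univ) := by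
  obtain ⟨N, τ, hτ, hN⟩ := HasBesicovitchCovering.no_satelliteConfig (α := ℂ)
  refine ⟨N, fun ν μ ε A hA => ?_⟩
  choose! J hJ using hA
  let q : Besicovitch.BallPackage A ℂ :=
    { c := fun z => z
      r := fun z => ww ^ J z
      rpos := fun z => pow_pos ww_pos _
      r_bound := 1
      r_le := fun z => pow_le_one₀ ww_pos.le ww_lt_one.le }
  obtain ⟨s, hs, hcov⟩ := Besicovitch.exist_disjoint_covering_families hτ hN q
  have hcount : ∀ i, (s i).Countable := fun i =>
    (hs i).countable_of_nonempty_interior fun z _ =>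
      ⟨z, Metric.ball_subset_interior_closedBall (Metric.mem_ball_self (q.rpos z))⟩
  have hone : ∀ i, ν (⋃ z ∈ s i, Metric.ball (q.c z) (q.r z)) ≤ ε * μ univ := by
    intro i
    calc ν (⋃ z ∈ s i, Metric.ball (q.c z) (q.r z))
        ≤ ν (⋃ z ∈ s i, Metric.closedBall (q.c z) (q.r z)) :=
          measure_mono (iUnion₂_mono fun z _ => Metric.ball_subset_closedBall)
      _ ≤ ∑' z : s i, ν (Metric.closedBall (q.c z) (q.r z)) := measure_biUnion_le _ (hcount i) _
      _ ≤ ∑' z : s i, ε * μ (Metric.closedBall (q.c z) (q.r z)) :=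
          ENNReal.tsum_le_tsum fun z => hJ _ z.1.2
      _ = ε * μ (⋃ z ∈ s i, Metric.closedBall (q.c z) (q.r z)) := by
          rw [ENNReal.tsum_mul_left, measure_biUnion (hcount i) (hs i)
            fun z _ => Metric.isClosed_closedBall.measurableSet]
      _ ≤ ε * μ univ := by gcongr; exact subset_univ _
  have hAsub : A ⊆ ⋃ i, ⋃ z ∈ s i, Metric.ball (q.c z) (q.r z) := by
    intro z hz
    exact hcov ⟨⟨z, hz⟩, rfl⟩
  calc ν A ≤ ∑ i, ν (⋃ z ∈ s i, Metric.ball (q.c z) (q.r z)) :=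
        (measure_mono hAsub).trans (measure_iUnion_fintype_le _ _)
    _ ≤ ∑ i : Fin N, ε * μ univ := Finset.sum_le_sum fun i _ => hone i
    _ = N * (ε * μ univ) := by simp

/-- The conditional probabilities of the cylinder of level one at finite resolution. -/
def qr (j : ℕ) (p : ℝ × ℝ) : ENNReal := 2⁻¹ * FF j (bb p) / FF (j + 1) p

lemma measurable_qr (j : ℕ) : Measurable (qr j) :=
  (((measurable_FF j).comp measurable_bb).const_mul _).div (measurable_FF _)

lemma qr_eq_ratio {p : ℝ × ℝ} (hp : p ∈ usq) (j : ℕ) :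
    qr j p = ratio (cyl 1 p.2) (j + 1) p.1 (Zfn p.1 p.2) := by
  rw [ratio_cyl hp 1 j]; simp [qr]

lemma exists_qr_bound : ∃ N : ℕ, ∀ ε : ENNReal, PP {p | ∃ j, qr j p ≤ ε} ≤ N * ε := by
  obtain ⟨N, hN⟩ := exists_weak_type_bound
  have hC : ∀ (ξ : ℝ) (k : ℤ) (ε : ENNReal),
      volume {y | y ∈ CL 1 k ∧ ∃ j, ratio (CL 1 k) j ξ (Zfn ξ y) ≤ ε} ≤ N * ε := by
    intro ξ k ε
    set A : Set ℂ := {z | ∃ j, ratio (CL 1 k) j ξ z ≤ ε} with hA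
    have h1 : nu (CL 1 k) ξ A ≤ N * (ε * nu II ξ univ) := by
      refine hN _ _ _ _ fun z hz => ?_
      obtain ⟨j, hj⟩ := hz
      refine ⟨j, ?_⟩
      rw [← mass_eq_nu (measurableSet_CL 1 k), ← mass_eq_nu measurableSet_Ico]
      unfold ratio at hj
      by_cases h0 : mass II ξ z (ww ^ j) = 0
      · rw [h0, mul_zero]; exact (mass_mono_set (CL_subset 1 k) _ _ _).trans h0.le
      · rwa [ENNReal.div_le_iff_le_mul (Or.inl h0)
          (Or.inl ((mass_le_one le_rfl _ _ _).trans_lt (by simp)).ne)] at hj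
    have h2 : nu II ξ univ ≤ 1 := by
      unfold nu
      rw [Measure.map_apply (measurable_Zfn_left ξ) MeasurableSet.univ]
      simp
    calc volume {y | y ∈ CL 1 k ∧ ∃ j, ratio (CL 1 k) j ξ (Zfn ξ y) ≤ ε}
        ≤ volume.restrict (CL 1 k) (Zfn ξ ⁻¹' A) := by
          rw [Measure.restrict_apply' (measurableSet_CL 1 k)]
          exact measure_mono fun y hy => ⟨hy.2, hy.1⟩
      _ ≤ nu (CL 1 k) ξ A := Measure.le_map_apply (measurable_Zfn_left ξ).aemeasurable A
      _ ≤ N * (ε * 1) := h1.trans (by gcongr)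
      _ = N * ε := by rw [mul_one]
  refine ⟨2 * N, fun ε => ?_⟩
  have hm : MeasurableSet {p | ∃ j, qr j p ≤ ε} := by
    rw [Set.ofPred_exists]
    exact MeasurableSet.iUnion fun j => measurableSet_le (measurable_qr j) measurable_const
  have hsec : ∀ ξ ∈ II, lam (Prod.mk ξ ⁻¹' {p | ∃ j, qr j p ≤ ε}) ≤ 2 * N * ε := by
    intro ξ hξ
    unfold lam
    rw [Measure.restrict_apply' measurableSet_Ico]
    calc _ ≤ volume ({y | y ∈ CL 1 0 ∧ ∃ j, ratio (CL 1 0) j ξ (Zfn ξ y) ≤ ε} ∪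
          {y | y ∈ CL 1 1 ∧ ∃ j, ratio (CL 1 1) j ξ (Zfn ξ y) ≤ ε}) := by
          refine measure_mono fun y hy => ?_
          obtain ⟨⟨j, hj⟩, hyI⟩ := hy
          rw [qr_eq_ratio ⟨hξ, hyI⟩] at hj
          simp only [cyl] at hj
          rcases floor_bit hyI with h | h
          · left
            have h' : ⌊(2:ℝ) ^ 1 * y⌋ = 0 := by rw [pow_one]; exact h
            rw [h'] at hj
            exact ⟨⟨hyI, h'⟩, _, hj⟩
          · right
            have h' : ⌊(2:ℝ) ^ 1 * y⌋ = 1 := by rw [pow_one]; exact h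
            rw [h'] at hj
            exact ⟨⟨hyI, h'⟩, _, hj⟩
      _ ≤ N * ε + N * ε := (measure_union_le _ _).trans (add_le_add (hC ξ 0 ε) (hC ξ 1 ε))
      _ = 2 * N * ε := by ring
  unfold PP
  rw [Measure.prod_apply hm]
  calc _ ≤ ∫⁻ ξ, 2 * N * ε ∂lam := lintegral_mono_ae (ae_lam_mem.mono hsec)
    _ = _ := by simp

/-- Minus the logarithm of the mass of a ball around the image point. -/
def uu (j : ℕ) (p : ℝ × ℝ) : ℝ := -Real.log (FF j p).toReal

/-- The information of the cylinder of level one at finite resolution. -/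
def ell (j : ℕ) (p : ℝ × ℝ) : ℝ := -Real.log (qr j p).toReal

lemma measurable_uu (j : ℕ) : Measurable (uu j) := (measurable_FF j).ennreal_toReal.log.neg

lemma measurable_ell (j : ℕ) : Measurable (ell j) := (measurable_qr j).ennreal_toReal.log.neg

lemma FF_toReal_pos {p : ℝ × ℝ} (hp : p ∈ usq) (j : ℕ) : 0 < (FF j p).toReal :=
  ENNReal.toReal_pos (FF_ne_zero hp j) (FF_ne_top j p)

lemma uu_nonneg (j : ℕ) (p : ℝ × ℝ) : 0 ≤ uu j p := by
  unfold uu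
  have := Real.log_nonpos ENNReal.toReal_nonneg
    (ENNReal.toReal_mono ENNReal.one_ne_top (FF_le_one j p))
  linarith

lemma uu_le {p : ℝ × ℝ} (hp : p ∈ usq) (j : ℕ) : uu j p ≤ (j + 14) * Real.log 2 := by
  have h := ENNReal.toReal_mono (FF_ne_top j p) (le_FF hp j)
  rw [ENNReal.toReal_pow, ENNReal.toReal_inv] at h
  have h2 := Real.log_le_log (by norm_num) h
  rw [Real.log_pow, Real.log_inv] at h2
  unfold uu
  push_cast at h2
  norm_num at h2
  linarith

lemma qr_le_one {p : ℝ × ℝ} (hp : p ∈ usq) (j : ℕ) : qr j p ≤ 1 := by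
  rw [qr_eq_ratio hp]; exact ratio_le_one (CL_subset _ _) _ _ _

lemma qr_ne_zero {p : ℝ × ℝ} (hp : p ∈ usq) (j : ℕ) : qr j p ≠ 0 :=
  (ENNReal.div_pos (mul_ne_zero (by simp) (FF_ne_zero (bb_mem hp) j)) (FF_ne_top _ p)).ne'

lemma qr_toReal_pos {p : ℝ × ℝ} (hp : p ∈ usq) (j : ℕ) : 0 < (qr j p).toReal :=
  ENNReal.toReal_pos (qr_ne_zero hp j) ((qr_le_one hp j).trans_lt (by simp)).ne

lemma ell_nonneg {p : ℝ × ℝ} (hp : p ∈ usq) (j : ℕ) : 0 ≤ ell j p := by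
  unfold ell
  have := Real.log_nonpos ENNReal.toReal_nonneg
    (ENNReal.toReal_mono ENNReal.one_ne_top (qr_le_one hp j))
  linarith

lemma uu_succ {p : ℝ × ℝ} (hp : p ∈ usq) (j : ℕ) :
    uu (j + 1) p = Real.log 2 + uu j (bb p) - ell j p := by
  unfold uu ell qr
  have h1 := FF_toReal_pos (bb_mem hp) j
  have h2 := FF_toReal_pos hp (j + 1)
  rw [ENNReal.toReal_div, ENNReal.toReal_mul, Real.log_div (mul_ne_zero (by simp) h1.ne') h2.ne',
    Real.log_mul (by simp) h1.ne', ENNReal.toReal_inv, Real.log_inv,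
    ENNReal.toReal_ofNat]
  ring

/-- The limiting information of the cylinder of level one. -/
def ellInf (p : ℝ × ℝ) : ℝ := -Real.log (pc 1 p).toReal

lemma measurable_ellInf : Measurable ellInf := (measurable_pc 1).ennreal_toReal.log.neg

lemma ellInf_nonneg (p : ℝ × ℝ) : 0 ≤ ellInf p := by
  unfold ellInf
  have := Real.log_nonpos ENNReal.toReal_nonneg
    (ENNReal.toReal_mono ENNReal.one_ne_top (pc_le_one 1 p))
  linarith

lemma ae_tendsto_ell : ∀ᵐ p ∂PP, Tendsto (fun j => ell j p) atTop (nhds (ellInf p)) := by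
  filter_upwards [ae_tendsto_pc 1, ae_pc_ne_zero 1] with p h h0
  have ht : pc 1 p ≠ ⊤ := ((pc_le_one 1 p).trans_lt (by simp)).ne
  have h1 : Tendsto (fun j => (qr j p).toReal) atTop (nhds (pc 1 p).toReal) := by
    refine (ENNReal.tendsto_toReal ht).comp (h.congr fun j => ?_)
    simp [qr]
  exact (h1.log (ENNReal.toReal_pos h0 ht).ne').neg

/-- The maximal information of the cylinder of level one. -/
def QQ (p : ℝ × ℝ) : ENNReal := ⨆ j, ENNReal.ofReal (ell j p)

lemma measurable_QQ : Measurable QQ := Measurable.iSup fun j => (measurable_ell j).ennreal_ofReal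

lemma ofReal_le_tsum (t : ℝ) : ENNReal.ofReal t ≤ ∑' n : ℕ, if (n : ℝ) < t then 1 else 0 := by
  calc ENNReal.ofReal t ≤ ENNReal.ofReal (⌈t⌉₊ : ℝ) := ENNReal.ofReal_le_ofReal (Nat.le_ceil t)
    _ = ∑ n ∈ Finset.range ⌈t⌉₊, 1 := by simp
    _ = ∑ n ∈ Finset.range ⌈t⌉₊, (if (n : ℝ) < t then 1 else 0) := by
        refine Finset.sum_congr rfl fun n hn => ?_
        rw [if_pos (Nat.lt_ceil.1 (Finset.mem_range.1 hn))]
    _ ≤ _ := ENNReal.sum_le_tsum _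

lemma lintegral_QQ_lt_top : ∫⁻ p, QQ p ∂PP < ⊤ := by
  obtain ⟨N, hN⟩ := exists_qr_bound
  set B : ℕ → Set (ℝ × ℝ) := fun n => {p | ∃ j, qr j p ≤ 2⁻¹ ^ n} with hB
  have mB : ∀ n, MeasurableSet (B n) := fun n => by
    simp only [hB]
    rw [Set.ofPred_exists]
    exact MeasurableSet.iUnion fun j => measurableSet_le (measurable_qr j) measurable_const
  have hle : ∀ p ∈ usq, QQ p ≤ ∑' n, (B n).indicator 1 p := by
    intro p hp
    refine iSup_le fun j => (ofReal_le_tsum _).trans (ENNReal.tsum_le_tsum fun n => ?_)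
    split_ifs with h
    · have hmem : p ∈ B n := by
        refine ⟨j, ?_⟩
        have hq := qr_toReal_pos hp j
        have hqt : qr j p ≠ ⊤ := ((qr_le_one hp j).trans_lt (by simp)).ne
        rw [← ENNReal.toReal_le_toReal hqt (by finiteness), ENNReal.toReal_pow, ENNReal.toReal_inv,
          ENNReal.toReal_ofNat]
        rw [← Real.log_le_log_iff hq (by positivity), Real.log_pow, Real.log_inv]
        unfold ell at h
        have l2 := Real.log_two_lt_d9
        have : (0:ℝ) ≤ n := by positivity
        norm_num
        nlinarith
      simp [hmem]
    · exact bot_le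
  calc ∫⁻ p, QQ p ∂PP ≤ ∫⁻ p, ∑' n, (B n).indicator 1 p ∂PP :=
        lintegral_mono_ae (ae_PP_mem.mono hle)
    _ = ∑' n, PP (B n) := by
        rw [lintegral_tsum fun n => (measurable_one.indicator (mB n)).aemeasurable]
        simp_rw [lintegral_indicator_one (mB _)]
    _ ≤ ∑' n : ℕ, (N : ENNReal) * (2⁻¹ : ENNReal) ^ n := ENNReal.tsum_le_tsum fun n => hN _
    _ = N * 2 := by
        rw [ENNReal.tsum_mul_left, ENNReal.tsum_geometric, ENNReal.one_sub_inv_two, inv_inv]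
    _ < ⊤ := by finiteness

lemma ae_QQ_lt_top : ∀ᵐ p ∂PP, QQ p < ⊤ := ae_lt_top measurable_QQ lintegral_QQ_lt_top.ne

lemma integrable_QQ : Integrable (fun p => (QQ p).toReal) PP :=
  integrable_toReal_of_lintegral_ne_top measurable_QQ.aemeasurable lintegral_QQ_lt_top.ne

lemma ae_ell_le : ∀ᵐ p ∂PP, ∀ j, ell j p ≤ (QQ p).toReal := by
  filter_upwards [ae_QQ_lt_top] with p h j
  rw [← ENNReal.ofReal_le_iff_le_toReal h.ne]
  exact le_iSup (fun j => ENNReal.ofReal (ell j p)) j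

lemma ae_norm_ell_le (j : ℕ) : ∀ᵐ p ∂PP, ‖ell j p‖ ≤ (QQ p).toReal := by
  filter_upwards [ae_ell_le, ae_PP_mem] with p h hp
  rw [Real.norm_of_nonneg (ell_nonneg hp j)]; exact h j

lemma integrable_ell (j : ℕ) : Integrable (ell j) PP :=
  integrable_QQ.mono' (measurable_ell j).aestronglyMeasurable (ae_norm_ell_le j)

lemma integrable_uu (j : ℕ) : Integrable (uu j) PP := by
  refine (integrable_const ((j + 14) * Real.log 2)).mono' (measurable_uu j).aestronglyMeasurable ?_
  filter_upwards [ae_PP_mem] with p hp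
  rw [Real.norm_of_nonneg (uu_nonneg j p)]; exact uu_le hp j

lemma integrable_ellInf : Integrable ellInf PP := by
  refine integrable_QQ.mono' measurable_ellInf.aestronglyMeasurable ?_
  filter_upwards [ae_ell_le, ae_tendsto_ell] with p h ht
  rw [Real.norm_of_nonneg (ellInf_nonneg p)]
  exact le_of_tendsto ht (Eventually.of_forall h)

lemma tendsto_setIntegral_ell (s : Set (ℝ × ℝ)) :
    Tendsto (fun j => ∫ p in s, ell j p ∂PP) atTop (nhds (∫ p in s, ellInf p ∂PP)) :=
  tendsto_integral_of_dominated_convergence _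
    (fun j => (measurable_ell j).aestronglyMeasurable) integrable_QQ.integrableOn
    (fun j => ae_restrict_of_ae (ae_norm_ell_le j)) (ae_restrict_of_ae ae_tendsto_ell)

lemma setIntegral_UU_comp (n : ℕ) {f : ℝ × ℝ → ℝ} (hf : Measurable f) :
    ∫ p in UU, f (bb^[n] p) ∂PP = ∫ p in UU, f p ∂PP := by
  have hm := measurePreserving_bb_iterate n
  have e : (bb^[n] ⁻¹' UU : Set (ℝ × ℝ)) =ᵐ[PP] UU :=
    (ae_UU_iterate n).mono fun p h => propext h
  rw [← setIntegral_congr_set e]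
  rw [← setIntegral_map measurableSet_UU, hm.map_eq]
  · rw [hm.map_eq]; exact hf.aestronglyMeasurable
  · exact hm.measurable.aemeasurable

/-- The limiting increment of the integral of `uu` over `UU`. -/
def cInf : ℝ := Real.log 2 * PP.real UU - ∫ p in UU, ellInf p ∂PP

lemma setIntegral_uu_succ (j : ℕ) :
    ∫ p in UU, uu (j + 1) p ∂PP - ∫ p in UU, uu j p ∂PP
      = Real.log 2 * PP.real UU - ∫ p in UU, ell j p ∂PP := by
  have e : ∫ p in UU, uu (j + 1) p ∂PP
      = ∫ p in UU, (Real.log 2 + uu j (bb^[1] p) - ell j p) ∂PP := by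
    refine integral_congr_ae (ae_restrict_of_ae ?_)
    filter_upwards [ae_PP_mem] with p hp
    exact uu_succ hp j
  have hi : Integrable (fun p => uu j (bb^[1] p)) PP :=
    (measurePreserving_bb_iterate 1).integrable_comp_of_integrable (integrable_uu j)
  have hi2 : Integrable (fun p => Real.log 2 + uu j (bb^[1] p)) PP := (integrable_const _).add hi
  rw [e, integral_sub hi2.integrableOn (integrable_ell j).integrableOn,
    integral_add (integrable_const _) hi.integrableOn, setIntegral_UU_comp 1 (measurable_uu j),
    setIntegral_const, smul_eq_mul]
  ring

lemma tendsto_setIntegral_uu_sub (k : ℕ) :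
    Tendsto (fun j => ∫ p in UU, uu (j + k) p ∂PP - ∫ p in UU, uu j p ∂PP) atTop
      (nhds (k * cInf)) := by
  induction k with
  | zero => simp
  | succ k ih =>
    have h : Tendsto (fun j => Real.log 2 * PP.real UU - ∫ p in UU, ell (j + k) p ∂PP) atTop
        (nhds cInf) :=
      tendsto_const_nhds.sub ((tendsto_setIntegral_ell UU).comp (tendsto_add_atTop_nat k))
    have := h.add ih
    refine (this.congr fun j => ?_).trans (le_of_eq ?_)
    · rw [← setIntegral_uu_succ]; ring_nf
    · congr 1; push_cast; ring

lemma rr_le_one {p : ℝ × ℝ} (j k : ℕ) : rr j k p ≤ 1 :=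
  ENNReal.div_le_of_le_mul (by rw [one_mul]; exact FF_antitone p (Nat.sub_le j k))

lemma uu_sub_uu {p : ℝ × ℝ} (hp : p ∈ usq) (j k : ℕ) :
    uu j p - uu (j - k) p = -Real.log (rr j k p).toReal := by
  unfold uu rr
  rw [ENNReal.toReal_div, Real.log_div (FF_toReal_pos hp _).ne' (FF_toReal_pos hp _).ne']
  ring

lemma rr_toReal_pos {p : ℝ × ℝ} (hp : p ∈ usq) (j k : ℕ) : 0 < (rr j k p).toReal := by
  unfold rr
  rw [ENNReal.toReal_div]
  exact div_pos (FF_toReal_pos hp _) (FF_toReal_pos hp _)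

lemma le_setIntegral_uu_sub {V : Set (ℝ × ℝ)} (hVU : V ⊆ UU) {c B : ℝ}
    (hc : 0 < c) (hB : 0 ≤ B) (j k L : ℕ)
    (h : ∫⁻ p in V, rr j k (bb^[L] p) ∂PP ≤ ENNReal.ofReal B) :
    Real.log c * PP.real V - c * B ≤ ∫ p in UU, uu j p ∂PP - ∫ p in UU, uu (j - k) p ∂PP := by
  have hmp := measurePreserving_bb_iterate L
  have hmr : Measurable (fun p => rr j k (bb^[L] p)) := (measurable_rr j k).comp hmp.measurable
  have hir : Integrable (fun p => (rr j k (bb^[L] p)).toReal) PP := by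
    refine (integrable_const (1:ℝ)).mono' hmr.ennreal_toReal.aestronglyMeasurable
      (Eventually.of_forall fun p => ?_)
    rw [Real.norm_of_nonneg ENNReal.toReal_nonneg]
    exact ENNReal.toReal_mono ENNReal.one_ne_top (rr_le_one j k)
  have hiD : Integrable (fun p => uu j p - uu (j - k) p) PP :=
    (integrable_uu j).sub (integrable_uu (j - k))
  have hiD' : Integrable (fun p => uu j (bb^[L] p) - uu (j - k) (bb^[L] p)) PP :=
    hmp.integrable_comp_of_integrable hiD
  have hD0 : ∀ᵐ p ∂PP, 0 ≤ uu j (bb^[L] p) - uu (j - k) (bb^[L] p) := by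
    filter_upwards [ae_PP_mem] with p hp
    rw [uu_sub_uu (bb_iterate_mem hp L)]
    have := Real.log_nonpos ENNReal.toReal_nonneg
      (ENNReal.toReal_mono ENNReal.one_ne_top (rr_le_one (p := bb^[L] p) j k))
    linarith
  have hr : ∫ p in V, (rr j k (bb^[L] p)).toReal ∂PP ≤ B := by
    rw [integral_toReal hmr.aemeasurable
      (Eventually.of_forall fun p => (rr_le_one j k).trans_lt (by simp))]
    exact ENNReal.toReal_le_of_le_ofReal hB h
  have hlow : ∀ᵐ p ∂PP, Real.log c - c * (rr j k (bb^[L] p)).toReal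
      ≤ uu j (bb^[L] p) - uu (j - k) (bb^[L] p) := by
    filter_upwards [ae_PP_mem] with p hp
    rw [uu_sub_uu (bb_iterate_mem hp L)]
    have hpos := rr_toReal_pos (bb_iterate_mem hp L) j k
    have := Real.log_le_sub_one_of_pos (mul_pos hc hpos)
    rw [Real.log_mul hc.ne' hpos.ne'] at this
    linarith
  calc Real.log c * PP.real V - c * B
      ≤ Real.log c * PP.real V - c * ∫ p in V, (rr j k (bb^[L] p)).toReal ∂PP := by gcongr
    _ = ∫ p in V, (Real.log c - c * (rr j k (bb^[L] p)).toReal) ∂PP := by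
        rw [integral_sub (integrable_const _) (hir.integrableOn.const_mul c), setIntegral_const,
          integral_const_mul, smul_eq_mul]
        ring
    _ ≤ ∫ p in V, (uu j (bb^[L] p) - uu (j - k) (bb^[L] p)) ∂PP :=
        integral_mono_ae ((integrable_const _).sub (hir.integrableOn.const_mul c))
          hiD'.integrableOn (ae_restrict_of_ae hlow)
    _ ≤ ∫ p in UU, (uu j (bb^[L] p) - uu (j - k) (bb^[L] p)) ∂PP :=
        setIntegral_mono_set hiD'.integrableOn (ae_restrict_of_ae hD0) hVU.eventuallyLE
    _ = ∫ p in UU, (uu j p - uu (j - k) p) ∂PP :=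
        setIntegral_UU_comp L (f := fun p => uu j p - uu (j - k) p)
          ((measurable_uu j).sub (measurable_uu (j - k)))
    _ = _ := integral_sub (integrable_uu j).integrableOn (integrable_uu (j - k)).integrableOn

lemma le_cInf_aux {ε : ℝ} (hε : 0 < ε) :
    ∃ (C : ℝ) (κ₀ : ℕ), ∀ κ ≥ κ₀,
      2 * κ * (Real.log 2 * (PP.real UU - 2 * ε)) - C ≤ 2 * κ * cInf := by
  have hε' : 0 < ENNReal.ofReal ε := by simpa using hε
  obtain ⟨L₂, hL₂⟩ := exists_Gam_large hε'
  obtain ⟨M, hM⟩ := exists_PP_compl_GG_le hε'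
  obtain ⟨s, h3⟩ : ∃ s : ℕ, (4:ℝ) * 2 ^ L₂ < 3 * 2 ^ s * ww ^ (M + 11) := by
    have hpos : 0 < 3 * ww ^ (M + 11) := mul_pos (by norm_num) (pow_pos ww_pos _)
    obtain ⟨s, hs⟩ := pow_unbounded_of_one_lt ((4:ℝ) * 2 ^ L₂ / (3 * ww ^ (M + 11)))
      (by norm_num : (1:ℝ) < 2)
    refine ⟨s, ?_⟩
    rw [div_lt_iff₀ hpos] at hs
    linarith
  have hlm : 0 ≤ Real.log ((M:ℝ) + 1) := Real.log_nonneg (by simp)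
  have hl2 : 0 < Real.log 2 := Real.log_pos (by norm_num)
  refine ⟨(2 * (s + 8) * Real.log 2 + Real.log (M + 1)) * (PP.real UU - 2 * ε) + 4,
    s + 8 + M + 3, fun κ hκ => ?_⟩
  obtain ⟨K, hK⟩ : ∃ K : ℕ, K = 2 ^ (κ - (s + 8)) := ⟨_, rfl⟩
  have hK1 : 1 ≤ K := hK ▸ Nat.one_le_two_pow
  have h2 : (3:ℝ) + 128 * K * 2 ^ s ≤ 2 ^ κ := by
    have e : (2:ℝ) ^ κ = 2 * (128 * K * 2 ^ s) := by
      rw [hK]; push_cast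
      have : κ = (κ - (s + 8)) + (s + 8) := by omega
      conv_lhs => rw [this, pow_add, pow_add]
      ring
    have h8 : (2:ℝ) ^ 3 ≤ 2 ^ κ := pow_le_pow_right₀ (by norm_num) (by omega)
    linarith
  obtain ⟨L₁, h1⟩ := pow_unbounded_of_one_lt ((256:ℝ) * K * 2 ^ s) (by norm_num : (1:ℝ) < 2)
  set L := max L₁ L₂ with hL
  have h1 : (256:ℝ) * K * 2 ^ s ≤ 2 ^ L :=
    h1.le.trans (pow_le_pow_right₀ (by norm_num) (le_max_left _ _))
  have hev := lintegral_Gam_le hK1 h1 h2 h3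
  have ht := (tendsto_setIntegral_uu_sub (2 * κ))
  push_cast at ht
  refine ge_of_tendsto ht ?_
  filter_upwards [(tendsto_add_atTop_nat (2 * κ)).eventually hev] with j hj
  set G := GG (j + 2 * κ + L - 2 * s) M with hG
  set V := UU ∩ G ∩ {p | 1 / 2 ≤ Gam L L₂ p} with hV
  have mG : MeasurableSet {p | 1 / 2 ≤ Gam L L₂ p} :=
    measurableSet_le measurable_const (measurable_Gam L L₂)
  have mV : MeasurableSet V := (measurableSet_UU.inter (measurableSet_GG _ _)).inter mG
  have hVG : V ⊆ G := fun p hp => hp.1.2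
  have hVU : V ⊆ UU := fun p hp => hp.1.1
  set c : ℝ := (K:ℝ) ^ 2 / (M + 1) with hc
  set B : ℝ := 4 * (M + 1) / (K:ℝ) ^ 2 with hB
  have hKr : (0:ℝ) < K := by exact_mod_cast hK1
  have hcB : c * B = 4 := by rw [hc, hB]; field_simp
  have hintegral : ∫⁻ p in V, rr (j + 2 * κ) (2 * κ) (bb^[L] p) ∂PP ≤ ENNReal.ofReal B := by
    have e1 : ∫⁻ p in V, rr (j + 2 * κ) (2 * κ) (bb^[L] p) ∂PP
        ≤ 2 * ∫⁻ p in G, Gam L L₂ p * rr (j + 2 * κ) (2 * κ) (bb^[L] p) ∂PP := by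
      rw [← lintegral_const_mul' _ _ (by simp)]
      refine le_trans (setLIntegral_mono' mV fun p hp => ?_) (lintegral_mono_set hVG)
      rw [← mul_assoc]
      refine le_mul_of_one_le_left bot_le ?_
      calc (1:ENNReal) = 2 * (1 / 2) := by
            rw [one_div, ENNReal.mul_inv_cancel (by simp) (by simp)]
        _ ≤ _ := by gcongr; exact hp.2
    have e2 : ENNReal.ofReal B = 2 * ((2 * (M + 1)) / (K:ENNReal) ^ 2) := by
      rw [hB, ENNReal.ofReal_div_of_pos (by positivity), ENNReal.ofReal_pow (by positivity),
        ENNReal.ofReal_mul (by norm_num), ENNReal.ofReal_add (by positivity) (by norm_num),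
        ENNReal.ofReal_natCast, ENNReal.ofReal_natCast, ← mul_div_assoc, ← mul_assoc]
      norm_num
    rw [e2]
    refine e1.trans ?_
    gcongr
    rw [ENNReal.le_div_iff_mul_le (Or.inl (by simp; omega)) (Or.inl (by finiteness)),
      mul_comm]
    exact hj
  have hmain := le_setIntegral_uu_sub hVU (c := c) (B := B) (by positivity) (by positivity)
    (j + 2 * κ) (2 * κ) L hintegral
  have hPV : PP.real UU - 2 * ε ≤ PP.real V := by
    have hsub : UU ⊆ V ∪ (Gᶜ ∪ (UU ∩ {p | Gam L L₂ p < 1 / 2})) := by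
      intro p hp
      by_cases hg : p ∈ G
      · by_cases h : 1 / 2 ≤ Gam L L₂ p
        · exact Or.inl ⟨⟨hp, hg⟩, h⟩
        · exact Or.inr (Or.inr ⟨hp, not_le.1 h⟩)
      · exact Or.inr (Or.inl hg)
    have h5 := (measureReal_mono (μ := PP) hsub).trans ((measureReal_union_le _ _).trans
      (add_le_add_right (measureReal_union_le _ _) _))
    have h6 : PP.real Gᶜ ≤ ε := ENNReal.toReal_le_of_le_ofReal hε.le (hM _)
    have h7 : PP.real (UU ∩ {p | Gam L L₂ p < 1 / 2}) ≤ ε :=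
      ENNReal.toReal_le_of_le_ofReal hε.le (hL₂ L (le_max_right _ _))
    linarith
  have hlogc : Real.log c = 2 * (κ - (s + 8)) * Real.log 2 - Real.log (M + 1) := by
    rw [hc, Real.log_div (by positivity) (by positivity), hK]
    push_cast
    rw [← pow_mul, Real.log_pow]
    push_cast [Nat.cast_sub (show s + 8 ≤ κ by omega)]
    ring
  have hlogc0 : 0 ≤ Real.log c := by
    refine Real.log_nonneg ?_
    rw [hc, one_le_div (by positivity)]
    have hMK : M + 1 ≤ K := by
      rw [hK]
      calc M + 1 ≤ 2 ^ M := Nat.lt_two_pow_self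
        _ ≤ _ := Nat.pow_le_pow_right (by norm_num) (by omega)
    have hMK' : (M:ℝ) + 1 ≤ K := by exact_mod_cast hMK
    have hK1' : (1:ℝ) ≤ K := by exact_mod_cast hK1
    nlinarith
  rw [hcB] at hmain
  rw [Nat.add_sub_cancel] at hmain
  have h9 := mul_le_mul_of_nonneg_left hPV hlogc0
  refine le_trans ?_ hmain
  refine le_trans (le_of_eq ?_) (sub_le_sub_right h9 4)
  rw [hlogc]
  ring

lemma setIntegral_ellInf_nonpos : ∫ p in UU, ellInf p ∂PP ≤ 0 := by
  by_contra hcon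
  rw [not_le] at hcon
  have hl2 : 0 < Real.log 2 := Real.log_pos (by norm_num)
  set I := ∫ p in UU, ellInf p ∂PP with hI
  set ε := I / (4 * Real.log 2) with hε
  have hε0 : 0 < ε := by positivity
  obtain ⟨C, κ₀, h⟩ := le_cInf_aux hε0
  have h2 : Real.log 2 * ε ≤ I / 4 := by
    rw [hε]
    refine le_of_eq ?_
    field_simp
  obtain ⟨n, hn⟩ := exists_nat_gt (C / I)
  rw [div_lt_iff₀ hcon] at hn
  have := h (n + κ₀) (by omega)
  unfold cInf at this
  push_cast at this
  have hk : (0:ℝ) ≤ n + κ₀ := by positivity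
  have hk0 : (0:ℝ) ≤ κ₀ * I := by positivity
  nlinarith [mul_le_mul_of_nonneg_left h2 hk]

lemma ae_ellInf_eq_zero : ∀ᵐ p ∂PP, ellInf p = 0 := by
  have h0 : ∫ p in UU, ellInf p ∂PP = 0 :=
    le_antisymm setIntegral_ellInf_nonpos (integral_nonneg ellInf_nonneg)
  rw [integral_eq_zero_iff_of_nonneg ellInf_nonneg integrable_ellInf.integrableOn] at h0
  have h1 := (ae_restrict_iff' measurableSet_UU).1 h0
  filter_upwards [h1, ae_pc_one_of_mm] with p hp hp2
  by_cases h : p ∈ UU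
  · exact hp h
  · simp [ellInf, hp2 h]

lemma ae_tendsto_ell_zero : ∀ᵐ p ∂PP, Tendsto (fun j => ell j p) atTop (nhds 0) := by
  filter_upwards [ae_tendsto_ell, ae_ellInf_eq_zero] with p h h0
  rwa [h0] at h

/-- The running maximum of the Birkhoff sums of `f`. -/
def birkhoffMax {α : Type*} (T : α → α) (f : α → ℝ) : ℕ → α → ℝ
  | 0 => fun _ => 0
  | n + 1 => fun a => max 0 (f a + birkhoffMax T f n (T a))

section maximal
variable {α : Type*} {T : α → α} {f : α → ℝ}

lemma birkhoffMax_nonneg (n : ℕ) (a : α) : 0 ≤ birkhoffMax T f n a := by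
  cases n with
  | zero => exact le_rfl
  | succ n => exact le_max_left _ _

lemma birkhoffMax_le_succ (n : ℕ) (a : α) : birkhoffMax T f n a ≤ birkhoffMax T f (n + 1) a := by
  induction n generalizing a with
  | zero => exact le_max_left _ _
  | succ n ih => exact max_le_max le_rfl (add_le_add_right (ih (T a)) _)

lemma sum_le_birkhoffMax (n : ℕ) (a : α) :
    ∑ i ∈ Finset.range n, f (T^[i] a) ≤ birkhoffMax T f n a := by
  induction n generalizing a with
  | zero => simp [birkhoffMax]
  | succ n ih =>
    rw [Finset.sum_range_succ']
    refine le_trans ?_ (le_max_right _ _)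
    have := ih (T a)
    simp only [Function.iterate_succ, Function.comp_apply, Function.iterate_zero, id]
    linarith

variable [MeasurableSpace α] {μ : Measure α}

lemma measurable_birkhoffMax (hT : Measurable T) (hf : Measurable f) (n : ℕ) :
    Measurable (birkhoffMax T f n) := by
  induction n with
  | zero => exact measurable_const
  | succ n ih => exact measurable_const.max (hf.add (ih.comp hT))

lemma integrable_birkhoffMax (hT : MeasurePreserving T μ μ) (hf : Integrable f μ) (n : ℕ) :
    Integrable (birkhoffMax T f n) μ := by
  induction n with
  | zero => exact integrable_zero _ _ _
  | succ n ih =>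
    exact (integrable_zero _ _ _).sup (hf.add (hT.integrable_comp_of_integrable ih))

/-- The maximal ergodic theorem. -/
lemma setIntegral_birkhoffMax_pos (hT : MeasurePreserving T μ μ) (mf : Measurable f)
    (hf : Integrable f μ) (n : ℕ) : 0 ≤ ∫ a in {a | 0 < birkhoffMax T f n a}, f a ∂μ := by
  cases n with
  | zero => simp [birkhoffMax]
  | succ n =>
    have i1 := integrable_birkhoffMax hT hf (n + 1)
    have i2 := integrable_birkhoffMax hT hf n
    have i3 : Integrable (fun a => birkhoffMax T f n (T a)) μ := hT.integrable_comp_of_integrable i2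
    have i4 : Integrable (fun a => birkhoffMax T f (n + 1) a - birkhoffMax T f n (T a)) μ :=
      i1.sub i3
    set A := {a | 0 < birkhoffMax T f (n + 1) a} with hA
    have mA : MeasurableSet A :=
      measurableSet_lt measurable_const (measurable_birkhoffMax hT.measurable mf _)
    have e0 : ∫ a, birkhoffMax T f n (T a) ∂μ = ∫ a, birkhoffMax T f n a ∂μ := by
      conv_rhs => rw [← hT.map_eq]
      rw [integral_map hT.measurable.aemeasurable
        (measurable_birkhoffMax hT.measurable mf n).aestronglyMeasurable]
    calc 0 ≤ ∫ a, birkhoffMax T f (n + 1) a ∂μ - ∫ a, birkhoffMax T f n (T a) ∂μ := by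
          rw [e0, sub_nonneg]
          exact integral_mono i2 i1 (birkhoffMax_le_succ n)
      _ = ∫ a, (birkhoffMax T f (n + 1) a - birkhoffMax T f n (T a)) ∂μ :=
          (integral_sub i1 i3).symm
      _ ≤ ∫ a in A, f a ∂μ := by
          rw [← integral_indicator mA]
          refine integral_mono i4 (hf.indicator mA) fun a => ?_
          by_cases h : a ∈ A
          · simp only [indicator_of_mem h]
            have h' : 0 < max 0 (f a + birkhoffMax T f n (T a)) := h
            have h2 := (lt_max_iff.1 h').resolve_left (lt_irrefl _)
            have : birkhoffMax T f (n + 1) a = f a + birkhoffMax T f n (T a) := max_eq_right h2.le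
            linarith
          · simp only [indicator_of_notMem h]
            have h' : birkhoffMax T f (n + 1) a ≤ 0 := not_lt.1 h
            have := birkhoffMax_nonneg (T := T) (f := f) n (T a)
            linarith

lemma measure_sum_gt_le [IsProbabilityMeasure μ] (hT : MeasurePreserving T μ μ) {h : α → ℝ}
    (mh : Measurable h) (hi : Integrable h μ) (h0 : ∀ a, 0 ≤ h a) {δ : ℝ} (hδ : 0 < δ) :
    μ {a | ∃ n : ℕ, n * δ < ∑ i ∈ Finset.range n, h (T^[i] a)}
      ≤ ENNReal.ofReal ((∫ a, h a ∂μ) / δ) := by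
  set f : α → ℝ := fun a => h a - δ with hf
  have mf : Measurable f := mh.sub_const δ
  have hif : Integrable f μ := hi.sub (integrable_const δ)
  set A : ℕ → Set α := fun n => {a | 0 < birkhoffMax T f n a} with hA
  have mA : ∀ n, MeasurableSet (A n) := fun n =>
    measurableSet_lt measurable_const (measurable_birkhoffMax hT.measurable mf n)
  have hmono : Monotone A := monotone_nat_of_le_succ fun n a ha =>
    lt_of_lt_of_le ha (birkhoffMax_le_succ n a)
  have hsub : {a | ∃ n : ℕ, n * δ < ∑ i ∈ Finset.range n, h (T^[i] a)} ⊆ ⋃ n, A n := by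
    rintro a ⟨n, hn⟩
    refine mem_iUnion.2 ⟨n, lt_of_lt_of_le ?_ (sum_le_birkhoffMax n a)⟩
    simp only [hf, Finset.sum_sub_distrib, Finset.sum_const, Finset.card_range, nsmul_eq_mul]
    linarith
  refine (measure_mono hsub).trans ?_
  rw [hmono.measure_iUnion]
  refine iSup_le fun n => ?_
  rw [ENNReal.le_ofReal_iff_toReal_le (measure_ne_top _ _)
    (div_nonneg (integral_nonneg h0) hδ.le), le_div_iff₀ hδ]
  have h1 := setIntegral_birkhoffMax_pos hT mf hif n
  rw [integral_sub hi.integrableOn (integrable_const _), setIntegral_const, smul_eq_mul] at h1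
  have h2 : ∫ a in A n, h a ∂μ ≤ ∫ a, h a ∂μ :=
    setIntegral_le_integral hi (Eventually.of_forall h0)
  have h3 : μ.real (A n) = (μ (A n)).toReal := rfl
  rw [← h3]
  linarith

end maximal

/-- The supremum of the information at resolutions beyond `J`. -/
def hh (J : ℕ) (p : ℝ × ℝ) : ℝ := (⨆ j, ENNReal.ofReal (ell (J + j) p)).toReal

lemma measurable_hh (J : ℕ) : Measurable (hh J) :=
  (Measurable.iSup fun j => (measurable_ell (J + j)).ennreal_ofReal).ennreal_toReal

lemma iSup_ell_le_QQ (J : ℕ) (p : ℝ × ℝ) : ⨆ j, ENNReal.ofReal (ell (J + j) p) ≤ QQ p :=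
  iSup_le fun j => le_iSup (fun j => ENNReal.ofReal (ell j p)) (J + j)

lemma hh_le {p : ℝ × ℝ} (h : QQ p < ⊤) (J : ℕ) : hh J p ≤ (QQ p).toReal :=
  ENNReal.toReal_mono h.ne (iSup_ell_le_QQ J p)

lemma ell_le_hh {p : ℝ × ℝ} (h : QQ p < ⊤) (J j : ℕ) : ell (J + j) p ≤ hh J p := by
  rw [hh, ← ENNReal.ofReal_le_iff_le_toReal ((iSup_ell_le_QQ J p).trans_lt h).ne]
  exact le_iSup (fun j => ENNReal.ofReal (ell (J + j) p)) j

lemma hh_nonneg (J : ℕ) (p : ℝ × ℝ) : 0 ≤ hh J p := ENNReal.toReal_nonneg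

lemma ae_norm_hh_le (J : ℕ) : ∀ᵐ p ∂PP, ‖hh J p‖ ≤ (QQ p).toReal := by
  filter_upwards [ae_QQ_lt_top] with p h
  rw [Real.norm_of_nonneg (hh_nonneg J p)]
  exact hh_le h J

lemma integrable_hh (J : ℕ) : Integrable (hh J) PP :=
  integrable_QQ.mono' (measurable_hh J).aestronglyMeasurable (ae_norm_hh_le J)

lemma ae_tendsto_hh : ∀ᵐ p ∂PP, Tendsto (fun J => hh J p) atTop (nhds 0) := by
  filter_upwards [ae_tendsto_ell_zero] with p h
  refine tendsto_order.2 ⟨fun a ha => Eventually.of_forall fun J => ha.trans_le (hh_nonneg J p),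
    fun a ha => ?_⟩
  obtain ⟨J₀, hJ₀⟩ := eventually_atTop.1 (h.eventually_le_const (half_pos ha))
  filter_upwards [eventually_ge_atTop J₀] with J hJ
  refine lt_of_le_of_lt ?_ (half_lt_self ha)
  refine ENNReal.toReal_le_of_le_ofReal (half_pos ha).le (iSup_le fun j => ?_)
  exact ENNReal.ofReal_le_ofReal (hJ₀ _ (by omega))

lemma tendsto_integral_hh : Tendsto (fun J => ∫ p, hh J p ∂PP) atTop (nhds 0) := by
  have := tendsto_integral_of_dominated_convergence _
    (fun J => (measurable_hh J).aestronglyMeasurable) integrable_QQ ae_norm_hh_le ae_tendsto_hh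
  simpa using this

lemma ae_exists_sum_hh_le {δ : ℝ} (hδ : 0 < δ) :
    ∀ᵐ p ∂PP, ∃ J, ∀ n : ℕ, ∑ i ∈ Finset.range n, hh J (bb^[i] p) ≤ n * δ := by
  rw [ae_iff]
  refine le_antisymm ?_ bot_le
  have ht : Tendsto (fun J => ENNReal.ofReal ((∫ p, hh J p ∂PP) / δ)) atTop (nhds 0) := by
    have := ENNReal.tendsto_ofReal (tendsto_integral_hh.div_const δ)
    simpa using this
  refine ge_of_tendsto' ht fun J => ?_
  refine le_trans (measure_mono fun p hp => ?_) (measure_sum_gt_le measurePreserving_bb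
    (measurable_hh J) (integrable_hh J) (hh_nonneg J) hδ)
  rw [mem_ofPred_eq] at hp
  push Not at hp
  exact hp J

lemma le_uu_add {p : ℝ × ℝ} (hp : p ∈ usq) (J n : ℕ) (h : ∀ i, QQ (bb^[i] p) < ⊤) :
    n * Real.log 2 - ∑ i ∈ Finset.range n, hh J (bb^[i] p) ≤ uu (J + n) p := by
  induction n generalizing p with
  | zero => simpa using uu_nonneg J p
  | succ n ih =>
    have h1 := ih (bb_mem hp) fun i => by
      simpa only [Function.iterate_succ, Function.comp_apply] using h (i + 1)
    rw [← add_assoc, uu_succ hp, Finset.sum_range_succ']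
    have h2 := ell_le_hh (h 0) J n
    simp only [Function.iterate_succ, Function.comp_apply, Function.iterate_zero, id] at h1 h2 ⊢
    push_cast
    linarith

lemma ae_uu_growth : ∀ᵐ p ∂PP, ∀ δ : ℝ, 0 < δ →
    ∃ J, ∀ n : ℕ, n * (Real.log 2 - δ) ≤ uu (J + n) p := by
  have hQ : ∀ᵐ p ∂PP, ∀ i, QQ (bb^[i] p) < ⊤ := ae_all_iff.2 fun i =>
    (measurePreserving_bb_iterate i).quasiMeasurePreserving.ae ae_QQ_lt_top
  have hs : ∀ᵐ p ∂PP, ∀ m : ℕ, ∃ J, ∀ n : ℕ,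
      ∑ i ∈ Finset.range n, hh J (bb^[i] p) ≤ n * (1 / ((m : ℝ) + 1)) :=
    ae_all_iff.2 fun m => ae_exists_sum_hh_le Nat.one_div_pos_of_nat
  filter_upwards [hQ, hs, ae_PP_mem] with p h1 h2 hp δ hδ
  obtain ⟨m, hm⟩ := exists_nat_one_div_lt hδ
  obtain ⟨J, hJ⟩ := h2 m
  refine ⟨J, fun n => ?_⟩
  have h3 := le_uu_add hp J n h1
  have h4 : (n : ℝ) * (1 / ((m : ℝ) + 1)) ≤ n * δ := by gcongr
  linarith [hJ n]

lemma volume_near_eq_mass (K : ℝ) (N : ℕ) {p : ℝ × ℝ} (hp : p ∈ usq) :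
    volume {y : ℝ | y ∈ Ico (0:ℝ) 1 ∧
      ‖Hfn (bakerInvN N p).1 y - Hfn (bakerInvN N p).1 (bakerInvN N p).2‖
        ≤ K * 2 ^ (-(N : ℝ) / 2)} =
    mass II (bb^[N] p).1 (Zfn (bb^[N] p).1 (bb^[N] p).2) (K * ww ^ N) := by
  simp only [mass, II, bakerInvN_eq N p hp, norm_Hfn_sub, ww_pow_eq_rpow]

lemma mass_le_two_pow_mul_FF {K : ℝ} {k N : ℕ} (hk : K * ww ^ k ≤ 1) (hN : k ≤ N) {p : ℝ × ℝ}
    (hp : p ∈ usq) :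
    mass II (bb^[N] p).1 (Zfn (bb^[N] p).1 (bb^[N] p).2) (K * ww ^ N)
      ≤ 2 ^ N * FF (2 * N - k) p := by
  have h1 : K * ww ^ N ≤ ww ^ (N - k) := by
    have e : ww ^ N = ww ^ k * ww ^ (N - k) := by rw [← pow_add]; congr 1; omega
    rw [e, ← mul_assoc]
    exact mul_le_of_le_one_left (pow_nonneg ww_pos.le _) hk
  have h2 : 2⁻¹ ^ N * FF (N - k) (bb^[N] p) ≤ FF (2 * N - k) p := by
    rw [← mass_cyl_eq hp N (N - k), show N - k + N = 2 * N - k by omega]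
    exact mass_mono_set (CL_subset _ _) _ _ _
  calc _ ≤ FF (N - k) (bb^[N] p) := mass_mono_radius _ _ _ h1
    _ = 2 ^ N * (2⁻¹ ^ N * FF (N - k) (bb^[N] p)) := by
        rw [← mul_assoc, ← mul_pow, ENNReal.mul_inv_cancel (by simp) (by simp), one_pow, one_mul]
    _ ≤ _ := by gcongr

lemma le_mass_near {K : ℝ} {l N : ℕ} (hl : ww ^ l ≤ K) {p : ℝ × ℝ} (hp : p ∈ usq) :
    2⁻¹ ^ (N + l + 14) ≤
      mass II (bb^[N] p).1 (Zfn (bb^[N] p).1 (bb^[N] p).2) (K * ww ^ N) := by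
  refine (le_FF (bb_iterate_mem hp N) (N + l)).trans (mass_mono_radius _ _ _ ?_)
  rw [pow_add, mul_comm]
  exact mul_le_mul_of_nonneg_right hl (pow_nonneg ww_pos.le _)

lemma one_le_liminf_of_growth {K : ℝ} (hK : 0 < K) {p : ℝ × ℝ} (hp : p ∈ usq)
    (h : ∀ δ : ℝ, 0 < δ → ∃ J, ∀ n : ℕ, n * (Real.log 2 - δ) ≤ uu (J + n) p) :
    1 ≤ Filter.liminf (fun N : ℕ =>
      Real.log (mass II (bb^[N] p).1 (Zfn (bb^[N] p).1 (bb^[N] p).2) (K * ww ^ N)).toReal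
        / Real.log ((2 : ℝ) ^ (-(N : ℝ)))) Filter.atTop := by
  have hl2 : 0 < Real.log 2 := Real.log_pos (by norm_num)
  obtain ⟨l, hl⟩ := exists_pow_lt_of_lt_one hK ww_lt_one
  obtain ⟨k, hk⟩ : ∃ k, K * ww ^ k ≤ 1 := by
    obtain ⟨k, hk⟩ := exists_pow_lt_of_lt_one (inv_pos.2 hK) ww_lt_one
    refine ⟨k, ?_⟩
    have := mul_le_mul_of_nonneg_left hk.le hK.le
    rwa [mul_inv_cancel₀ hK.ne'] at this
  set m : ℕ → ENNReal := fun N =>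
    mass II (bb^[N] p).1 (Zfn (bb^[N] p).1 (bb^[N] p).2) (K * ww ^ N) with hm
  have m1 : ∀ N, m N ≤ 1 := fun N => mass_le_one le_rfl _ _ _
  have mt : ∀ N, m N ≠ ⊤ := fun N => ((m1 N).trans_lt (by simp)).ne
  have mlow : ∀ N, -((N + l + 14 : ℕ) * Real.log 2) ≤ Real.log (m N).toReal := by
    intro N
    have h1 := ENNReal.toReal_mono (mt N) (le_mass_near (N := N) hl.le hp)
    rw [ENNReal.toReal_pow, ENNReal.toReal_inv, ENNReal.toReal_ofNat] at h1
    have h2 := Real.log_le_log (by positivity) h1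
    rw [Real.log_pow, Real.log_inv] at h2
    linarith
  have mpos : ∀ N, 0 < (m N).toReal := fun N => by
    refine ENNReal.toReal_pos ?_ (mt N)
    exact ((ENNReal.pow_pos (by simp) _).trans_le (le_mass_near hl.le hp)).ne'
  have mup : ∀ N, k ≤ N → Real.log (m N).toReal ≤ N * Real.log 2 - uu (2 * N - k) p := by
    intro N hN
    have h1 := ENNReal.toReal_mono (ENNReal.mul_ne_top (by finiteness) (FF_ne_top _ p))
      (mass_le_two_pow_mul_FF hk hN hp)
    have h2 := Real.log_le_log (mpos N) h1
    rw [ENNReal.toReal_mul, ENNReal.toReal_pow, ENNReal.toReal_ofNat,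
      Real.log_mul (by positivity) (FF_toReal_pos hp _).ne', Real.log_pow] at h2
    unfold uu
    linarith
  have hden : ∀ N : ℕ, Real.log ((2:ℝ) ^ (-(N:ℝ))) = -(N * Real.log 2) := fun N => by
    rw [Real.log_rpow (by norm_num)]; ring
  simp only [hden]
  have hbdd : IsBoundedUnder (· ≤ ·) atTop
      fun N : ℕ => Real.log (m N).toReal / -(N * Real.log 2) := by
    refine isBoundedUnder_of_eventually_le (a := (l:ℝ) + 15) ?_
    filter_upwards [eventually_ge_atTop 1] with N hN
    have hN1 : (1:ℝ) ≤ N := by exact_mod_cast hN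
    rw [div_neg, ← neg_div, div_le_iff₀ (by positivity)]
    have h1 := mlow N
    push_cast at h1
    have h2 : 0 ≤ ((N:ℝ) - 1) * (l + 14) * Real.log 2 :=
      mul_nonneg (mul_nonneg (by linarith) (by positivity)) hl2.le
    nlinarith
  refine le_of_forall_sub_le fun η hη => ?_
  refine le_liminf_of_le hbdd.isCoboundedUnder_ge ?_
  obtain ⟨J, hJ⟩ := h (η * Real.log 2 / 4) (by positivity)
  filter_upwards [eventually_ge_atTop (k + J + 1),
    (tendsto_natCast_atTop_atTop (R := ℝ)).eventually_ge_atTop ((k + J) * 2 / η)] with N hN hN2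
  rw [div_le_iff₀ hη] at hN2
  have hN1 : (0:ℝ) < N := by exact_mod_cast (by omega : 0 < N)
  have h1 := mup N (by omega)
  have h2 := hJ (2 * N - k - J)
  rw [show J + (2 * N - k - J) = 2 * N - k by omega] at h2
  have h3 : ((2 * N - k - J : ℕ) : ℝ) = 2 * N - k - J := by
    rw [Nat.cast_sub (by omega), Nat.cast_sub (by omega)]; push_cast; ring
  rw [h3] at h2
  rw [div_neg, ← neg_div, le_div_iff₀ (by positivity)]
  have h4 : 0 ≤ (N * η - (k + J) * 2) * Real.log 2 := mul_nonneg (by linarith) hl2.le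
  have h5 : 0 ≤ ((k:ℝ) + J) * (η * Real.log 2) := by positivity
  nlinarith

/-- For every `K > 0` and `λ²`-a.e. `(ξ,x) ∈ [0,1)²`,
`liminf_N log λ({y ∈ [0,1) : |H(ξ_{-N},y) - H(ξ_{-N},x_{-N})| ≤ K 2^{-N/2}}) / log 2^{-N} ≥ 1`. -/
theorem liminf_H_neighborhood_ge_one :
    ∀ K : ℝ, 0 < K →
      ∀ᵐ p ∂((volume : Measure (ℝ × ℝ)).restrict usq),
        1 ≤ Filter.liminf (fun N : ℕ =>
          Real.log (volume {y : ℝ | y ∈ Ico (0:ℝ) 1 ∧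
              ‖Hfn (bakerInvN N p).1 y
                  - Hfn (bakerInvN N p).1 (bakerInvN N p).2‖
                ≤ K * 2 ^ (-(N : ℝ) / 2)}).toReal
            / Real.log ((2 : ℝ) ^ (-(N : ℝ)))) Filter.atTop := by
  intro K hK
  rw [← PP_eq]
  filter_upwards [ae_uu_growth, ae_PP_mem] with p h hp
  simp only [volume_near_eq_mass K _ hp]
  exact one_le_liminf_of_growth hK hp h

end
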